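/- If κ is a Ramsey cardinal and α < κ⁺, then there is a Ramsey measure on κ whose rank in the order ◁ (where U ◁ W iff U ∈ N_W) is at least α. -/

import Mathlib

noncomputable section

namespace MPaper

open ZFSet

attribute [local instance] Classical.propDecidable

/-! ### Basic set-theoretic vocabulary over `ZFSet` -/

/-- The (external) cardinality of a ZFC set. -/
def zcard (x : ZFSet) : Cardinal := Cardinal.mk x.toSet

/-- `x` is a von Neumann ordinal: a transitive set of transitive sets. -/
def IsOrd (x : ZFSet) : Prop := x.IsTransitive ∧ ∀ y ∈ x, ZFSet.IsTransitive y

/-- `κ` is a cardinal: an ordinal not equinumerous with any of its members. -/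
def IsCard (κ : ZFSet) : Prop := IsOrd κ ∧ ∀ α ∈ κ, zcard α < zcard κ

/-- The ordinal `κ⁺`, the cardinal successor of `κ`. -/
def cardSuccOrd (κ : ZFSet) : Ordinal := (Order.succ (zcard κ)).ord

/-- `f` is a set-coded function with domain `d` (a set of Kuratowski pairs). -/
def IsZFunc (d f : ZFSet) : Prop :=
  (∀ p ∈ f, ∃ a ∈ d, ∃ b, p = ZFSet.pair a b) ∧ ∀ a ∈ d, ∃! b, ZFSet.pair a b ∈ f

/-- Application of a set-coded function. -/
def fapp (f a : ZFSet) : ZFSet :=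
  ⋃₀ (ZFSet.sep (fun b => ZFSet.pair a b ∈ f) (⋃₀ (⋃₀ f)))

/-- `f` maps `d` into `y`. -/
def MapsInto (f d y : ZFSet) : Prop := ∀ a ∈ d, fapp f a ∈ y

/-- `f` maps `d` onto `y`. -/
def SurjOnto (f d y : ZFSet) : Prop := MapsInto f d y ∧ ∀ b ∈ y, ∃ a ∈ d, fapp f a = b

/-- `f` is injective on `d`. -/
def InjOnZ (f d : ZFSet) : Prop := ∀ a ∈ d, ∀ b ∈ d, fapp f a = fapp f b → a = b

/-- `f` is a bijection from `d` onto `y`. -/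
def IsBij (f d y : ZFSet) : Prop := IsZFunc d f ∧ SurjOnto f d y ∧ InjOnZ f d

/-- The tail `κ ∖ α = {ξ ∈ κ | α ≤ ξ}` (for ordinals `α ∈ κ`). -/
def tailSet (κ α : ZFSet) : ZFSet := ZFSet.sep (fun ξ => ξ ∉ α) κ

/-- The relative complement `κ ∖ A`. -/
def compl (κ A : ZFSet) : ZFSet := ZFSet.sep (fun ξ => ξ ∉ A) κ

/-! ### First-order satisfaction in ∈-structures -/

/-- First order formulas in the language of set theory, with variables indexed by `ℕ`. -/
inductive Fml : Type
  | mem : ℕ → ℕ → Fml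
  | eq : ℕ → ℕ → Fml
  | impl : Fml → Fml → Fml
  | neg : Fml → Fml
  | all : ℕ → Fml → Fml

/-- Tarskian satisfaction of a formula in the ∈-structure with domain `D`. -/
def Sat (D : Set ZFSet) : Fml → (ℕ → ZFSet) → Prop
  | .mem i j, v => v i ∈ v j
  | .eq i j, v => v i = v j
  | .impl φ ψ, v => Sat D φ v → Sat D ψ v
  | .neg φ, v => ¬ Sat D φ v
  | .all n φ, v => ∀ x ∈ D, Sat D φ (Function.update v n x)

/-- `D` is an elementary substructure of `E` (as ∈-structures). -/
def ElemSub (D E : Set ZFSet) : Prop :=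
  D ⊆ E ∧ ∀ (φ : Fml) (v : ℕ → ZFSet), (∀ n, v n ∈ D) → (Sat D φ v ↔ Sat E φ v)

/-- `r` is a well-ordering of `x` (coded as a set of Kuratowski pairs). -/
def IsWellOrderOn (x r : ZFSet) : Prop :=
  (∀ p ∈ r, ∃ a ∈ x, ∃ b ∈ x, p = ZFSet.pair a b) ∧
  (∀ a ∈ x, ∀ b ∈ x, a = b ∨ ZFSet.pair a b ∈ r ∨ ZFSet.pair b a ∈ r) ∧
  (∀ a ∈ x, ∀ b ∈ x, ∀ c ∈ x,
    ZFSet.pair a b ∈ r → ZFSet.pair b c ∈ r → ZFSet.pair a c ∈ r) ∧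
  (∀ a ∈ x, ZFSet.pair a a ∉ r) ∧
  (∀ S : Set ZFSet, S ⊆ x.toSet → S.Nonempty → ∃ a ∈ S, ∀ b ∈ S, ZFSet.pair b a ∉ r)

/-- A transitive model of `ZFC⁻` (ZFC minus power set): a transitive set closed under
pairing and union, containing `ω`, satisfying the separation and collection schemes for
first-order formulas, and choice in the guise of the well-ordering principle.
(Extensionality and foundation hold automatically in transitive sets.) -/
def IsTransModel (M : ZFSet) : Prop :=
  M.IsTransitive ∧
  ZFSet.omega ∈ M ∧
  (∀ x ∈ M, ∀ y ∈ M, ({x, y} : ZFSet) ∈ M) ∧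
  (∀ x ∈ M, (⋃₀ x : ZFSet) ∈ M) ∧
  (∀ (φ : Fml) (v : ℕ → ZFSet), (∀ n, v n ∈ M) → ∀ a ∈ M,
    ∃ b ∈ M, ∀ x, x ∈ b ↔ x ∈ a ∧ Sat M.toSet φ (Function.update v 0 x)) ∧
  (∀ (φ : Fml) (v : ℕ → ZFSet), (∀ n, v n ∈ M) → ∀ a ∈ M,
    (∀ x ∈ a, ∃ y ∈ M, Sat M.toSet φ (Function.update (Function.update v 0 x) 1 y)) →
    ∃ b ∈ M, ∀ x ∈ a, ∃ y ∈ b, Sat M.toSet φ (Function.update (Function.update v 0 x) 1 y)) ∧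
  (∀ x ∈ M, ∃ r ∈ M, IsWellOrderOn x r)

/-! ### Weak κ-models, κ-models, M-ultrafilters -/

/-- A weak `κ`-model: a transitive model of ZFC⁻ of size `κ` with `κ ∈ M`. -/
def IsWeakModel (κ M : ZFSet) : Prop :=
  IsTransModel M ∧ κ ∈ M ∧ zcard M = zcard κ

/-- `M` is closed under `<κ`-sequences (of its elements). -/
def SeqClosed (κ M : ZFSet) : Prop :=
  ∀ γ ∈ κ, ∀ f : ZFSet, IsZFunc γ f → (∀ a ∈ γ, fapp f a ∈ M) → f ∈ M

/-- A `κ`-model: a weak `κ`-model closed under `<κ`-sequences. -/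
def IsKappaModel (κ M : ZFSet) : Prop := IsWeakModel κ M ∧ SeqClosed κ M

/-- `U` is an `M`-ultrafilter on `κ`: `⟨M, ∈, U⟩` thinks `U` is a normal ultrafilter on `κ`
containing all tail sets. -/
def IsMUltrafilter (κ M U : ZFSet) : Prop :=
  (∀ A ∈ U, A ∈ M ∧ A ⊆ κ) ∧
  (∀ α ∈ κ, tailSet κ α ∈ U) ∧
  (∅ : ZFSet) ∉ U ∧
  (∀ A ∈ U, ∀ B ∈ U, A ∩ B ∈ U) ∧
  (∀ A ∈ U, ∀ B, B ∈ M → B ⊆ κ → A ⊆ B → B ∈ U) ∧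
  (∀ B, B ∈ M → B ⊆ κ → B ∈ U ∨ compl κ B ∈ U) ∧
  (∀ f ∈ M, IsZFunc κ f → ZFSet.sep (fun ξ => fapp f ξ ∈ ξ) κ ∈ U →
    ∃ γ ∈ κ, ZFSet.sep (fun ξ => fapp f ξ = γ) κ ∈ U)

/-- `U` is weakly amenable for `M`: for every `X ∈ M` of size at most `κ` in `M`,
the intersection `X ∩ U` belongs to `M`. -/
def WeaklyAmenable (κ M U : ZFSet) : Prop :=
  ∀ X ∈ M, (∃ f ∈ M.toSet, IsZFunc κ f ∧ ∀ y ∈ X, ∃ ξ ∈ κ, fapp f ξ = y) →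
    X ∩ U ∈ M

/-- `U` is `ω₁`-intersecting: every countable collection of its members has a common element. -/
def OmegaOneIntersecting (U : ZFSet) : Prop :=
  ∀ s : ℕ → ZFSet, (∀ n, s n ∈ U) → ∃ x, ∀ n, x ∈ s n

/-- `M` contains (its version of) `V_κ`, i.e. the set of all sets of rank `< κ`. -/
def HasVkappa (κ M : ZFSet) : Prop :=
  ∃ v ∈ M.toSet, ∀ x, x ∈ v ↔ ZFSet.rank x < ZFSet.rank κ

/-! ### Small universe measures and the associated models `M_U`, `N_U` -/

/-- `M` is the minimal model associated to `U` (the collection of Mostowski collapses of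
well-founded relations on `κ` coded by sets in `U` and their complements): a weak `κ`-model
with `V_κ ∈ M` for which `U` is an `M`-ultrafilter, contained in every transitive
ZFC⁻-model `M'` with `κ ∈ M'` for which `U` is an `M'`-ultrafilter. -/
def IsMUModel (κ U M : ZFSet) : Prop :=
  IsWeakModel κ M ∧ HasVkappa κ M ∧ IsMUltrafilter κ M U ∧
  ∀ M', IsTransModel M' → κ ∈ M' → IsMUltrafilter κ M' U → M ⊆ M'

/-- A small universe measure on `κ`: a set `U` of subsets of `κ` of size `κ` whose associated
minimal model `M_U` exists (is a weak `κ`-model with `V_κ ∈ M_U` and `U` an `M_U`-ultrafilter). -/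
def IsSUMeasure (κ U : ZFSet) : Prop :=
  zcard U = zcard κ ∧ (∀ A ∈ U, A ⊆ κ) ∧ ∃ M, IsMUModel κ U M

/-- The minimal model `M_U` associated to a small universe measure `U`. -/
def MU (κ U : ZFSet) : ZFSet :=
  if h : ∃ M, IsMUModel κ U M then h.choose else ∅

/-- `j : M → N` is (up to isomorphism) the ultrapower embedding of `M` by the
`M`-ultrafilter `U` on `κ`, with `N` transitive (so the ultrapower is well-founded):
`j` is elementary, every element of `N` has the form `j(f)(κ)` for `f : κ → M` in `M`,
and `U` is the `M`-ultrafilter derived from `j` with seed `κ`. -/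
def IsUltrapowerEmb (κ M U N : ZFSet) (j : ZFSet → ZFSet) : Prop :=
  N.IsTransitive ∧
  (∀ x ∈ M, j x ∈ N) ∧
  (∀ (φ : Fml) (v : ℕ → ZFSet), (∀ n, v n ∈ M) →
    (Sat M.toSet φ v ↔ Sat N.toSet φ (fun n => j (v n)))) ∧
  (∀ a ∈ N, ∃ f ∈ M.toSet, IsZFunc κ f ∧ MapsInto f κ M ∧ fapp (j f) κ = a) ∧
  (∀ A ∈ M, A ⊆ κ → (A ∈ U ↔ κ ∈ j A))

/-- The ultrapower of `M_U` by `U` is well-founded. -/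
def UltrapowerWF (κ U : ZFSet) : Prop :=
  ∃ (N : ZFSet) (j : ZFSet → ZFSet), IsUltrapowerEmb κ (MU κ U) U N j

/-- A choice of transitive collapse of the ultrapower of `M_U` by `U`, with its embedding. -/
def upData (κ U : ZFSet) : ZFSet × (ZFSet → ZFSet) :=
  if h : ∃ p : ZFSet × (ZFSet → ZFSet), IsUltrapowerEmb κ (MU κ U) U p.1 p.2
  then h.choose else (∅, id)

/-- `N_U`: the transitive collapse of the ultrapower of `M_U` by `U` (when well-founded). -/
def NU (κ U : ZFSet) : ZFSet := (upData κ U).1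

/-- The ultrapower embedding `j_U : M_U → N_U`. -/
def jU (κ U : ZFSet) : ZFSet → ZFSet := (upData κ U).2

/-- `M_U⋆ = V_{j(κ)}^{N_U}`, the rank-initial segment of `N_U` below `j_U(κ)`. -/
def MUstar (κ U : ZFSet) : ZFSet :=
  ZFSet.sep (fun x => ZFSet.rank x < ZFSet.rank (jU κ U κ)) (NU κ U)

/-! ### Hereditary size, `H_{κ⁺}`, elementarity -/

/-- `x` has hereditary size at most `κ`. -/
def HeredLE (κ : ZFSet) : ZFSet → Prop :=
  WellFounded.fix ZFSet.mem_wf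
    (fun x ih => zcard x ≤ zcard κ ∧ ∀ y, ∀ h : y ∈ x, ih y h)

/-- The class `H_{κ⁺}` of sets of hereditary size at most `κ`. -/
def Hclass (κ : ZFSet) : Set ZFSet := { x | HeredLE κ x }

/-! ### The measures witnessing Ramsey and Ramsey-like cardinals -/

/-- A Ramsey measure on `κ`: a weakly amenable `ω₁`-intersecting small universe measure. -/
def IsRamseyMeasure (κ U : ZFSet) : Prop :=
  IsSUMeasure κ U ∧ WeaklyAmenable κ (MU κ U) U ∧ OmegaOneIntersecting U

/-- A strong Ramsey measure on `κ`: a weakly amenable small universe measure whose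
minimal model `M_U` is a `κ`-model. -/
def IsStrongRamseyMeasure (κ U : ZFSet) : Prop :=
  IsSUMeasure κ U ∧ WeaklyAmenable κ (MU κ U) U ∧ SeqClosed κ (MU κ U)

/-- A super Ramsey measure on `κ`: a strong Ramsey measure with `M_U ≺ H_{κ⁺}`. -/
def IsSuperRamseyMeasure (κ U : ZFSet) : Prop :=
  IsStrongRamseyMeasure κ U ∧ ElemSub (MU κ U).toSet (Hclass κ)

/-- `I` certifies `U`: `I` is an unbounded subset of `κ` and the sets in `U` are exactly
the subsets of `κ` in `M_U` containing a tail of `I`. -/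
def Certifies (κ U : ZFSet) (I : Set ZFSet) : Prop :=
  (∀ ξ ∈ I, ξ ∈ κ) ∧ (∀ α ∈ κ, ∃ ξ ∈ I, ξ ∉ α) ∧
  ∀ X ∈ (MU κ U).toSet, X ⊆ κ →
    (X ∈ U ↔ ∃ α ∈ κ.toSet, ∀ ξ ∈ I, ξ ∉ α → ξ ∈ X)

/-- A certified Ramsey measure on `κ`: a weakly amenable small universe measure which is
certified by some unbounded `I ⊆ κ`. -/
def IsCertifiedRamseyMeasure (κ U : ZFSet) : Prop :=
  IsSUMeasure κ U ∧ WeaklyAmenable κ (MU κ U) U ∧ ∃ I : Set ZFSet, Certifies κ U I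

/-! ### Relativized (internal) versions of the measure predicates -/

/-- `ω₁`-intersecting from the point of view of the transitive model `N`: every
`ω`-sequence of members of `U` lying in `N` has a common element. -/
def OmegaOneIntersectingIn (N U : ZFSet) : Prop :=
  ∀ f ∈ N.toSet, IsZFunc ZFSet.omega f → (∀ n ∈ ZFSet.omega, fapp f n ∈ U) →
    ∃ x, ∀ n ∈ ZFSet.omega, x ∈ fapp f n

/-- `N ⊨ U is a Ramsey measure on κ`, for a transitive ZFC⁻-model `N`: all components are
absolute except `ω₁`-intersectingness, which is evaluated using sequences in `N`. -/
def RamseyMeasureIn (N κ U : ZFSet) : Prop :=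
  U ∈ N ∧ IsSUMeasure κ U ∧ WeaklyAmenable κ (MU κ U) U ∧ OmegaOneIntersectingIn N U

/-- `N ⊨ U is a strong Ramsey measure on κ`: closure of `M_U` under `<κ`-sequences is
evaluated using the sequences lying in `N`. -/
def StrongRamseyMeasureIn (N κ U : ZFSet) : Prop :=
  U ∈ N ∧ IsSUMeasure κ U ∧ WeaklyAmenable κ (MU κ U) U ∧
  ∀ f ∈ N.toSet, ∀ γ ∈ κ, IsZFunc γ f → (∀ a ∈ γ, fapp f a ∈ MU κ U) → f ∈ MU κ U

/-- The class `H_{κ⁺}` as computed in `N`. -/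
def HclassIn (N κ : ZFSet) : Set ZFSet := { x | x ∈ N ∧ HeredLE κ x }

/-- `N ⊨ U is a super Ramsey measure on κ`. -/
def SuperRamseyMeasureIn (N κ U : ZFSet) : Prop :=
  StrongRamseyMeasureIn N κ U ∧ ElemSub (MU κ U).toSet (HclassIn N κ)

/-- `N ⊨ U is a certified Ramsey measure on κ` (the certifying set is required to lie in `N`). -/
def CertifiedRamseyMeasureIn (N κ U : ZFSet) : Prop :=
  U ∈ N ∧ IsSUMeasure κ U ∧ WeaklyAmenable κ (MU κ U) U ∧
  ∃ I ∈ N.toSet, Certifies κ U I.toSet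

/-! ### Goodness, witness collections, and the M-order -/

/-- `U` is `A`-good: `A ∈ M_U`. -/
def AGood (κ A U : ZFSet) : Prop := A ∈ MU κ U

/-- A witness collection of `Pm`-measures on `κ`: a collection of `Pm`-measures containing
an `A`-good one for every `A ⊆ κ`. -/
def IsWitness (Pm : ZFSet → ZFSet → Prop) (κ : ZFSet) (𝒰 : Set ZFSet) : Prop :=
  (∀ U ∈ 𝒰, Pm κ U) ∧ ∀ A : ZFSet, A ⊆ κ → ∃ U ∈ 𝒰, AGood κ A U

/-- The M-order on witness collections of `Pm`-measures on `κ`; `PmIn N κ U` is the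
relativization `N ⊨ U is a Pm-measure on κ`.  `MOrder Pm PmIn κ 𝒰 𝒲` says `𝒰 ◁ 𝒲`. -/
def MOrder (Pm : ZFSet → ZFSet → Prop) (PmIn : ZFSet → ZFSet → ZFSet → Prop)
    (κ : ZFSet) (𝒰 𝒲 : Set ZFSet) : Prop :=
  IsWitness Pm κ 𝒰 ∧ IsWitness Pm κ 𝒲 ∧
  (∀ W ∈ 𝒲, ∀ A ∈ (NU κ W).toSet, A ⊆ κ →
    ∃ U ∈ 𝒰, U ∈ NU κ W ∧ AGood κ A U ∧ PmIn (NU κ W) κ U) ∧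
  (∀ U ∈ 𝒰, ∃ W ∈ 𝒲, U ∈ NU κ W)

/-! ### Ranks -/

/-- The rank of a point in an arbitrary binary relation (`0` at non-accessible points). -/
def relRank {X : Type*} (r : X → X → Prop) (x : X) : Ordinal :=
  if h : Acc r x then h.rank else 0

/-- The M-rank `o_Pm(κ)`: the strict supremum of the M-ranks of all witness collections of
`Pm`-measures on `κ` (and `0` if there are none). -/
def oRank (Pm : ZFSet → ZFSet → Prop) (PmIn : ZFSet → ZFSet → ZFSet → Prop)
    (κ : ZFSet) : Ordinal :=
  sSup { o : Ordinal |
    ∃ 𝒰 : Set ZFSet, IsWitness Pm κ 𝒰 ∧ o = relRank (MOrder Pm PmIn κ) 𝒰 + 1 }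

/-- `N ⊨ o_Pm(κ) ≥ α`, defined by the recursion: for every `A ⊆ κ` in `N` and every `β < α`
there is an `A`-good `Pm`-measure `W` in `N` (in the sense of `N`) whose ultrapower satisfies
`o_Pm(κ) ≥ β`. -/
def oGEin (PmIn : ZFSet → ZFSet → ZFSet → Prop) (κ : ZFSet) : Ordinal → ZFSet → Prop :=
  WellFounded.fix wellFounded_lt fun α ih N =>
    ∀ A ∈ N.toSet, A ⊆ κ → ∀ β, ∀ h : β < α,
      ∃ W ∈ N.toSet, PmIn N κ W ∧ AGood κ A W ∧ ih β h (NU κ W)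

/-- `N ⊨ o_Pm(κ) = α`. -/
def oEQin (PmIn : ZFSet → ZFSet → ZFSet → Prop) (κ : ZFSet) (α : Ordinal) (N : ZFSet) : Prop :=
  oGEin PmIn κ α N ∧ ¬ oGEin PmIn κ (α + 1) N

/-! ### The M-order and M-rank relativized to a model `ℳ` -/

/-- A witness collection (coded as a set) of `Pm`-measures in the sense of the model `ℳ`. -/
def IsWitnessIn (PmIn : ZFSet → ZFSet → ZFSet → Prop) (ℳ κ 𝒰 : ZFSet) : Prop :=
  𝒰 ∈ ℳ ∧ (∀ U ∈ 𝒰, PmIn ℳ κ U) ∧ ∀ A ∈ ℳ.toSet, A ⊆ κ → ∃ U ∈ 𝒰.toSet, AGood κ A U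

/-- The M-order on witness collections as computed in `ℳ`. -/
def MOrderIn (PmIn : ZFSet → ZFSet → ZFSet → Prop) (ℳ κ : ZFSet) (𝒰 𝒲 : ZFSet) : Prop :=
  IsWitnessIn PmIn ℳ κ 𝒰 ∧ IsWitnessIn PmIn ℳ κ 𝒲 ∧
  (∀ W ∈ 𝒲, ∀ A ∈ (NU κ W).toSet, A ⊆ κ →
    ∃ U ∈ 𝒰.toSet, U ∈ NU κ W ∧ AGood κ A U ∧ PmIn (NU κ W) κ U) ∧
  (∀ U ∈ 𝒰, ∃ W ∈ 𝒲.toSet, U ∈ NU κ W)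

/-- The M-rank `o_Pm(κ)` as computed in `ℳ`. -/
def oRankIn (PmIn : ZFSet → ZFSet → ZFSet → Prop) (ℳ κ : ZFSet) : Ordinal :=
  sSup { o : Ordinal |
    ∃ 𝒰 : ZFSet, IsWitnessIn PmIn ℳ κ 𝒰 ∧ o = relRank (MOrderIn PmIn ℳ κ) 𝒰 + 1 }

/-! ### Practical models, cover and approximation properties -/

/-- `ℳ` is practical for `κ`: a transitive ZFC⁻-model containing `κ` in which
`V_{κ+3}` exists. -/
def Practical (κ ℳ : ZFSet) : Prop :=
  IsTransModel ℳ ∧ κ ∈ ℳ ∧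
  ∃ v ∈ ℳ.toSet, ∀ x, x ∈ v ↔ (x ∈ ℳ ∧ ZFSet.rank x < ZFSet.rank κ + 3)

/-- `x` has size less than `δ` as witnessed inside the class `D`:
some `f ∈ D` injects `x` into an ordinal `γ ∈ δ`. -/
def SizeLTin (D : Set ZFSet) (x δ : ZFSet) : Prop :=
  ∃ γ ∈ δ.toSet, ∃ f ∈ D, IsZFunc x f ∧ MapsInto f x γ ∧ InjOnZ f x

/-- The pair `D ⊆ D'` has the `δ`-cover property. -/
def CoverProperty (δ : ZFSet) (D D' : Set ZFSet) : Prop :=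
  ∀ X ∈ D', X.toSet ⊆ D → SizeLTin D' X δ →
    ∃ Y ∈ D, X ⊆ Y ∧ SizeLTin D Y δ

/-- The pair `D ⊆ D'` has the `δ`-approximation property. -/
def ApproxProperty (δ : ZFSet) (D D' : Set ZFSet) : Prop :=
  ∀ X ∈ D', X.toSet ⊆ D → (∀ x ∈ D, SizeLTin D x δ → X ∩ x ∈ D) → X ∈ D

/-- `δ` is a cardinal from the point of view of the class `D`. -/
def IsCardIn (D : Set ZFSet) (δ : ZFSet) : Prop :=
  IsOrd δ ∧ δ ∈ D ∧ ∀ γ ∈ δ, ¬ ∃ f ∈ D, IsZFunc γ f ∧ SurjOnto f γ δ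

/-- `δ` is a regular (infinite) cardinal from the point of view of the class `D`. -/
def IsRegularIn (D : Set ZFSet) (δ : ZFSet) : Prop :=
  IsCardIn D δ ∧ ZFSet.omega ⊆ δ ∧
  ∀ γ ∈ δ, ∀ f ∈ D, IsZFunc γ f → MapsInto f γ δ →
    ∃ β ∈ δ, ∀ a ∈ γ, fapp f a ∈ β

/-- `H_λ` as computed in the model `V`: the members of `V` having, in `V`,
a transitive superset of size `< λ`. -/
def HIn (V lam : ZFSet) : Set ZFSet :=
  { x | x ∈ V ∧ ∃ t ∈ V.toSet, x ⊆ t ∧ t.IsTransitive ∧ SizeLTin V.toSet t lam }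

/-- `V` and `V'` have the same ordinals. -/
def SameOrdinals (D D' : Set ZFSet) : Prop :=
  ∀ α, IsOrd α → (α ∈ D ↔ α ∈ D')

/-- Every `ω`-sequence of elements of `ℳ` lying in `ℳ'` is an element of `ℳ`. -/
def OmegaSeqClosedPair (ℳ ℳ' : ZFSet) : Prop :=
  ∀ f ∈ ℳ'.toSet, IsZFunc ZFSet.omega f → (∀ n ∈ ZFSet.omega, fapp f n ∈ ℳ) → f ∈ ℳ

/-! ### Large cardinal properties -/

/-- `κ` is Ramsey: every `A ⊆ κ` belongs to a weak `κ`-model `M` carrying a weakly amenable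
`ω₁`-intersecting `M`-ultrafilter on `κ`. -/
def IsRamseyCard (κ : ZFSet) : Prop :=
  IsCard κ ∧ ∀ A : ZFSet, A ⊆ κ →
    ∃ M, IsWeakModel κ M ∧ A ∈ M ∧
      ∃ U, IsMUltrafilter κ M U ∧ WeaklyAmenable κ M U ∧ OmegaOneIntersecting U

/-- `κ` is strongly Ramsey: the model `M` can moreover be taken to be a `κ`-model. -/
def IsStronglyRamseyCard (κ : ZFSet) : Prop :=
  IsCard κ ∧ ∀ A : ZFSet, A ⊆ κ →
    ∃ M, IsKappaModel κ M ∧ A ∈ M ∧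
      ∃ U, IsMUltrafilter κ M U ∧ WeaklyAmenable κ M U ∧ OmegaOneIntersecting U

/-- `κ` is super Ramsey: the model `M` can moreover be taken to be a `κ`-model
elementary in `H_{κ⁺}`. -/
def IsSuperRamseyCard (κ : ZFSet) : Prop :=
  IsCard κ ∧ ∀ A : ZFSet, A ⊆ κ →
    ∃ M, IsKappaModel κ M ∧ ElemSub M.toSet (Hclass κ) ∧ A ∈ M ∧
      ∃ U, IsMUltrafilter κ M U ∧ WeaklyAmenable κ M U ∧ OmegaOneIntersecting U

/-- `κ` is weakly super Ramsey: the model `M` is a weak `κ`-model elementary in `H_{κ⁺}`. -/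
def IsWeaklySuperRamseyCard (κ : ZFSet) : Prop :=
  IsCard κ ∧ ∀ A : ZFSet, A ⊆ κ →
    ∃ M, IsWeakModel κ M ∧ ElemSub M.toSet (Hclass κ) ∧ A ∈ M ∧
      ∃ U, IsMUltrafilter κ M U ∧ WeaklyAmenable κ M U ∧ OmegaOneIntersecting U

/-- `κ` is measurable: there is a `κ`-complete nonprincipal ultrafilter on (all) subsets
of `κ`. -/
def IsMeasurableCard (κ : ZFSet) : Prop :=
  IsCard κ ∧ ZFSet.omega ∈ κ ∧
  ∃ 𝒰 : Set ZFSet,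
    (∀ A ∈ 𝒰, A ⊆ κ) ∧ (∅ : ZFSet) ∉ 𝒰 ∧ κ ∈ 𝒰 ∧
    (∀ A ∈ 𝒰, ∀ B : ZFSet, B ⊆ κ → A ⊆ B → B ∈ 𝒰) ∧
    (∀ A : ZFSet, A ⊆ κ → (A ∈ 𝒰 ∨ compl κ A ∈ 𝒰)) ∧
    (∀ γ ∈ κ.toSet, ∀ s : ZFSet → ZFSet, (∀ i ∈ γ, s i ∈ 𝒰) →
      ZFSet.sep (fun ξ => ∀ i ∈ γ, ξ ∈ s i) κ ∈ 𝒰)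

/-! ### Relativized large-cardinal properties -/

/-- `N ⊨ κ is Ramsey` (for a transitive model `N`): the witnessing models and ultrafilters
lie in `N`, smallness of the models is witnessed in `N`, and `ω₁`-intersectingness is
evaluated using the sequences in `N`. -/
def RamseyCardIn (N κ : ZFSet) : Prop :=
  ∀ A ∈ N.toSet, A ⊆ κ →
    ∃ M ∈ N.toSet, A ∈ M ∧ IsTransModel M ∧ κ ∈ M ∧
      (∃ f ∈ N.toSet, IsZFunc κ f ∧ SurjOnto f κ M) ∧
      ∃ U ∈ N.toSet, IsMUltrafilter κ M U ∧ WeaklyAmenable κ M U ∧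
        OmegaOneIntersectingIn N U

/-- `N ⊨ κ is strongly Ramsey`. -/
def StronglyRamseyCardIn (N κ : ZFSet) : Prop :=
  ∀ A ∈ N.toSet, A ⊆ κ →
    ∃ M ∈ N.toSet, A ∈ M ∧ IsTransModel M ∧ κ ∈ M ∧
      (∃ f ∈ N.toSet, IsZFunc κ f ∧ SurjOnto f κ M) ∧
      (∀ f ∈ N.toSet, ∀ γ ∈ κ, IsZFunc γ f → (∀ a ∈ γ, fapp f a ∈ M) → f ∈ M) ∧
      ∃ U ∈ N.toSet, IsMUltrafilter κ M U ∧ WeaklyAmenable κ M U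

/-- `N ⊨ κ is super Ramsey`. -/
def SuperRamseyCardIn (N κ : ZFSet) : Prop :=
  ∀ A ∈ N.toSet, A ⊆ κ →
    ∃ M ∈ N.toSet, A ∈ M ∧ IsTransModel M ∧ κ ∈ M ∧
      (∃ f ∈ N.toSet, IsZFunc κ f ∧ SurjOnto f κ M) ∧
      (∀ f ∈ N.toSet, ∀ γ ∈ κ, IsZFunc γ f → (∀ a ∈ γ, fapp f a ∈ M) → f ∈ M) ∧
      ElemSub M.toSet (HclassIn N κ) ∧
      ∃ U ∈ N.toSet, IsMUltrafilter κ M U ∧ WeaklyAmenable κ M U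

/-! ### ω-special models -/

/-- A weak `κ`-model `M` is `ω`-special: it is the union of a chain
`M₀ ≺ M₁ ≺ ⋯` of elementary substructures of `M` with each `Mₙ ∈ M` and `|Mₙ|^M = κ`. -/
def OmegaSpecial (κ M : ZFSet) : Prop :=
  ∃ s : ℕ → ZFSet,
    (∀ n, s n ∈ M) ∧
    (∀ n, (s n).toSet ⊆ (s (n + 1)).toSet) ∧
    (∀ n, ElemSub (s n).toSet M.toSet) ∧
    (∀ n, ∃ f ∈ M.toSet, IsBij f κ (s n)) ∧
    (∀ x, x ∈ M ↔ ∃ n, x ∈ s n)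

/-! ### Iterated ultrapowers and α-iterability -/

/-- `U` is an `α`-iterable `M`-ultrafilter on `κ`: there is a coherent system of transitive
models `Mod β` (`β ≤ α`), with commuting elementary embeddings `e β γ : Mod β → Mod γ`,
critical sequence `cr β` and ultrafilter sequence `Us β`, starting at `(M, κ, U)`, where each
successor step is given by an ultrapower and each limit step is a (collapsed) direct limit. -/
def IsAlphaIterable (κ M U : ZFSet) (α : Ordinal) : Prop :=
  ∃ (Mod : Ordinal → ZFSet) (cr : Ordinal → ZFSet) (Us : Ordinal → ZFSet)
    (e : Ordinal → Ordinal → ZFSet → ZFSet),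
    Mod 0 = M ∧ cr 0 = κ ∧ Us 0 = U ∧
    (∀ β ≤ α, (Mod β).IsTransitive) ∧
    (∀ β ≤ α, ∀ x ∈ Mod β, e β β x = x) ∧
    (∀ β γ ρ : Ordinal, β ≤ γ → γ ≤ ρ → ρ ≤ α →
      ∀ x ∈ Mod β, e γ ρ (e β γ x) = e β ρ x) ∧
    (∀ β γ : Ordinal, β ≤ γ → γ ≤ α →
      (∀ x ∈ Mod β, e β γ x ∈ Mod γ) ∧
      ∀ (φ : Fml) (v : ℕ → ZFSet), (∀ n, v n ∈ Mod β) →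
        (Sat (Mod β).toSet φ v ↔ Sat (Mod γ).toSet φ (fun n => e β γ (v n)))) ∧
    (∀ β : Ordinal, β + 1 ≤ α →
      IsUltrapowerEmb (cr β) (Mod β) (Us β) (Mod (β + 1)) (e β (β + 1)) ∧
      cr (β + 1) = e β (β + 1) (cr β) ∧
      (∀ A, A ∈ Us (β + 1) ↔
        ∃ X ∈ (Mod β).toSet, X ∩ Us β ∈ Mod β ∧ A ∈ e β (β + 1) (X ∩ Us β))) ∧
    (∀ lam : Ordinal, lam ≤ α → lam ≠ 0 → (∀ β < lam, β + 1 < lam) →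
      (∀ x ∈ Mod lam, ∃ β < lam, ∃ y ∈ (Mod β).toSet, e β lam y = x) ∧
      cr lam = e 0 lam κ ∧
      (∀ A, A ∈ Us lam ↔ ∃ β < lam, ∃ B, B ∈ Us β ∧ e β lam B = A))

/-- `N ⊨ κ is α-iterable`: every `A ⊆ κ` in `N` belongs to a weak `κ`-model `M ∈ N` for
which there is a weakly amenable `α`-iterable `M`-ultrafilter `U ∈ N` on `κ`. -/
def AlphaIterableCardIn (N κ : ZFSet) (α : Ordinal) : Prop :=
  ∀ A ∈ N.toSet, A ⊆ κ →
    ∃ M ∈ N.toSet, A ∈ M ∧ IsTransModel M ∧ κ ∈ M ∧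
      (∃ f ∈ N.toSet, IsZFunc κ f ∧ SurjOnto f κ M) ∧
      ∃ U ∈ N.toSet, IsMUltrafilter κ M U ∧ WeaklyAmenable κ M U ∧
        IsAlphaIterable κ M U α

/-! ### Forcing -/

/-- `R` codes a partial order (of forcing conditions) on `P`: `pair p q ∈ R` means `p ≤ q`. -/
def IsPoset (P R : ZFSet) : Prop :=
  (∀ p ∈ R, ∃ a ∈ P, ∃ b ∈ P, p = ZFSet.pair a b) ∧
  (∀ p ∈ P, ZFSet.pair p p ∈ R) ∧
  (∀ p ∈ P, ∀ q ∈ P, ∀ r ∈ P,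
    ZFSet.pair p q ∈ R → ZFSet.pair q r ∈ R → ZFSet.pair p r ∈ R)

/-- `G` is an `ℳ`-generic filter on the poset `(P, R)`. -/
def IsGenericFilter (ℳ P R : ZFSet) (G : Set ZFSet) : Prop :=
  G ⊆ P.toSet ∧ G.Nonempty ∧
  (∀ p ∈ G, ∀ q ∈ G, ∃ r ∈ G, ZFSet.pair r p ∈ R ∧ ZFSet.pair r q ∈ R) ∧
  (∀ p ∈ G, ∀ q ∈ P.toSet, ZFSet.pair p q ∈ R → q ∈ G) ∧
  ∀ Dset ∈ ℳ.toSet, Dset ⊆ P →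
    (∀ p ∈ P.toSet, ∃ q ∈ Dset.toSet, ZFSet.pair q p ∈ R) →
    ∃ q ∈ G, q ∈ Dset

/-- `ℳ'` is the generic extension `ℳ[G]`: the least transitive ZFC⁻-model containing `ℳ`
and (a set coding) `G`, with the same ordinals as `ℳ`. -/
def IsGenericExt (ℳ ℳ' : ZFSet) (G : Set ZFSet) : Prop :=
  IsTransModel ℳ' ∧ ℳ ⊆ ℳ' ∧ (∃ g ∈ ℳ'.toSet, g.toSet = G) ∧
  SameOrdinals ℳ.toSet ℳ'.toSet ∧
  ∀ N', IsTransModel N' → ℳ ⊆ N' → (∃ g ∈ N'.toSet, g.toSet = G) → ℳ' ⊆ N'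

/-- `f ∈ D` is a cofinal map from `γ` into the ordinal `α`. -/
def CofinalMapIn (D : Set ZFSet) (γ α f : ZFSet) : Prop :=
  f ∈ D ∧ IsZFunc γ f ∧ MapsInto f γ α ∧
  ∀ b ∈ α, ∃ a ∈ γ, b ∈ fapp f a ∨ b = fapp f a

/-- `γ` is the cofinality of the ordinal `α` as computed in `D`. -/
def IsCofIn (D : Set ZFSet) (α γ : ZFSet) : Prop :=
  IsOrd γ ∧ (∃ f, CofinalMapIn D γ α f) ∧ ∀ γ' ∈ γ, ¬ ∃ f, CofinalMapIn D γ' α f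

/-- The pair `ℳ ⊆ ℳ'` preserves all cofinalities. -/
def PreservesCofinalities (ℳ ℳ' : ZFSet) : Prop :=
  ∀ α ∈ ℳ.toSet, IsOrd α → ∀ γ, (IsCofIn ℳ.toSet α γ ↔ IsCofIn ℳ'.toSet α γ)

/-- The order on Ramsey measures on `κ`: `U ◁ W` iff `U ∈ N_W`. -/
def ramseyMeasureOrder (κ : ZFSet) (U W : ZFSet) : Prop :=
  IsRamseyMeasure κ U ∧ IsRamseyMeasure κ W ∧ U ∈ NU κ W

universe u

/-! ### A calculus of definable predicates -/

@[simp] theorem mem_toSet' {x y : ZFSet.{u}} : y ∈ x.toSet ↔ y ∈ x := Iff.rfl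

/-- de Bruijn terms with constants -/
inductive Tm : Type (u+1)
  | var : ℕ → Tm
  | cst : ZFSet.{u} → Tm

/-- de Bruijn formulas with constants -/
inductive Fm : Type (u+1)
  | mem : Tm.{u} → Tm.{u} → Fm
  | eq : Tm.{u} → Tm.{u} → Fm
  | impl : Fm → Fm → Fm
  | neg : Fm → Fm
  | all : Fm → Fm

/-- an environment: domain, interpretation of constants, valuation -/
structure Env : Type (u+1) where
  D : ZFSet.{u}
  e : ZFSet.{u} → ZFSet.{u}
  v : ℕ → ZFSet.{u}

instance : CoeFun Env.{u} (fun _ => ℕ → ZFSet.{u}) := ⟨Env.v⟩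

def pushV (v : ℕ → ZFSet.{u}) (x : ZFSet.{u}) : ℕ → ZFSet.{u}
  | 0 => x
  | (n+1) => v n

def Env.push (E : Env.{u}) (x : ZFSet.{u}) : Env := ⟨E.D, E.e, pushV E.v x⟩
def Env.tail (E : Env.{u}) : Env := ⟨E.D, E.e, fun n => E.v (n+1)⟩
def Env.ren (E : Env.{u}) (σ : ℕ → ℕ) : Env := ⟨E.D, E.e, fun n => E.v (σ n)⟩

def Tm.val (E : Env.{u}) : Tm.{u} → ZFSet.{u}
  | .var n => E.v n
  | .cst c => E.e c

def Fm.sat : Fm.{u} → Env.{u} → Prop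
  | .mem s t, E => s.val E ∈ t.val E
  | .eq s t, E => s.val E = t.val E
  | .impl φ ψ, E => φ.sat E → ψ.sat E
  | .neg φ, E => ¬ φ.sat E
  | .all φ, E => ∀ x ∈ E.D, φ.sat (E.push x)

def Tm.ren (σ : ℕ → ℕ) : Tm.{u} → Tm.{u}
  | .var n => .var (σ n)
  | .cst c => .cst c

def liftR (σ : ℕ → ℕ) : ℕ → ℕ
  | 0 => 0
  | (n+1) => σ n + 1

def Fm.ren : (ℕ → ℕ) → Fm.{u} → Fm.{u}
  | σ, .mem s t => .mem (s.ren σ) (t.ren σ)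
  | σ, .eq s t => .eq (s.ren σ) (t.ren σ)
  | σ, .impl φ ψ => .impl (φ.ren σ) (ψ.ren σ)
  | σ, .neg φ => .neg (φ.ren σ)
  | σ, .all φ => .all (φ.ren (liftR σ))

def Tm.consts : Tm.{u} → List ZFSet.{u}
  | .var _ => []
  | .cst c => [c]

def Fm.consts : Fm.{u} → List ZFSet.{u}
  | .mem s t => s.consts ++ t.consts
  | .eq s t => s.consts ++ t.consts
  | .impl φ ψ => φ.consts ++ ψ.consts
  | .neg φ => φ.consts
  | .all φ => φ.consts

theorem Tm.val_ren (t : Tm.{u}) (σ : ℕ → ℕ) (E : Env) : (t.ren σ).val E = t.val (E.ren σ) := by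
  cases t <;> rfl

theorem Tm.consts_ren (t : Tm.{u}) (σ : ℕ → ℕ) : (t.ren σ).consts = t.consts := by
  cases t <;> rfl

theorem Fm.sat_ren (φ : Fm.{u}) : ∀ (σ : ℕ → ℕ) (E : Env),
    (φ.ren σ).sat E ↔ φ.sat (E.ren σ) := by
  induction φ with
  | mem s t => intro σ E; simp [Fm.ren, Fm.sat, Tm.val_ren]
  | eq s t => intro σ E; simp [Fm.ren, Fm.sat, Tm.val_ren]
  | impl φ ψ h1 h2 => intro σ E; simp [Fm.ren, Fm.sat, h1, h2]
  | neg φ h => intro σ E; simp [Fm.ren, Fm.sat, h]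
  | all φ h =>
    intro σ E
    have : ∀ x, (E.push x).ren (liftR σ) = (E.ren σ).push x := by
      intro x
      simp only [Env.push, Env.ren, Env.mk.injEq, true_and]
      funext n
      cases n <;> rfl
    simp only [Fm.ren, Fm.sat, h, this]
    rfl

theorem Fm.consts_ren (φ : Fm.{u}) : ∀ (σ : ℕ → ℕ), (φ.ren σ).consts = φ.consts := by
  induction φ with
  | mem s t => intro σ; simp [Fm.ren, Fm.consts, Tm.consts_ren]
  | eq s t => intro σ; simp [Fm.ren, Fm.consts, Tm.consts_ren]
  | impl φ ψ h1 h2 => intro σ; simp [Fm.ren, Fm.consts, h1, h2]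
  | neg φ h => intro σ; simp [Fm.ren, Fm.consts, h]
  | all φ h => intro σ; simp [Fm.ren, Fm.consts, h]

theorem Fm.sat_congr (φ : Fm.{u}) : ∀ (D : ZFSet) (e e' : ZFSet → ZFSet) (v : ℕ → ZFSet),
    (∀ c ∈ φ.consts, e c = e' c) → (φ.sat ⟨D, e, v⟩ ↔ φ.sat ⟨D, e', v⟩) := by
  have ht : ∀ (t : Tm.{u}) (D : ZFSet) (e e' : ZFSet → ZFSet) (v : ℕ → ZFSet),
    (∀ c ∈ t.consts, e c = e' c) → t.val ⟨D, e, v⟩ = t.val ⟨D, e', v⟩ := by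
    intro t D e e' v h
    cases t with
    | var n => rfl
    | cst c => exact h c (by simp [Tm.consts])
  induction φ with
  | mem s t =>
    intro D e e' v h
    simp only [Fm.consts, List.mem_append] at h
    simp only [Fm.sat]
    rw [ht s D e e' v (fun c hc => h c (Or.inl hc)), ht t D e e' v (fun c hc => h c (Or.inr hc))]
  | eq s t =>
    intro D e e' v h
    simp only [Fm.consts, List.mem_append] at h
    simp only [Fm.sat]
    rw [ht s D e e' v (fun c hc => h c (Or.inl hc)), ht t D e e' v (fun c hc => h c (Or.inr hc))]
  | impl φ ψ h1 h2 =>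
    intro D e e' v h
    simp only [Fm.consts, List.mem_append] at h
    simp only [Fm.sat]
    rw [h1 D e e' v (fun c hc => h c (Or.inl hc)), h2 D e e' v (fun c hc => h c (Or.inr hc))]
  | neg φ h1 =>
    intro D e e' v h
    simp only [Fm.sat]
    rw [h1 D e e' v h]
  | all φ h1 =>
    intro D e e' v h
    simp only [Fm.sat]
    refine forall_congr' fun x => forall_congr' fun _ => ?_
    exact h1 D e e' (pushV v x) h

theorem Fm.tr (φ : Fm.{u}) : ∀ (ρ : ℕ → ℕ) (γ : ZFSet → ℕ) (K : ℕ), (∀ i, ρ i < K) →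
    (∀ c, γ c < K) → ∃ ψ : Fml, ∀ (D : ZFSet) (w : ℕ → ZFSet),
      Sat D.toSet ψ w ↔ φ.sat ⟨D, fun c => w (γ c), fun i => w (ρ i)⟩ := by
  have ht : ∀ (t : Tm.{u}) (ρ : ℕ → ℕ) (γ : ZFSet → ℕ), ∃ n : ℕ, ∀ (D : ZFSet) (w : ℕ → ZFSet),
      t.val ⟨D, fun c => w (γ c), fun i => w (ρ i)⟩ = w n := by
    intro t ρ γ
    cases t with
    | var n => exact ⟨ρ n, fun _ _ => rfl⟩
    | cst c => exact ⟨γ c, fun _ _ => rfl⟩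
  induction φ with
  | mem s t =>
    intro ρ γ K _ _
    obtain ⟨a, ha⟩ := ht s ρ γ
    obtain ⟨b, hb⟩ := ht t ρ γ
    refine ⟨.mem a b, fun D w => ?_⟩
    simp only [Fm.sat, Sat, ha, hb]
  | eq s t =>
    intro ρ γ K _ _
    obtain ⟨a, ha⟩ := ht s ρ γ
    obtain ⟨b, hb⟩ := ht t ρ γ
    refine ⟨.eq a b, fun D w => ?_⟩
    simp only [Fm.sat, Sat, ha, hb]
  | impl φ ψ h1 h2 =>
    intro ρ γ K hρ hγ
    obtain ⟨a, ha⟩ := h1 ρ γ K hρ hγ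
    obtain ⟨b, hb⟩ := h2 ρ γ K hρ hγ
    refine ⟨.impl a b, fun D w => ?_⟩
    simp only [Fm.sat, Sat, ha, hb]
  | neg φ h1 =>
    intro ρ γ K hρ hγ
    obtain ⟨a, ha⟩ := h1 ρ γ K hρ hγ
    refine ⟨.neg a, fun D w => ?_⟩
    simp only [Fm.sat, Sat, ha]
  | all φ h1 =>
    intro ρ γ K hρ hγ
    let ρ' : ℕ → ℕ := fun n => match n with
      | 0 => K
      | (m+1) => ρ m
    obtain ⟨a, ha⟩ := h1 ρ' γ (K+1) (by
      intro i
      cases i with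
      | zero => exact Nat.lt_succ_self K
      | succ m => exact Nat.lt_succ_of_lt (hρ m)) (fun c => Nat.lt_succ_of_lt (hγ c))
    refine ⟨.all K a, fun D w => ?_⟩
    simp only [Fm.sat, Sat, ha]
    refine forall_congr' fun x => forall_congr' fun _ => ?_
    have e1 : (fun c => Function.update w K x (γ c)) = fun c => w (γ c) := by
      funext c
      exact Function.update_of_ne (hγ c).ne _ _
    have e2 : (fun i => Function.update w K x (ρ' i)) = pushV (fun i => w (ρ i)) x := by
      funext i
      cases i with
      | zero => exact Function.update_self _ _ _
      | succ m => exact Function.update_of_ne (hρ m).ne _ _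
    rw [e1, e2]
    rfl

abbrev StrC := Set (ZFSet.{u} × (ZFSet.{u} → ZFSet.{u}))

def Env.ok (𝒞 : StrC.{u}) (E : Env.{u}) : Prop := (E.D, E.e) ∈ 𝒞 ∧ ∀ n, E.v n ∈ E.D

theorem Env.ok.push {𝒞 : StrC.{u}} {E : Env.{u}} (h : E.ok 𝒞) {x} (hx : x ∈ E.D) :
    (E.push x).ok 𝒞 := ⟨h.1, fun n => by
      cases n with
      | zero => exact hx
      | succ m => exact h.2 m⟩

theorem Env.ok.tail {𝒞 : StrC.{u}} {E : Env.{u}} (h : E.ok 𝒞) : (E.tail).ok 𝒞 :=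
  ⟨h.1, fun n => h.2 (n+1)⟩

theorem Env.ok.ren {𝒞 : StrC.{u}} {E : Env.{u}} (h : E.ok 𝒞) (σ) : (E.ren σ).ok 𝒞 :=
  ⟨h.1, fun n => h.2 (σ n)⟩

/-- uniformly definable predicates over a class of structures -/
def Dfn (𝒞 : StrC.{u}) (P : Env.{u} → Prop) : Prop :=
  ∃ φ : Fm.{u}, (∀ c ∈ φ.consts, ∀ s ∈ 𝒞, s.2 c ∈ s.1) ∧ ∀ E, E.ok 𝒞 → (φ.sat E ↔ P E)

namespace Dfn
variable {𝒞 : StrC.{u}} {P Q : Env.{u} → Prop}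

theorem congr (h : Dfn 𝒞 P) (hPQ : ∀ E, E.ok 𝒞 → (P E ↔ Q E)) : Dfn 𝒞 Q := by
  obtain ⟨φ, h1, h2⟩ := h
  exact ⟨φ, h1, fun E hE => (h2 E hE).trans (hPQ E hE)⟩

theorem imp (h : Dfn 𝒞 P) (h' : Dfn 𝒞 Q) : Dfn 𝒞 (fun E => P E → Q E) := by
  obtain ⟨φ, h1, h2⟩ := h
  obtain ⟨ψ, h3, h4⟩ := h'
  refine ⟨.impl φ ψ, ?_, fun E hE => ?_⟩
  · intro c hc
    rcases List.mem_append.1 hc with hc | hc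
    exacts [h1 c hc, h3 c hc]
  · simp only [Fm.sat, h2 E hE, h4 E hE]

theorem not (h : Dfn 𝒞 P) : Dfn 𝒞 (fun E => ¬ P E) := by
  obtain ⟨φ, h1, h2⟩ := h
  exact ⟨.neg φ, h1, fun E hE => by simp only [Fm.sat, h2 E hE]⟩

theorem and (h : Dfn 𝒞 P) (h' : Dfn 𝒞 Q) : Dfn 𝒞 (fun E => P E ∧ Q E) :=
  (h.imp h'.not).not.congr fun E _ => by tauto

theorem or (h : Dfn 𝒞 P) (h' : Dfn 𝒞 Q) : Dfn 𝒞 (fun E => P E ∨ Q E) :=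
  (h.not.imp h').congr fun E _ => by tauto

theorem iff (h : Dfn 𝒞 P) (h' : Dfn 𝒞 Q) : Dfn 𝒞 (fun E => P E ↔ Q E) :=
  ((h.imp h').and (h'.imp h)).congr fun E _ => by tauto

theorem all {Q : ZFSet → Env.{u} → Prop} (h : Dfn 𝒞 (fun E => Q (E 0) E.tail)) :
    Dfn 𝒞 (fun E => ∀ x ∈ E.D, Q x E) := by
  obtain ⟨φ, h1, h2⟩ := h
  refine ⟨.all φ, h1, fun E hE => ?_⟩
  simp only [Fm.sat]
  exact forall_congr' fun x => forall_congr' fun hx => h2 (E.push x) (hE.push hx)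

theorem ex {Q : ZFSet → Env.{u} → Prop} (h : Dfn 𝒞 (fun E => Q (E 0) E.tail)) :
    Dfn 𝒞 (fun E => ∃ x ∈ E.D, Q x E) :=
  (all (Q := fun x E => ¬ Q x E) h.not).not.congr fun E _ => by push Not; rfl

theorem ren (h : Dfn 𝒞 P) (σ : ℕ → ℕ) : Dfn 𝒞 (fun E => P (E.ren σ)) := by
  obtain ⟨φ, h1, h2⟩ := h
  exact ⟨φ.ren σ, by rwa [Fm.consts_ren], fun E hE => (Fm.sat_ren _ _ _).trans (h2 _ (hE.ren σ))⟩

theorem weak (h : Dfn 𝒞 P) : Dfn 𝒞 (fun E => P E.tail) := h.ren Nat.succ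

theorem memv (i j : ℕ) : Dfn 𝒞 (fun E => E i ∈ E j) :=
  ⟨.mem (.var i) (.var j), by simp [Fm.consts, Tm.consts], fun E _ => Iff.rfl⟩

theorem eqv (i j : ℕ) : Dfn 𝒞 (fun E => E i = E j) :=
  ⟨.eq (.var i) (.var j), by simp [Fm.consts, Tm.consts], fun E _ => Iff.rfl⟩

theorem triv : Dfn 𝒞 (fun _ => True) := (eqv 0 0).congr fun _ _ => by simp

theorem const (p : Prop) : Dfn 𝒞 (fun _ => p) := by
  by_cases h : p
  · exact triv.congr fun _ _ => by simp [h]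
  · exact triv.not.congr fun _ _ => by simp [h]

end Dfn

/-- definable terms -/
def T (𝒞 : StrC.{u}) (t : Env.{u} → ZFSet.{u}) : Prop :=
  (∀ E, E.ok 𝒞 → t E ∈ E.D) ∧ Dfn 𝒞 (fun E => E 0 = t E.tail)

namespace T
variable {𝒞 : StrC.{u}} {s t : Env.{u} → ZFSet.{u}}

theorem var (i : ℕ) : T 𝒞 (fun E => E i) := ⟨fun _ h => h.2 i, Dfn.eqv 0 (i+1)⟩

theorem ren (h : T 𝒞 t) (σ : ℕ → ℕ) : T 𝒞 (fun E => t (E.ren σ)) :=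
  ⟨fun E hE => h.1 _ (hE.ren σ), h.2.ren (liftR σ)⟩

theorem weak (h : T 𝒞 t) : T 𝒞 (fun E => t E.tail) := h.ren Nat.succ

theorem cst (c : ZFSet) (h : ∀ s ∈ 𝒞, s.2 c ∈ s.1) : T 𝒞 (fun E => E.e c) :=
  ⟨fun _ hE => h _ hE.1, ⟨.eq (.var 0) (.cst c), by simpa [Fm.consts, Tm.consts] using h,
    fun E _ => Iff.rfl⟩⟩

end T

namespace Dfn
variable {𝒞 : StrC.{u}} {s t r q : Env.{u} → ZFSet.{u}}

theorem subst {Q : ZFSet → Env.{u} → Prop} (h : Dfn 𝒞 (fun E => Q (E 0) E.tail)) (ht : T 𝒞 t) :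
    Dfn 𝒞 (fun E => Q (t E) E) :=
  (ex (Q := fun x E => x = t E ∧ Q x E) (ht.2.and h)).congr fun E hE => by
    constructor
    · rintro ⟨x, _, rfl, h⟩; exact h
    · intro h; exact ⟨_, ht.1 E hE, rfl, h⟩

theorem s1 {R : ZFSet → Prop} (h : Dfn 𝒞 (fun E => R (E 0))) (ht : T 𝒞 t) :
    Dfn 𝒞 (fun E => R (t E)) := subst (Q := fun x _ => R x) h ht

theorem s2 {R : ZFSet → ZFSet → Prop} (h : Dfn 𝒞 (fun E => R (E 0) (E 1)))
    (hs : T 𝒞 s) (ht : T 𝒞 t) : Dfn 𝒞 (fun E => R (s E) (t E)) :=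
  subst (Q := fun x E => R x (t E))
    (subst (Q := fun y E => R (E 0) y) (h.ren (fun n => match n with | 0 => 1 | 1 => 0 | n => n))
      ht.weak) hs

theorem s3 {R : ZFSet → ZFSet → ZFSet → Prop} (h : Dfn 𝒞 (fun E => R (E 0) (E 1) (E 2)))
    (hs : T 𝒞 s) (ht : T 𝒞 t) (hr : T 𝒞 r) : Dfn 𝒞 (fun E => R (s E) (t E) (r E)) :=
  subst (Q := fun x E => R x (t E) (r E))
    (subst (Q := fun y E => R (E 0) y (r E.tail))
      (subst (Q := fun z E => R (E 1) (E 0) z)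
        (h.ren (fun n => match n with | 0 => 2 | 1 => 1 | 2 => 0 | n => n))
        hr.weak.weak) ht.weak) hs

theorem s4 {R : ZFSet → ZFSet → ZFSet → ZFSet → Prop}
    (h : Dfn 𝒞 (fun E => R (E 0) (E 1) (E 2) (E 3)))
    (hs : T 𝒞 s) (ht : T 𝒞 t) (hr : T 𝒞 r) (hq : T 𝒞 q) :
    Dfn 𝒞 (fun E => R (s E) (t E) (r E) (q E)) :=
  subst (Q := fun x E => R x (t E) (r E) (q E))
    (subst (Q := fun y E => R (E 0) y (r E.tail) (q E.tail))
      (subst (Q := fun z E => R (E 1) (E 0) z (q E.tail.tail))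
        (subst (Q := fun z E => R (E 2) (E 1) (E 0) z)
        (h.ren (fun n => match n with | 0 => 3 | 1 => 2 | 2 => 1 | 3 => 0 | n => n))
        hq.weak.weak.weak) hr.weak.weak) ht.weak) hs

theorem mem (hs : T 𝒞 s) (ht : T 𝒞 t) : Dfn 𝒞 (fun E => s E ∈ t E) :=
  s2 (R := fun x y => x ∈ y) (memv 0 1) hs ht
theorem eq (hs : T 𝒞 s) (ht : T 𝒞 t) : Dfn 𝒞 (fun E => s E = t E) :=
  s2 (R := fun x y => x = y) (eqv 0 1) hs ht

end Dfn

class Tr (𝒞 : StrC.{u}) : Prop where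
  tr : ∀ s ∈ 𝒞, s.1.IsTransitive

namespace Dfn
variable {𝒞 : StrC.{u}} [Tr 𝒞] {s t r q : Env.{u} → ZFSet.{u}}

theorem ball {Q : ZFSet → Env.{u} → Prop} (ht : T 𝒞 t) (h : Dfn 𝒞 (fun E => Q (E 0) E.tail)) :
    Dfn 𝒞 (fun E => ∀ x ∈ t E, Q x E) :=
  (all (Q := fun x E => x ∈ t E → Q x E) ((mem (T.var 0) ht.weak).imp h)).congr fun E hE => by
    constructor
    · intro H x hx; exact H x (Tr.tr _ hE.1 _ (ht.1 E hE) hx) hx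
    · intro H x _ hx; exact H x hx

theorem bex {Q : ZFSet → Env.{u} → Prop} (ht : T 𝒞 t) (h : Dfn 𝒞 (fun E => Q (E 0) E.tail)) :
    Dfn 𝒞 (fun E => ∃ x ∈ t E, Q x E) :=
  (ball (Q := fun x E => ¬ Q x E) ht h.not).not.congr fun E _ => by push Not; rfl

theorem subset (hs : T 𝒞 s) (ht : T 𝒞 t) : Dfn 𝒞 (fun E => s E ⊆ t E) :=
  s2 (R := fun x y => x ⊆ y) (ball (T.var 0) (mem (T.var 0) (T.var 2))) hs ht

end Dfn

/-! Elementarity transfer and definable sets in a model -/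

theorem Dfn.elem {M N : ZFSet.{u}} {j : ZFSet → ZFSet} (m0 : ZFSet) (hm0 : m0 ∈ M)
    (hj : ∀ x ∈ M, j x ∈ N)
    (hel : ∀ (φ : Fml) (v : ℕ → ZFSet), (∀ n, v n ∈ M) →
      (Sat M.toSet φ v ↔ Sat N.toSet φ (fun n => j (v n))))
    {P : ZFSet → (ZFSet → ZFSet) → Prop}
    (h : Dfn {(M, id), (N, j)} (fun E => P E.D E.e)) : P M id ↔ P N j := by
  obtain ⟨φ, h1, h2⟩ := h
  obtain ⟨ψ, hψ⟩ := φ.tr (fun _ => 0) (fun c => 1 + φ.consts.idxOf c) (2 + φ.consts.length)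
    (fun _ => by omega) (fun c => by have := List.idxOf_le_length (a := c) (l := φ.consts); omega)
  let w : ℕ → ZFSet := fun n => match n with
    | 0 => m0
    | (k+1) => φ.consts.getD k m0
  have hw : ∀ n, w n ∈ M := by
    intro n
    cases n with
    | zero => exact hm0
    | succ k =>
      show φ.consts.getD k m0 ∈ M
      by_cases hk : k < φ.consts.length
      · rw [List.getD_eq_getElem _ _ hk]
        exact h1 _ (List.getElem_mem hk) (M, id) (by simp)
      · rw [List.getD_eq_default _ _ (by omega)]; exact hm0
  have hc : ∀ c ∈ φ.consts, w (1 + φ.consts.idxOf c) = c := by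
    intro c hc
    rw [add_comm]
    show φ.consts.getD _ m0 = c
    rw [List.getD_eq_getElem _ _ (List.idxOf_lt_length_of_mem hc)]
    exact List.getElem_idxOf _
  have a1 := (hψ M w).trans ((φ.sat_congr M _ id _ hc).trans (h2 ⟨M, id, fun _ => w 0⟩
    ⟨by simp, fun _ => hw 0⟩))
  have a2 := (hψ N (fun n => j (w n))).trans ((φ.sat_congr N _ j _ (fun c hc' => by
    simp only [hc c hc'])).trans (h2 ⟨N, j, fun _ => j (w 0)⟩ ⟨by simp, fun _ => hj _ (hw 0)⟩))
  exact a1.symm.trans ((hel ψ w hw).trans a2)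

/-- the one-structure class -/
abbrev one (M : ZFSet.{u}) : StrC.{u} := {(M, id)}

theorem Dfn.to_fml {M : ZFSet.{u}} (m0 : ZFSet) (hm0 : m0 ∈ M) {P : Env.{u} → Prop}
    (h : Dfn (one M) P) : ∃ (ψ : Fml) (w : ℕ → ZFSet), (∀ n, w n ∈ M) ∧
      ∀ x ∈ M, ∀ y ∈ M, (Sat M.toSet ψ (Function.update (Function.update w 0 x) 1 y) ↔
        P ⟨M, id, fun n => if n = 0 then x else y⟩) := by
  obtain ⟨φ, h1, h2⟩ := h
  obtain ⟨ψ, hψ⟩ := φ.tr (fun n => if n = 0 then 0 else 1) (fun c => 2 + φ.consts.idxOf c)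
    (3 + φ.consts.length)
    (fun _ => by split_ifs <;> omega)
    (fun c => by have := List.idxOf_le_length (a := c) (l := φ.consts); omega)
  let w : ℕ → ZFSet := fun n => match n with
    | 0 => m0
    | 1 => m0
    | (k+2) => φ.consts.getD k m0
  have hw : ∀ n, w n ∈ M := by
    intro n
    match n with
    | 0 => exact hm0
    | 1 => exact hm0
    | k+2 =>
      show φ.consts.getD k m0 ∈ M
      by_cases hk : k < φ.consts.length
      · rw [List.getD_eq_getElem _ _ hk]
        exact h1 _ (List.getElem_mem hk) (M, id) (by simp)
      · rw [List.getD_eq_default _ _ (by omega)]; exact hm0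
  have hc : ∀ c ∈ φ.consts, w (2 + φ.consts.idxOf c) = c := by
    intro c hc
    rw [add_comm]
    show φ.consts.getD _ m0 = c
    rw [List.getD_eq_getElem _ _ (List.idxOf_lt_length_of_mem hc)]
    exact List.getElem_idxOf _
  refine ⟨ψ, w, hw, fun x hx y hy => ?_⟩
  rw [hψ]
  have e2 : (fun i => Function.update (Function.update w 0 x) 1 y (if i = 0 then 0 else 1)) =
      fun n => if n = 0 then x else y := by
    funext i
    by_cases hi : i = 0 <;> simp [hi]
  rw [e2]
  refine ((φ.sat_congr M _ id _ ?_).trans (h2 _ ⟨by simp, ?_⟩))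
  · intro c hc'
    rw [Function.update_of_ne (by omega), Function.update_of_ne (by omega), hc c hc']; rfl
  · intro n
    dsimp only
    split_ifs <;> assumption

class TM (M : ZFSet.{u}) : Prop where
  h : IsTransModel M

instance {M : ZFSet.{u}} [h : TM M] : Tr (one M) := ⟨by
  rintro s rfl
  exact h.h.1⟩

namespace TM
variable {M : ZFSet.{u}} [TM M]

theorem tr {x y : ZFSet.{u}} (hx : x ∈ M) (hy : y ∈ x) : y ∈ M := (TM.h (M := M)).1 x hx hy
theorem omega_mem : ZFSet.omega ∈ M := (TM.h (M := M)).2.1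
theorem upair_mem {x y : ZFSet.{u}} (hx : x ∈ M) (hy : y ∈ M) : ({x, y} : ZFSet) ∈ M :=
  (TM.h (M := M)).2.2.1 x hx y hy
theorem sUnion_mem {x : ZFSet.{u}} (hx : x ∈ M) : (⋃₀ x : ZFSet) ∈ M :=
  (TM.h (M := M)).2.2.2.1 x hx

theorem sep_mem {P : ZFSet → Prop} {a : ZFSet} (ha : a ∈ M)
    (h : Dfn (one M) (fun E => P (E 0))) : ZFSet.sep P a ∈ M := by
  obtain ⟨ψ, w, hw, H⟩ := h.to_fml a ha
  obtain ⟨b, hb, hb'⟩ := (TM.h (M := M)).2.2.2.2.1 ψ w hw a ha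
  convert hb
  ext x
  rw [mem_sep, hb']
  refine and_congr_right fun hx => ?_
  have := H x (tr ha hx) (w 1) (hw 1)
  rw [show Function.update (Function.update w 0 x) 1 (w 1) = Function.update w 0 x by
    rw [Function.update_eq_self_iff]; simp] at this
  rw [this]; rfl

theorem coll {P : ZFSet → ZFSet → Prop} {a : ZFSet} (ha : a ∈ M)
    (h : Dfn (one M) (fun E => P (E 0) (E 1))) (hP : ∀ x ∈ a, ∃ y ∈ M, P x y) :
    ∃ b ∈ M, ∀ x ∈ a, ∃ y ∈ b, P x y := by
  obtain ⟨ψ, w, hw, H⟩ := h.to_fml a ha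
  have key : ∀ x ∈ M, ∀ y ∈ M, (Sat M.toSet ψ (Function.update (Function.update w 0 x) 1 y) ↔
    P x y) := fun x hx y hy => H x hx y hy
  obtain ⟨b, hb, hb'⟩ := (TM.h (M := M)).2.2.2.2.2.1 ψ w hw a ha (fun x hx => by
    obtain ⟨y, hy, h⟩ := hP x hx
    exact ⟨y, hy, (key x (tr ha hx) y hy).2 h⟩)
  refine ⟨b, hb, fun x hx => ?_⟩
  obtain ⟨y, hy, h⟩ := hb' x hx
  exact ⟨y, hy, (key x (tr ha hx) y (tr hb hy)).1 h⟩

theorem wo {x : ZFSet.{u}} (hx : x ∈ M) : ∃ r ∈ M, IsWellOrderOn x r :=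
  (TM.h (M := M)).2.2.2.2.2.2 x hx

end TM

/-! ### More definability -/

theorem Env.tail_v (E : Env.{u}) (n : ℕ) : E.tail n = E (n+1) := rfl
theorem Env.tail_D (E : Env.{u}) : E.tail.D = E.D := rfl
theorem Env.tail_e (E : Env.{u}) : E.tail.e = E.e := rfl

theorem eq_pair_iff {p a b : ZFSet.{u}} : p = pair a b ↔ ∃ x ∈ p, ∃ y ∈ p, ((∀ z ∈ x, z = a) ∧ a ∈ x) ∧
    (a ∈ y ∧ b ∈ y ∧ ∀ z ∈ y, z = a ∨ z = b) ∧ ∀ w ∈ p, w = x ∨ w = y := by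
  constructor
  · rintro rfl
    refine ⟨{a}, by simp [pair], {a, b}, by simp [pair], by simp, by simp, by simp [pair]⟩
  · rintro ⟨x, hx, y, hy, ⟨h1, h2⟩, ⟨h3, h4, h5⟩, h6⟩
    have e1 : x = {a} := by ext z; simp; exact ⟨h1 z, fun h => h ▸ h2⟩
    have e2 : y = {a, b} := by
      ext z; simp; exact ⟨h5 z, fun h => by rcases h with rfl | rfl <;> assumption⟩
    ext z
    simp only [pair, mem_pair]
    rw [← e1, ← e2]
    exact ⟨h6 z, fun h => by rcases h with rfl | rfl <;> assumption⟩

namespace Dfn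
variable {𝒞 : StrC.{u}} {s t r q : Env.{u} → ZFSet.{u}}

theorem eq_pair [Tr 𝒞] (hr : T 𝒞 r) (hs : T 𝒞 s) (ht : T 𝒞 t) :
    Dfn 𝒞 (fun E => r E = pair (s E) (t E)) := by
  refine s3 (R := fun p a b => p = pair a b) ?_ hr hs ht
  simp only [eq_pair_iff]
  refine bex (T.var 0) (bex (T.var 1) (and (and ?_ ?_) (and (and ?_ (and ?_ ?_)) ?_)))
  · exact ball (T.var 1) (eq (T.var 0) (T.var 4))
  · exact mem (T.var 3) (T.var 1)
  · exact mem (T.var 3) (T.var 0)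
  · exact mem (T.var 4) (T.var 0)
  · exact ball (T.var 0) (or (eq (T.var 0) (T.var 4)) (eq (T.var 0) (T.var 5)))
  · exact ball (T.var 2) (or (eq (T.var 0) (T.var 2)) (eq (T.var 0) (T.var 1)))

theorem pair_eq [Tr 𝒞] (hr : T 𝒞 r) (hs : T 𝒞 s) (ht : T 𝒞 t) :
    Dfn 𝒞 (fun E => pair (s E) (t E) = r E) :=
  (eq_pair hr hs ht).congr fun _ _ => eq_comm

theorem pair_mem [Tr 𝒞] (hs : T 𝒞 s) (ht : T 𝒞 t) (hr : T 𝒞 r) :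
    Dfn 𝒞 (fun E => pair (s E) (t E) ∈ r E) := by
  refine s3 (R := fun a b p => pair a b ∈ p) ?_ hs ht hr
  refine (bex (Q := fun p E => p = pair (E 0) (E 1)) (T.var 2)
    (eq_pair (T.var 0) (T.var 1) (T.var 2))).congr ?_
  intro E _
  simp

end Dfn

theorem mem_of_pair_mem {D a b f : ZFSet.{u}} (hD : D.IsTransitive) (hf : f ∈ D) (h : pair a b ∈ f) :
    a ∈ D ∧ b ∈ D := by
  have h1 : pair a b ∈ D := hD _ hf h
  have h2 : ({a, b} : ZFSet) ∈ D := hD _ h1 (by simp [pair])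
  exact ⟨hD _ h2 (by simp), hD _ h2 (by simp)⟩

theorem Dfn.isZFunc {𝒞 : StrC.{u}} [Tr 𝒞] {s t : Env.{u} → ZFSet.{u}} (hs : T 𝒞 s) (ht : T 𝒞 t) :
    Dfn 𝒞 (fun E => IsZFunc (s E) (t E)) := by
  refine s2 (R := IsZFunc) ?_ hs ht
  refine ((ball (Q := fun p E => ∃ a ∈ E 0, ∃ b ∈ E.D, p = pair a b) (T.var 1)
    (bex (T.var 1) (ex (eq_pair (T.var 2) (T.var 1) (T.var 0))))).and
    (ball (Q := fun a E => ∃ b ∈ E.D, pair a b ∈ E 1 ∧ ∀ b' ∈ E.D, pair a b' ∈ E 1 → b' = b)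
      (T.var 0) (ex (and (pair_mem (T.var 1) (T.var 0) (T.var 3))
        (all (imp (pair_mem (T.var 2) (T.var 0) (T.var 4)) (eq (T.var 0) (T.var 1)))))))).congr ?_
  intro E hE
  have hD := Tr.tr _ hE.1
  have hf := hE.2 1
  unfold IsZFunc
  refine and_congr (forall_congr' fun p => forall_congr' fun hp => exists_congr fun a =>
    and_congr_right fun ha => ?_) (forall_congr' fun a => forall_congr' fun ha => ?_)
  · constructor
    · rintro ⟨b, _, h⟩; exact ⟨b, h⟩
    · rintro ⟨b, rfl⟩; exact ⟨b, (mem_of_pair_mem hD hf hp).2, rfl⟩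
  · constructor
    · rintro ⟨b, _, h, h'⟩
      exact ⟨b, h, fun y hy => h' y (mem_of_pair_mem hD hf hy).2 hy⟩
    · rintro ⟨b, h, h'⟩
      exact ⟨b, (mem_of_pair_mem hD hf h).2, h, fun y _ hy => h' y hy⟩

/-! substituting constants for variables, in a single model -/

def Tm.cl (k : ℕ) (v : ℕ → ZFSet.{u}) : Tm.{u} → Tm.{u}
  | .var n => if n < k then .var n else .cst (v (n - k))
  | .cst c => .cst c

def Fm.cl (v : ℕ → ZFSet.{u}) : ℕ → Fm.{u} → Fm.{u}
  | k, .mem s t => .mem (s.cl k v) (t.cl k v)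
  | k, .eq s t => .eq (s.cl k v) (t.cl k v)
  | k, .impl φ ψ => .impl (φ.cl v k) (ψ.cl v k)
  | k, .neg φ => .neg (φ.cl v k)
  | k, .all φ => .all (φ.cl v (k+1))

def Env.cl (E : Env.{u}) (k : ℕ) (v : ℕ → ZFSet.{u}) : Env.{u} :=
  ⟨E.D, E.e, fun n => if n < k then E n else v (n - k)⟩

theorem Tm.val_cl (t : Tm.{u}) (k v) (E : Env) (hE : E.e = id) :
    (t.cl k v).val E = t.val (E.cl k v) := by
  cases t with
  | var n =>
    by_cases h : n < k <;> simp [Tm.cl, h, Tm.val, Env.cl, hE]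
  | cst c => rfl

theorem Fm.sat_cl (φ : Fm.{u}) (v : ℕ → ZFSet) : ∀ (k : ℕ) (E : Env) (_ : E.e = id),
    (φ.cl v k).sat E ↔ φ.sat (E.cl k v) := by
  induction φ with
  | mem s t => intro k E h; simp [Fm.cl, Fm.sat, Tm.val_cl, h]
  | eq s t => intro k E h; simp [Fm.cl, Fm.sat, Tm.val_cl, h]
  | impl φ ψ h1 h2 => intro k E h; simp [Fm.cl, Fm.sat, h1, h2, h]
  | neg φ h1 => intro k E h; simp [Fm.cl, Fm.sat, h1, h]
  | all φ h1 =>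
    intro k E h
    have : ∀ x, (E.push x).cl (k+1) v = (E.cl k v).push x := by
      intro x
      simp only [Env.push, Env.cl, Env.mk.injEq, true_and]
      funext n
      cases n <;> simp [pushV]
    simp only [Fm.cl, Fm.sat]
    refine forall_congr' fun x => forall_congr' fun _ => ?_
    rw [h1 (k+1) (E.push x) h, this]

theorem Fm.consts_cl (φ : Fm.{u}) (v : ℕ → ZFSet) : ∀ (k : ℕ), ∀ c ∈ (φ.cl v k).consts,
    c ∈ φ.consts ∨ ∃ n, c = v n := by
  have ht : ∀ (t : Tm.{u}) (k : ℕ), ∀ c ∈ (t.cl k v).consts, c ∈ t.consts ∨ ∃ n, c = v n := by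
    intro t k c hc
    cases t with
    | var n =>
      simp only [Tm.cl] at hc
      split_ifs at hc with h
      · simp [Tm.consts] at hc
      · simp [Tm.consts] at hc; exact Or.inr ⟨_, hc⟩
    | cst c => exact Or.inl hc
  induction φ with
  | mem s t =>
    intro k c hc
    rcases List.mem_append.1 hc with hc | hc <;> rcases ht _ _ _ hc with h | h <;>
      simp [Fm.consts, h]
  | eq s t =>
    intro k c hc
    rcases List.mem_append.1 hc with hc | hc <;> rcases ht _ _ _ hc with h | h <;>
      simp [Fm.consts, h]
  | impl φ ψ h1 h2 =>
    intro k c hc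
    rcases List.mem_append.1 hc with hc | hc
    · rcases h1 _ _ hc with h | h <;> simp [Fm.consts, h]
    · rcases h2 _ _ hc with h | h <;> simp [Fm.consts, h]
  | neg φ h1 => intro k c hc; exact h1 k c hc
  | all φ h1 => intro k c hc; exact h1 (k+1) c hc

section
variable {M : ZFSet.{u}}

theorem Dfn.cl {P : Env.{u} → Prop} (h : Dfn (one M) P) (k : ℕ) {E : Env.{u}} (hE : E.ok (one M)) :
    Dfn (one M) (fun E' => P (E'.cl k E.v)) := by
  obtain ⟨φ, h1, h2⟩ := h
  have hD : (E.D, E.e) = (M, id) := hE.1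
  have hD1 : E.D = M := congrArg Prod.fst hD
  have hv : ∀ n, E.v n ∈ M := fun n => hD1 ▸ hE.2 n
  refine ⟨φ.cl E.v k, ?_, ?_⟩
  · rintro c hc s rfl
    rcases φ.consts_cl _ _ c hc with h | ⟨n, rfl⟩
    · exact h1 c h _ rfl
    · exact hv n
  · intro E' hE'
    have he : (E'.D, E'.e) = (M, id) := hE'.1
    have he1 : E'.D = M := congrArg Prod.fst he
    have he2 : E'.e = id := congrArg Prod.snd he
    rw [Fm.sat_cl _ _ _ _ he2]
    refine h2 _ ⟨hE'.1, fun n => ?_⟩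
    simp only [Env.cl]
    split_ifs
    · exact hE'.2 n
    · rw [he1]; exact hv _

theorem okD {E : Env.{u}} (hE : E.ok (one M)) : E.D = M :=
  congrArg Prod.fst (show (E.D, E.e) = (M, id) from hE.1)

theorem okv {E : Env.{u}} (hE : E.ok (one M)) (n : ℕ) : E n ∈ M := okD hE ▸ hE.2 n

theorem Dfn.fix1 {Q : ZFSet → Env.{u} → Prop} (h : Dfn (one M) (fun E => Q (E 0) E.tail))
    {E : Env.{u}} (hE : E.ok (one M)) : Dfn (one M) (fun E' => Q (E' 0) E) :=
  (h.cl 1 hE).congr fun E' hE' => by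
    have : (E'.cl 1 E.v).tail = E := by
      have h1 : (E'.D, E'.e) = (M, id) := hE'.1
      have h2 : (E.D, E.e) = (M, id) := hE.1
      have h3 := h1.trans h2.symm
      simp only [Prod.mk.injEq] at h3
      cases E
      simp only [Env.tail, Env.cl, Env.mk.injEq, h3, true_and]
      funext n; simp
    rw [this]; rfl

theorem Dfn.fix2 {Q : ZFSet → ZFSet → Env.{u} → Prop}
    (h : Dfn (one M) (fun E => Q (E 0) (E 1) E.tail.tail))
    {E : Env.{u}} (hE : E.ok (one M)) : Dfn (one M) (fun E' => Q (E' 0) (E' 1) E) :=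
  (h.cl 2 hE).congr fun E' hE' => by
    have : (E'.cl 2 E.v).tail.tail = E := by
      have h1 : (E'.D, E'.e) = (M, id) := hE'.1
      have h2 : (E.D, E.e) = (M, id) := hE.1
      have h3 := h1.trans h2.symm
      simp only [Prod.mk.injEq] at h3
      cases E
      simp only [Env.tail, Env.cl, Env.mk.injEq, h3, true_and]
      funext n; simp
    rw [this]; rfl

theorem Dfn.allM {Q : ZFSet → Env.{u} → Prop} (h : Dfn (one M) (fun E => Q (E 0) E.tail)) :
    Dfn (one M) (fun E => ∀ x ∈ M, Q x E) :=
  (Dfn.all h).congr fun E hE => by rw [okD hE]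

theorem Dfn.exM {Q : ZFSet → Env.{u} → Prop} (h : Dfn (one M) (fun E => Q (E 0) E.tail)) :
    Dfn (one M) (fun E => ∃ x ∈ M, Q x E) :=
  (Dfn.ex h).congr fun E hE => by rw [okD hE]

theorem T.constM {c : ZFSet.{u}} (h : c ∈ M) : T (one M) (fun _ => c) := by
  have := T.cst (𝒞 := one M) c (by rintro s rfl; exact h)
  refine ⟨fun E hE => (okD hE).symm ▸ h, this.2.congr fun E hE => ?_⟩
  have h1 : (E.D, E.e) = (M, id) := hE.1
  have he2 : E.e = id := congrArg Prod.snd h1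
  show E.v 0 = E.e c ↔ _
  rw [he2]; rfl

theorem T.toM {t : Env.{u} → ZFSet.{u}} (h : T (one M) t) {E} (hE : E.ok (one M)) : t E ∈ M :=
  okD hE ▸ h.1 E hE

variable [TM M]

theorem T.mk' {t : Env.{u} → ZFSet.{u}} (h1 : ∀ E, E.ok (one M) → t E ∈ M)
    (h2 : Dfn (one M) (fun E => E 0 ∈ t E.tail)) : T (one M) t := by
  refine ⟨fun E hE => (okD hE).symm ▸ h1 E hE, ?_⟩
  have := Dfn.ren h2 (liftR Nat.succ)
  refine (Dfn.all (Q := fun x E => (x ∈ E 0 ↔ x ∈ t E.tail)) ((Dfn.memv 0 1).iff this)).congr ?_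
  intro E hE
  have hD := okD hE
  constructor
  · intro h
    ext z
    constructor
    · intro hz; exact (h z (hD ▸ TM.tr (okv hE 0) hz)).1 hz
    · intro hz; exact (h z (hD ▸ TM.tr (h1 _ hE.tail) hz)).2 hz
  · intro h x _; rw [h]

variable {s t r : Env.{u} → ZFSet.{u}}

theorem T.sep {Q : ZFSet → Env.{u} → Prop} (h : Dfn (one M) (fun E => Q (E 0) E.tail))
    (hs : T (one M) s) : T (one M) (fun E => ZFSet.sep (fun x => Q x E) (s E)) := by
  refine T.mk' (fun E hE => TM.sep_mem (hs.toM hE) (h.fix1 hE)) ?_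
  refine ((Dfn.mem (T.var 0) hs.weak).and h).congr fun E hE => ?_
  rw [mem_sep]

theorem T.upair (hs : T (one M) s) (ht : T (one M) t) : T (one M) (fun E => {s E, t E}) := by
  refine T.mk' (fun E hE => TM.upair_mem (hs.toM hE) (ht.toM hE)) ?_
  refine ((Dfn.eq (T.var 0) hs.weak).or (Dfn.eq (T.var 0) ht.weak)).congr fun E hE => ?_
  rw [mem_pair]

theorem T.sing (hs : T (one M) s) : T (one M) (fun E => {s E}) := by
  have := T.upair hs hs
  simpa [ZFSet.pair_eq_singleton] using this

theorem T.pair (hs : T (one M) s) (ht : T (one M) t) : T (one M) (fun E => pair (s E) (t E)) :=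
  T.upair (T.sing hs) (T.upair hs ht)

theorem T.sUnion (hs : T (one M) s) : T (one M) (fun E => (⋃₀ (s E) : ZFSet)) := by
  refine T.mk' (fun E hE => TM.sUnion_mem (hs.toM hE)) ?_
  refine (Dfn.bex (Q := fun x E => E 0 ∈ x) hs.weak (Dfn.memv 1 0)).congr fun E hE => ?_
  rw [mem_sUnion]

theorem T.union (hs : T (one M) s) (ht : T (one M) t) : T (one M) (fun E => s E ∪ t E) := by
  have := T.sUnion (T.upair hs ht)
  have e : ∀ x y : ZFSet.{u}, x ∪ y = ⋃₀ {x, y} := fun x y => by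
    ext z; simp
  simpa only [e] using this

theorem T.ins (hs : T (one M) s) (ht : T (one M) t) : T (one M) (fun E => insert (s E) (t E)) := by
  have := T.union (T.sing hs) ht
  have e : ∀ x y : ZFSet.{u}, insert x y = {x} ∪ y := fun x y => by
    ext z; simp
  simpa only [e] using this

theorem T.inter (hs : T (one M) s) (ht : T (one M) t) : T (one M) (fun E => s E ∩ t E) :=
  T.sep (Q := fun x E => x ∈ t E) (Dfn.mem (T.var 0) ht.weak) hs

theorem T.compl (hs : T (one M) s) (ht : T (one M) t) :
    T (one M) (fun E => compl (s E) (t E)) :=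
  T.sep (Q := fun x E => x ∉ t E) (Dfn.mem (T.var 0) ht.weak).not hs

theorem T.fapp (hs : T (one M) s) (ht : T (one M) t) : T (one M) (fun E => fapp (s E) (t E)) :=
  T.sUnion (T.sep (Q := fun b E => ZFSet.pair (t E) b ∈ s E)
    (Dfn.pair_mem ht.weak (T.var 0) hs.weak) (T.sUnion (T.sUnion hs)))

end

/-- image of a set under an arbitrary function -/
def im (f : ZFSet.{u} → ZFSet.{u}) (a : ZFSet.{u}) : ZFSet.{u} := ZFSet.range (fun x : a => f x.1)

@[simp] theorem mem_im {f : ZFSet.{u} → ZFSet.{u}} {a y : ZFSet.{u}} :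
    y ∈ im f a ↔ ∃ x ∈ a, f x = y := by
  unfold im
  rw [mem_range]
  constructor
  · rintro ⟨⟨x, hx⟩, h⟩; exact ⟨x, hx, h⟩
  · rintro ⟨x, hx, h⟩; exact ⟨⟨x, hx⟩, h⟩

/-- graph of a function on a set -/
def mkf (f : ZFSet.{u} → ZFSet.{u}) (a : ZFSet.{u}) : ZFSet.{u} := im (fun x => pair x (f x)) a

theorem pair_mem_mkf {f : ZFSet.{u} → ZFSet.{u}} {a x y : ZFSet.{u}} :
    pair x y ∈ mkf f a ↔ x ∈ a ∧ y = f x := by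
  simp only [mkf, mem_im, pair_inj]
  constructor
  · rintro ⟨_, h, rfl, rfl⟩; exact ⟨h, rfl⟩
  · rintro ⟨h, rfl⟩; exact ⟨x, h, rfl, rfl⟩

theorem IsZFunc.mkf (f : ZFSet.{u} → ZFSet.{u}) (a : ZFSet.{u}) : IsZFunc a (mkf f a) := by
  refine ⟨fun p hp => ?_, fun x hx => ⟨f x, pair_mem_mkf.2 ⟨hx, rfl⟩, fun y hy =>
    (pair_mem_mkf.1 hy).2⟩⟩
  obtain ⟨x, hx, rfl⟩ := mem_im.1 hp
  exact ⟨x, hx, _, rfl⟩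

theorem fapp_of_unique {f a b : ZFSet.{u}} (h : pair a b ∈ f) (h' : ∀ y, pair a y ∈ f → y = b) :
    fapp f a = b := by
  have : ZFSet.sep (fun b => pair a b ∈ f) (⋃₀ (⋃₀ f)) = {b} := by
    ext z
    simp only [mem_sep, mem_singleton]
    constructor
    · exact fun hz => h' z hz.2
    · rintro rfl
      refine ⟨?_, h⟩
      rw [mem_sUnion]
      refine ⟨{a, z}, ?_, by simp⟩
      rw [mem_sUnion]
      exact ⟨_, h, by simp [pair]⟩
  unfold fapp
  rw [this, sUnion_singleton]

theorem IsZFunc.fapp_mem {d f a : ZFSet.{u}} (h : IsZFunc d f) (ha : a ∈ d) : pair a (fapp f a) ∈ f := by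
  obtain ⟨b, hb, hb'⟩ := h.2 a ha
  rwa [fapp_of_unique hb hb']

theorem IsZFunc.fapp_eq {d f a b : ZFSet.{u}} (h : IsZFunc d f) (hp : pair a b ∈ f) : fapp f a = b := by
  obtain ⟨a', ha', b', e⟩ := h.1 _ hp
  rw [pair_inj] at e
  obtain ⟨rfl, rfl⟩ := e
  obtain ⟨c, _, hc⟩ := h.2 a ha'
  exact fapp_of_unique hp (fun y hy => (hc y hy).trans (hc b hp).symm)

theorem IsZFunc.dom {d f a b : ZFSet.{u}} (h : IsZFunc d f) (hp : pair a b ∈ f) : a ∈ d := by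
  obtain ⟨a', ha', b', e⟩ := h.1 _ hp
  rw [pair_inj] at e
  rw [e.1]; exact ha'

theorem IsZFunc.pair_mem_iff {d f a b : ZFSet.{u}} (h : IsZFunc d f) :
    pair a b ∈ f ↔ a ∈ d ∧ fapp f a = b :=
  ⟨fun hp => ⟨h.dom hp, h.fapp_eq hp⟩, fun ⟨ha, e⟩ => e ▸ h.fapp_mem ha⟩

theorem IsZFunc.ext {d f g : ZFSet.{u}} (hf : IsZFunc d f) (hg : IsZFunc d g)
    (h : ∀ a ∈ d, fapp f a = fapp g a) : f = g := by
  ext p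
  constructor
  · intro hp
    obtain ⟨a, ha, b, rfl⟩ := hf.1 p hp
    rw [hg.pair_mem_iff, ← h a ha, ← hf.pair_mem_iff]; exact hp
  · intro hp
    obtain ⟨a, ha, b, rfl⟩ := hg.1 p hp
    rw [hf.pair_mem_iff, h a ha, ← hg.pair_mem_iff]; exact hp

theorem fapp_mkf {f : ZFSet.{u} → ZFSet.{u}} {a x : ZFSet.{u}} (hx : x ∈ a) : fapp (mkf f a) x = f x :=
  (IsZFunc.mkf f a).fapp_eq (pair_mem_mkf.2 ⟨hx, rfl⟩)

section
variable {M : ZFSet.{u}} [TM M] {s t r : Env.{u} → ZFSet.{u}}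

theorem TM.im_mem {f : ZFSet.{u} → ZFSet.{u}} {a : ZFSet.{u}} (ha : a ∈ M)
    (hf : T (one M) (fun E => f (E 0))) : im f a ∈ M := by
  have h1 : ∀ x ∈ M, f x ∈ M := fun x hx => hf.toM (E := ⟨M, id, fun _ => x⟩) ⟨rfl, fun _ => hx⟩
  obtain ⟨b, hb, h⟩ := TM.coll (P := fun x y => y = f x) ha
    (hf.2.ren (fun n => match n with | 0 => 1 | 1 => 0 | n => n))
    (fun x hx => ⟨f x, h1 x (TM.tr ha hx), rfl⟩)
  have := TM.sep_mem (P := fun y => ∃ x ∈ a, y = f x) hb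
    (Dfn.bex (Q := fun x E => E 0 = f x) (T.constM ha)
      (hf.2.ren (fun n => match n with | 0 => 1 | 1 => 0 | n => n)))
  convert this
  ext y
  simp only [mem_im, mem_sep]
  constructor
  · rintro ⟨x, hx, rfl⟩
    obtain ⟨y, hy, rfl⟩ := h x hx
    exact ⟨hy, x, hx, rfl⟩
  · rintro ⟨_, x, hx, rfl⟩; exact ⟨x, hx, rfl⟩

theorem T.im {f : ZFSet.{u} → Env.{u} → ZFSet.{u}} (hf : T (one M) (fun E => f (E 0) E.tail))
    (hs : T (one M) s) : T (one M) (fun E => im (fun x => f x E) (s E)) := by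
  have key : Dfn (one M) (fun E => E 0 = f (E 1) E.tail.tail) := hf.2
  refine T.mk' (fun E hE => TM.im_mem (hs.toM hE) ⟨fun E' hE' => ?_, ?_⟩) ?_
  · have := hf.toM (E := E.push (E' 0)) (hE.push (by rw [okD hE]; exact okv hE' 0))
    rw [okD hE']; exact this
  · exact Dfn.fix2 (Q := fun a b E => a = f b E) key hE
  · refine (Dfn.bex (Q := fun x E => E 0 = f x E.tail) hs.weak
      (key.ren (fun n => match n with | 0 => 1 | 1 => 0 | n => n))).congr fun E hE => ?_
    simp only [mem_im, eq_comm]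

theorem T.mkf {f : ZFSet.{u} → Env.{u} → ZFSet.{u}} (hf : T (one M) (fun E => f (E 0) E.tail))
    (hs : T (one M) s) : T (one M) (fun E => mkf (fun x => f x E) (s E)) :=
  T.im (f := fun x E => ZFSet.pair x (f x E)) (T.pair (T.var 0) hf) hs

theorem T.prod (hs : T (one M) s) (ht : T (one M) t) :
    T (one M) (fun E => ZFSet.prod (s E) (t E)) := by
  have h := T.sUnion (T.im (f := fun x E => MPaper.im (fun y => ZFSet.pair x y) (t E))
    (T.im (f := fun y E => ZFSet.pair (E 0) y) (T.pair (T.var 1) (T.var 0)) ht.weak) hs)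
  convert h using 2
  ext z
  simp only [mem_prod, mem_sUnion, mem_im]
  constructor
  · rintro ⟨a, ha, b, hb, rfl⟩; exact ⟨_, ⟨a, ha, rfl⟩, by simp; exact hb⟩
  · rintro ⟨_, ⟨a, ha, rfl⟩, h⟩
    rw [mem_im] at h
    obtain ⟨b, hb, rfl⟩ := h
    exact ⟨a, ha, b, hb, rfl⟩

end

theorem Dfn.ne {𝒞 : StrC.{u}} {s t : Env.{u} → ZFSet.{u}} (hs : T 𝒞 s) (ht : T 𝒞 t) :
    Dfn 𝒞 (fun E => s E ≠ t E) := (Dfn.eq hs ht).not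

theorem TM.of {M c : ZFSet.{u}} [TM M] (h : T (one M) (fun _ => c)) : c ∈ M :=
  h.toM (E := ⟨M, id, fun _ => omega⟩) ⟨rfl, fun _ => TM.omega_mem⟩

theorem T.cst2 {M N c : ZFSet.{u}} {j : ZFSet.{u} → ZFSet.{u}} (hj : ∀ x ∈ M, j x ∈ N) (hc : c ∈ M) :
    T {(M, id), (N, j)} (fun E => E.e c) := T.cst c (by
      rintro s (rfl | rfl)
      · exact hc
      · exact hj c hc)

theorem TM.sep_mem' {M a : ZFSet.{u}} [TM M] {P : ZFSet.{u} → Prop} (ha : a ∈ M)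
    (h : Dfn (one M) (fun E => P (E 0))) : ZFSet.sep P a ∈ M := TM.sep_mem ha h

theorem TM.empty_mem {M : ZFSet.{u}} [TM M] : (∅ : ZFSet) ∈ M := by
  have := TM.sep_mem (M := M) (P := fun _ => False) TM.omega_mem (Dfn.const _)
  convert this
  ext z; simp

theorem T.emp {M : ZFSet.{u}} [TM M] : T (one M) (fun _ => (∅ : ZFSet)) := T.constM TM.empty_mem

theorem T.tailSet {M : ZFSet.{u}} [TM M] {s t : Env.{u} → ZFSet.{u}} (hs : T (one M) s)
    (ht : T (one M) t) : T (one M) (fun E => tailSet (s E) (t E)) := T.compl hs ht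

/-- Proof by the definability calculus: the argument is filled in automatically. -/
theorem dfn {p : Prop} (h : p := by
  repeat' first
    | exact T.constM (by assumption)
    | exact T.var _
    | exact T.cst2 (by assumption) (by assumption)
    | exact T.emp
    | assumption
    | exact Dfn.const _
    | refine Dfn.isZFunc ?_ ?_
    | refine Dfn.not ?_
    | refine Dfn.allM ?_
    | refine Dfn.exM ?_
    | refine Dfn.all ?_
    | refine Dfn.ex ?_
    | refine Dfn.subset ?_ ?_
    | refine Dfn.ball ?_ ?_
    | refine Dfn.bex ?_ ?_
    | refine Dfn.and ?_ ?_
    | refine Dfn.or ?_ ?_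
    | refine Dfn.iff ?_ ?_
    | refine Dfn.eq_pair ?_ ?_ ?_
    | refine Dfn.pair_eq ?_ ?_ ?_
    | refine Dfn.pair_mem ?_ ?_ ?_
    | refine Dfn.mem ?_ ?_
    | refine Dfn.eq ?_ ?_
    | refine Dfn.ne ?_ ?_
    | refine Dfn.imp ?_ ?_
    | refine T.pair ?_ ?_
    | refine T.fapp ?_ ?_
    | refine T.upair ?_ ?_
    | refine T.sing ?_
    | refine T.ins ?_ ?_
    | refine T.sUnion ?_
    | refine T.union ?_ ?_
    | refine T.inter ?_ ?_
    | refine T.compl ?_ ?_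
    | refine T.tailSet ?_ ?_
    | refine T.prod ?_ ?_
    | refine T.mkf ?_ ?_
    | refine T.im ?_ ?_
    | refine T.sep ?_ ?_) : p := h

section
variable {M : ZFSet.{u}} [TM M]

theorem TM.choice {P : ZFSet → ZFSet → Prop} {a : ZFSet.{u}} (ha : a ∈ M)
    (h : Dfn (one M) (fun E => P (E 0) (E 1))) (hP : ∀ x ∈ a, ∃ y ∈ M, P x y) :
    ∃ f ∈ M, IsZFunc a f ∧ ∀ x ∈ a, P x (fapp f x) := by
  obtain ⟨b, hb, hb'⟩ := TM.coll ha h hP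
  obtain ⟨r, hr, h1, h2, h3, h4, h5⟩ := TM.wo hb
  have hPs : ∀ {s t : Env.{u} → ZFSet.{u}}, T (one M) s → T (one M) t →
    Dfn (one M) (fun E => P (s E) (t E)) := fun hs ht => Dfn.s2 (R := P) h hs ht
  let R : ZFSet → ZFSet → Prop := fun x y => y ∈ b ∧ P x y ∧ ∀ z ∈ b, P x z → pair z y ∉ r
  have hex : ∀ x ∈ a, ∃ y, R x y := by
    intro x hx
    obtain ⟨y, hy, hxy⟩ := hb' x hx
    obtain ⟨m, hm, hm'⟩ := h5 {y | y ∈ b ∧ P x y} (fun y hy => hy.1) ⟨y, hy, hxy⟩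
    exact ⟨m, hm.1, hm.2, fun z hz hz' => hm' z ⟨hz, hz'⟩⟩
  have hun : ∀ x y z, R x y → R x z → y = z := by
    intro x y z hy hz
    rcases h2 y hy.1 z hz.1 with h | h | h
    · exact h
    · exact absurd h (hz.2.2 y hy.1 hy.2.1)
    · exact absurd h (hy.2.2 z hz.1 hz.2.1)
  let f := ZFSet.sep (fun p => ∃ x ∈ a, ∃ y ∈ b, p = pair x y ∧ P x y ∧
    ∀ z ∈ b, P x z → pair z y ∉ r) (ZFSet.prod a b)
  have hf : f ∈ M := TM.sep_mem (TM.of dfn) (by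
    refine Dfn.bex dfn (Dfn.bex dfn (Dfn.and dfn (Dfn.and (hPs dfn dfn)
      (Dfn.ball dfn (Dfn.imp (hPs dfn dfn) dfn)))))  )
  have hpf : ∀ x y, pair x y ∈ f ↔ x ∈ a ∧ R x y := by
    intro x y
    simp only [f, mem_sep, pair_mem_prod, pair_inj]
    constructor
    · rintro ⟨_, x', hx, y', hy, ⟨rfl, rfl⟩, h⟩; exact ⟨hx, hy, h⟩
    · rintro ⟨hx, hy, h⟩; exact ⟨⟨hx, hy⟩, x, hx, y, hy, ⟨rfl, rfl⟩, h⟩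
  have hff : IsZFunc a f := by
    refine ⟨fun p hp => ?_, fun x hx => ?_⟩
    · simp only [f, mem_sep, mem_prod] at hp
      obtain ⟨⟨x, hx, y, _, rfl⟩, _⟩ := hp
      exact ⟨x, hx, y, rfl⟩
    · obtain ⟨y, hy⟩ := hex x hx
      exact ⟨y, (hpf x y).2 ⟨hx, hy⟩, fun z hz => hun x z y ((hpf x z).1 hz).2 hy⟩
  exact ⟨f, hf, hff, fun x hx => ((hpf x _).1 (hff.fapp_mem hx)).2.2.1⟩

theorem Dfn.sat (φ : Fml) : ∀ (t : ℕ → Env.{u} → ZFSet.{u}), (∀ n, T (one M) (t n)) →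
    Dfn (one M) (fun E => Sat M.toSet φ (fun n => t n E)) := by
  induction φ with
  | mem i j => intro t ht; exact Dfn.mem (ht i) (ht j)
  | eq i j => intro t ht; exact Dfn.eq (ht i) (ht j)
  | impl φ ψ h1 h2 => intro t ht; exact Dfn.imp (h1 t ht) (h2 t ht)
  | neg φ h1 => intro t ht; exact Dfn.not (h1 t ht)
  | all n φ h1 =>
    intro t ht
    refine Dfn.allM (Q := fun x E => Sat M.toSet φ (Function.update (fun n => t n E) n x)) ?_
    refine (h1 (fun m E => if m = n then E 0 else t m E.tail) ?_).congr fun E _ => ?_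
    · intro m
      by_cases hm : m = n
      · simp only [hm, if_true]; exact T.var 0
      · simp only [hm, if_false]; exact (ht m).weak
    · have : (fun m => if m = n then E 0 else t m E.tail) =
        Function.update (fun n => t n E.tail) n (E 0) := by
        funext m
        by_cases hm : m = n
        · subst hm; simp
        · simp [hm]
      rw [this]

end

/-! ### Mostowski collapse -/

/-- restriction of a relation to a set -/
def rst (X : ZFSet.{u}) (R : ZFSet.{u} → ZFSet.{u} → Prop) : ZFSet.{u} → ZFSet.{u} → Prop :=
  fun a b => a ∈ X ∧ b ∈ X ∧ R a b

section
variable {X : ZFSet.{u}} {R : ZFSet.{u} → ZFSet.{u} → Prop}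

def col (h : WellFounded (rst X R)) : ZFSet.{u} → ZFSet.{u} :=
  h.fix (fun b ih => im (fun a => if h : rst X R a b then ih a h else ∅)
    (ZFSet.sep (fun a => rst X R a b) X))

theorem mem_col (h : WellFounded (rst X R)) {b z : ZFSet.{u}} (hb : b ∈ X) :
    z ∈ col h b ↔ ∃ a ∈ X, R a b ∧ col h a = z := by
  unfold col
  rw [WellFounded.fix_eq]
  simp only [mem_im, mem_sep]
  constructor
  · rintro ⟨a, ⟨ha, hab⟩, e⟩
    rw [dif_pos hab] at e
    exact ⟨a, ha, hab.2.2, e⟩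
  · rintro ⟨a, ha, hab, e⟩
    refine ⟨a, ⟨ha, ha, hb, hab⟩, ?_⟩
    rw [dif_pos ⟨ha, hb, hab⟩]
    exact e

theorem col_unique (h : WellFounded (rst X R)) {d : ZFSet.{u}} (hd : d ⊆ X)
    (hcl : ∀ a ∈ d, ∀ a' ∈ X, R a' a → a' ∈ d) (F : ZFSet.{u} → ZFSet.{u})
    (hF : ∀ a ∈ d, ∀ z, z ∈ F a ↔ ∃ a' ∈ X, R a' a ∧ F a' = z) : ∀ a ∈ d, F a = col h a := by
  intro a
  induction a using h.induction with
  | _ a ih =>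
    intro ha
    ext z
    rw [hF a ha, mem_col h (hd ha)]
    refine exists_congr fun a' => and_congr_right fun ha' => and_congr_right fun hr => ?_
    rw [ih a' ⟨ha', hd ha, hr⟩ (hcl a ha a' ha' hr)]

variable {M : ZFSet.{u}} [TM M]

theorem fapp_memM {f a : ZFSet.{u}} (hf : f ∈ M) (ha : a ∈ M) : fapp f a ∈ M := TM.of dfn

/-- the collapse of a well-founded relation in `M` is in `M` -/
theorem TM.col_mem (h : WellFounded (rst X R)) (hX : X ∈ M)
    (hR : Dfn (one M) (fun E => R (E 0) (E 1))) : mkf (col h) X ∈ M := by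
  have hRs : ∀ {s t : Env.{u} → ZFSet.{u}}, T (one M) s → T (one M) t →
    Dfn (one M) (fun E => R (s E) (t E)) := fun hs ht => Dfn.s2 (R := R) hR hs ht
  let App : ZFSet → ZFSet → Prop := fun d g => IsZFunc d g ∧ d ⊆ X ∧
    (∀ a ∈ d, ∀ a' ∈ X, R a' a → a' ∈ d) ∧
    ∀ a ∈ d, ∀ z ∈ M, (z ∈ fapp g a ↔ ∃ a' ∈ X, R a' a ∧ fapp g a' = z)
  have hApp : Dfn (one M) (fun E => App (E 0) (E 1)) := by
    refine Dfn.and dfn (Dfn.and dfn (Dfn.and (Dfn.ball dfn (Dfn.ball dfn (Dfn.imp (hRs dfn dfn) dfn)))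
      (Dfn.ball dfn (Dfn.allM (Dfn.iff dfn (Dfn.bex dfn (Dfn.and (hRs dfn dfn) dfn)))))))
  have hApps : ∀ {s t : Env.{u} → ZFSet.{u}}, T (one M) s → T (one M) t →
    Dfn (one M) (fun E => App (s E) (t E)) := fun hs ht => Dfn.s2 (R := App) hApp hs ht
  have app1 : ∀ d ∈ M, ∀ g ∈ M, App d g → g = mkf (col h) d := by
    intro d hd g hg ⟨h1, h2, h3, h4⟩
    refine h1.ext (IsZFunc.mkf _ _) fun a ha => ?_
    rw [fapp_mkf ha]
    refine col_unique h h2 h3 (fapp g) (fun a ha z => ?_) a ha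
    constructor
    · intro hz
      exact (h4 a ha z (TM.tr (fapp_memM hg (TM.tr hd ha)) hz)).1 hz
    · rintro ⟨a', ha', hr, rfl⟩
      exact (h4 a ha _ (fapp_memM hg (TM.tr hX ha'))).2 ⟨a', ha', hr, rfl⟩
  have app2 : ∀ d, d ⊆ X → (∀ a ∈ d, ∀ a' ∈ X, R a' a → a' ∈ d) → App d (mkf (col h) d) := by
    intro d h2 h3
    refine ⟨IsZFunc.mkf _ _, h2, h3, fun a ha z _ => ?_⟩
    rw [fapp_mkf ha, mem_col h (h2 ha)]
    refine exists_congr fun a' => and_congr_right fun ha' => and_congr_right fun hr => ?_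
    rw [fapp_mkf (h3 a ha a' ha' hr)]
  have step : ∀ A ∈ M, A ⊆ X → (∀ a ∈ A, ∃ g ∈ M, ∃ d ∈ M, App d g ∧ a ∈ d) →
      ∃ d ∈ M, d ⊆ X ∧ (∀ a ∈ d, ∀ a' ∈ X, R a' a → a' ∈ d) ∧ A ⊆ d ∧ mkf (col h) d ∈ M := by
    intro A hA hAX hA'
    obtain ⟨B, hB, hB'⟩ := TM.coll (P := fun a g => ∃ d ∈ M, App d g ∧ a ∈ d) hA
      (Dfn.exM (Dfn.and (hApps dfn dfn) dfn)) hA'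
    let D := ZFSet.sep (fun a => ∃ g ∈ B, ∃ d ∈ M, App d g ∧ a ∈ d) X
    have hD : D ∈ M := TM.sep_mem hX (Dfn.bex dfn (Dfn.exM (Dfn.and (hApps dfn dfn) dfn)))
    let G := ZFSet.sep (fun p => ∃ g ∈ B, (∃ d ∈ M, App d g) ∧ p ∈ g) (⋃₀ B)
    have hG : G ∈ M := TM.sep_mem (TM.of dfn)
      (Dfn.bex dfn (Dfn.and (Dfn.exM (hApps dfn dfn)) dfn))
    refine ⟨D, hD, fun x hx => (mem_sep.1 hx).1, ?_, ?_, ?_⟩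
    · intro a ha a' ha' hr
      obtain ⟨_, g, hg, d, hd, hdg, had⟩ := mem_sep.1 ha
      exact mem_sep.2 ⟨ha', g, hg, d, hd, hdg, hdg.2.2.1 a had a' ha' hr⟩
    · intro a ha
      obtain ⟨g, hg, h⟩ := hB' a ha
      exact mem_sep.2 ⟨hAX ha, g, hg, h⟩
    · convert hG
      ext p
      simp only [G, mem_sep]
      constructor
      · intro hp
        obtain ⟨a, ha, rfl⟩ := mem_im.1 hp
        obtain ⟨_, g, hg, d, hd, hdg, had⟩ := mem_sep.1 ha
        have hpg : pair a (col h a) ∈ g := by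
          rw [app1 d hd g (TM.tr hB hg) hdg, pair_mem_mkf]; exact ⟨had, rfl⟩
        exact ⟨mem_sUnion.2 ⟨g, hg, hpg⟩, g, hg, ⟨d, hd, hdg⟩, hpg⟩
      · rintro ⟨_, g, hg, ⟨d, hd, hdg⟩, hp⟩
        have e := app1 d hd g (TM.tr hB hg) hdg
        rw [e] at hp
        obtain ⟨a, ha, rfl⟩ := mem_im.1 hp
        exact pair_mem_mkf.2 ⟨mem_sep.2 ⟨hdg.2.1 ha, g, hg, d, hd, hdg, ha⟩, rfl⟩
  have all : ∀ b ∈ X, ∃ g ∈ M, ∃ d ∈ M, App d g ∧ b ∈ d := by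
    intro b
    induction b using h.induction with
    | _ b ih =>
      intro hb
      have hbM := TM.tr hX hb
      obtain ⟨d, hd, hdX, hcl, hAd, hm⟩ := step (ZFSet.sep (fun a => R a b) X)
        (TM.sep_mem hX (hRs dfn dfn)) (fun x hx => (mem_sep.1 hx).1) (by
          intro a ha
          rw [mem_sep] at ha
          exact ih a ⟨ha.1, hb, ha.2⟩ ha.1)
      let m := mkf (col h) d
      have hm : m ∈ M := hm
      have hcb : col h b = im (fun a => fapp m a) (ZFSet.sep (fun a => R a b) X) := by
        ext z
        rw [mem_col h hb, mem_im]
        refine exists_congr fun a => ?_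
        rw [mem_sep, and_assoc]
        refine and_congr_right fun ha => and_congr_right fun hr => ?_
        rw [fapp_mkf (hAd (mem_sep.2 ⟨ha, hr⟩))]
      have hcbM : col h b ∈ M := by
        rw [hcb]
        refine TM.of (T.im dfn (T.sep (hRs dfn dfn) dfn))
      have e : mkf (col h) (insert b d) = insert (pair b (col h b)) m := by
        ext p
        simp only [mkf, mem_im, mem_insert_iff, m]
        constructor
        · rintro ⟨a, rfl | ha, rfl⟩
          · exact Or.inl rfl
          · exact Or.inr ⟨a, ha, rfl⟩
        · rintro (rfl | ⟨a, ha, rfl⟩)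
          · exact ⟨b, Or.inl rfl, rfl⟩
          · exact ⟨a, Or.inr ha, rfl⟩
      refine ⟨mkf (col h) (insert b d), ?_, insert b d, TM.of dfn, app2 _ ?_ ?_, by simp⟩
      · rw [e]; exact TM.of dfn
      · intro x hx
        rcases mem_insert_iff.1 hx with rfl | hx
        exacts [hb, hdX hx]
      · intro a ha a' ha' hr
        rw [mem_insert_iff] at ha ⊢
        rcases ha with rfl | ha
        · exact Or.inr (hAd (mem_sep.2 ⟨ha', hr⟩))
        · exact Or.inr (hcl a ha a' ha' hr)
  obtain ⟨d, hd, hdX, _, hXd, hm⟩ := step X hX (fun x hx => hx) all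
  rwa [show d = X from (by ext z; exact ⟨fun h => hdX h, fun h => hXd h⟩)] at hm

theorem TM.col_val_mem (h : WellFounded (rst X R)) (hX : X ∈ M)
    (hR : Dfn (one M) (fun E => R (E 0) (E 1))) {b : ZFSet.{u}} (hb : b ∈ X) : col h b ∈ M := by
  have := TM.col_mem h hX hR
  have e := fapp_mkf (f := col h) hb
  rw [← e]
  exact fapp_memM this (TM.tr hX hb)

end


/-! ### Infinite cardinals and Goedel pairing -/

theorem zcard_mono {x y : ZFSet.{u}} (h : x ⊆ y) : zcard x ≤ zcard y :=
  Cardinal.mk_le_mk_of_subset h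

theorem zcard_im_le (f : ZFSet.{u} → ZFSet.{u}) (a : ZFSet.{u}) : zcard (im f a) ≤ zcard a := by
  unfold zcard
  refine Cardinal.mk_le_of_surjective (f := fun x : a.toSet => (⟨f x.1, mem_im.2 ⟨x.1, x.2, rfl⟩⟩ : (im f a).toSet)) ?_
  rintro ⟨y, hy⟩
  obtain ⟨x, hx, rfl⟩ := mem_im.1 hy
  exact ⟨⟨x, hx⟩, rfl⟩

theorem zcard_prod (a b : ZFSet.{u}) : zcard (ZFSet.prod a b) = zcard a * zcard b := by
  unfold zcard
  rw [Cardinal.mul_def]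
  refine Cardinal.mk_congr ?_
  symm
  refine Equiv.ofBijective (fun p : a.toSet × b.toSet =>
    (⟨pair p.1.1 p.2.1, pair_mem_prod.2 ⟨p.1.2, p.2.2⟩⟩ : (ZFSet.prod a b).toSet)) ⟨?_, ?_⟩
  · rintro ⟨⟨x, hx⟩, y, hy⟩ ⟨⟨x', hx'⟩, y', hy'⟩ h
    simpa [pair_inj] using h
  · rintro ⟨p, hp⟩
    obtain ⟨x, hx, y, hy, rfl⟩ := mem_prod.1 hp
    exact ⟨⟨⟨x, hx⟩, ⟨y, hy⟩⟩, rfl⟩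

theorem zcard_insert_le (a b : ZFSet.{u}) : zcard (insert a b) ≤ zcard b + 1 := by
  unfold zcard
  have : (insert a b : ZFSet).toSet = insert a b.toSet := by ext z; simp
  rw [this]
  exact Cardinal.mk_insert_le

class KC (κ : ZFSet.{u}) : Prop where
  card : IsCard κ
  inf : Cardinal.aleph0 ≤ zcard κ

section
variable {κ : ZFSet.{u}} [KC κ]

theorem KC.ord : κ.IsOrdinal := isOrdinal_iff_forall_mem_isTransitive.2 (KC.card (κ := κ)).1

theorem KC.ord' {a : ZFSet.{u}} (h : a ∈ κ) : a.IsOrdinal := (KC.ord (κ := κ)).mem h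

theorem KC.tr {a b : ZFSet.{u}} (h : a ∈ κ) (hb : b ∈ a) : b ∈ κ := KC.ord.isTransitive _ h hb

theorem KC.lt {a : ZFSet.{u}} (h : a ∈ κ) : zcard a < zcard κ := (KC.card (κ := κ)).2 a h

theorem KC.mem_of_zcard_lt {x : ZFSet.{u}} (hx : x.IsOrdinal) (h : zcard x < zcard κ) : x ∈ κ := by
  by_contra hc
  exact absurd (zcard_mono ((hx.notMem_iff_subset KC.ord).1 hc)) (not_le.2 h)

theorem KC.union_mem {a b : ZFSet.{u}} (ha : a ∈ κ) (hb : b ∈ κ) : a ∪ b ∈ κ := by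
  rcases (KC.ord' ha).subset_total (KC.ord' hb) with h | h
  · rwa [show a ∪ b = b by ext z; simp; exact fun hz => h hz]
  · rwa [show a ∪ b = a by ext z; simp; exact fun hz => h hz]

theorem KC.succ_mem {a : ZFSet.{u}} (ha : a ∈ κ) : insert a a ∈ κ := by
  apply KC.mem_of_zcard_lt
  · have ho := KC.ord' ha
    rw [isOrdinal_iff_forall_mem_isTransitive]
    refine ⟨fun y hy z hz => ?_, fun y hy => ?_⟩
    · rcases mem_insert_iff.1 hy with rfl | hy
      · exact mem_insert_iff.2 (Or.inr hz)
      · exact mem_insert_iff.2 (Or.inr (ho.isTransitive _ hy hz))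
    · rcases mem_insert_iff.1 hy with rfl | hy
      · exact ho.isTransitive
      · exact (ho.mem hy).isTransitive
  · exact (zcard_insert_le a a).trans_lt (Cardinal.add_lt_of_lt KC.inf (KC.lt ha)
      (Cardinal.one_lt_aleph0.trans_le KC.inf))

def GR (κ p q : ZFSet.{u}) : Prop := ∃ a ∈ κ, ∃ b ∈ κ, ∃ c ∈ κ, ∃ d ∈ κ, p = pair a b ∧ q = pair c d ∧
  (a ∪ b ∈ c ∪ d ∨ (a ∪ b = c ∪ d ∧ (a ∈ c ∨ (a = c ∧ b ∈ d))))

def GG (a b : ZFSet.{u}) : Ordinal.{u} ×ₗ (Ordinal.{u} ×ₗ Ordinal.{u}) :=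
  toLex (rank (a ∪ b), toLex (rank a, rank b))

theorem GR_iff {a b c d : ZFSet.{u}} (ha : a ∈ κ) (hb : b ∈ κ) (hc : c ∈ κ) (hd : d ∈ κ) :
    GR κ (pair a b) (pair c d) ↔ GG a b < GG c d := by
  have e : ∀ {x y : ZFSet.{u}}, x ∈ κ → y ∈ κ → (rank x = rank y ↔ x = y) := by
    intro x y hx hy
    refine ⟨fun h => ?_, fun h => h ▸ rfl⟩
    rw [← (KC.ord' hx).toZFSet_rank_eq, h, (KC.ord' hy).toZFSet_rank_eq]
  unfold GG
  rw [Prod.Lex.toLex_lt_toLex, Prod.Lex.toLex_lt_toLex]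
  have h1 := (KC.ord' (KC.union_mem ha hb)).rank_lt_iff_mem (KC.ord' (KC.union_mem hc hd))
  rw [h1, e (KC.union_mem ha hb) (KC.union_mem hc hd), (KC.ord' ha).rank_lt_iff_mem (KC.ord' hc),
    e ha hc, (KC.ord' hb).rank_lt_iff_mem (KC.ord' hd)]
  constructor
  · rintro ⟨a', _, b', _, c', _, d', _, h1, h2, h⟩
    rw [pair_inj] at h1 h2
    obtain ⟨rfl, rfl⟩ := h1
    obtain ⟨rfl, rfl⟩ := h2
    exact h
  · intro h
    exact ⟨a, ha, b, hb, c, hc, d, hd, rfl, rfl, h⟩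

theorem GR_wf : WellFounded (rst (ZFSet.prod κ κ) (GR κ)) := by
  let F : ZFSet.{u} → Ordinal.{u} ×ₗ (Ordinal.{u} ×ₗ Ordinal.{u}) := fun p =>
    if h : ∃ x : ZFSet × ZFSet, p = pair x.1 x.2 then GG h.choose.1 h.choose.2 else GG ∅ ∅
  have hF : ∀ a b, F (pair a b) = GG a b := by
    intro a b
    have h : ∃ x : ZFSet × ZFSet, pair a b = pair x.1 x.2 := ⟨(a, b), rfl⟩
    simp only [F]
    rw [dif_pos h]
    have := pair_inj.1 h.choose_spec
    rw [← this.1, ← this.2]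
  refine Subrelation.wf ?_ (InvImage.wf F wellFounded_lt)
  intro p q ⟨hp, hq, h⟩
  obtain ⟨a, ha, b, hb, rfl⟩ := mem_prod.1 hp
  obtain ⟨c, hc, d, hd, rfl⟩ := mem_prod.1 hq
  show F _ < F _
  rw [hF, hF]
  exact (GR_iff ha hb hc hd).1 h

/-- Goedel pairing -/
def gam (κ : ZFSet.{u}) [KC κ] : ZFSet.{u} → ZFSet.{u} := col (GR_wf (κ := κ))

theorem GR_tri {p q : ZFSet.{u}} (hp : p ∈ ZFSet.prod κ κ) (hq : q ∈ ZFSet.prod κ κ) :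
    p = q ∨ GR κ p q ∨ GR κ q p := by
  obtain ⟨a, ha, b, hb, rfl⟩ := mem_prod.1 hp
  obtain ⟨c, hc, d, hd, rfl⟩ := mem_prod.1 hq
  rw [GR_iff ha hb hc hd, GR_iff hc hd ha hb]
  rcases lt_trichotomy (GG a b) (GG c d) with h | h | h
  · exact Or.inr (Or.inl h)
  · left
    have h' := toLex_inj.1 h
    rw [Prod.mk.injEq, toLex_inj, Prod.mk.injEq] at h'
    rw [pair_inj, ← (KC.ord' ha).toZFSet_rank_eq, ← (KC.ord' hb).toZFSet_rank_eq, h'.2.1, h'.2.2,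
      (KC.ord' hc).toZFSet_rank_eq, (KC.ord' hd).toZFSet_rank_eq]
    exact ⟨rfl, rfl⟩
  · exact Or.inr (Or.inr h)

theorem gam_inj {p q : ZFSet.{u}} (hp : p ∈ ZFSet.prod κ κ) (hq : q ∈ ZFSet.prod κ κ)
    (h : gam κ p = gam κ q) : p = q := by
  rcases GR_tri hp hq with h' | h' | h'
  · exact h'
  · have := (mem_col GR_wf hq).2 ⟨p, hp, h', rfl⟩
    exact absurd (show gam κ p ∈ gam κ q from this) (by rw [h]; exact mem_irrefl _)
  · have := (mem_col GR_wf hp).2 ⟨q, hq, h', rfl⟩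
    exact absurd (show gam κ q ∈ gam κ p from this) (by rw [h]; exact mem_irrefl _)

theorem gam_tr {p : ZFSet.{u}} (hp : p ∈ ZFSet.prod κ κ) : (gam κ p).IsTransitive := by
  intro z hz w hw
  obtain ⟨q, hq, hqp, rfl⟩ := (mem_col GR_wf hp).1 hz
  obtain ⟨r, hr, hrq, rfl⟩ := (mem_col GR_wf hq).1 hw
  refine (mem_col GR_wf hp).2 ⟨r, hr, ?_, rfl⟩
  obtain ⟨a, ha, b, hb, rfl⟩ := mem_prod.1 hp
  obtain ⟨c, hc, d, hd, rfl⟩ := mem_prod.1 hq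
  obtain ⟨e, he, f, hf, rfl⟩ := mem_prod.1 hr
  rw [GR_iff] at * <;> try assumption
  exact hrq.trans hqp

theorem gam_mem {p : ZFSet.{u}} (hp : p ∈ ZFSet.prod κ κ) : gam κ p ∈ κ := by
  apply KC.mem_of_zcard_lt
  · refine isOrdinal_iff_forall_mem_isTransitive.2 ⟨gam_tr hp, fun y hy => ?_⟩
    obtain ⟨q, hq, _, rfl⟩ := (mem_col GR_wf hp).1 hy
    exact gam_tr hq
  · obtain ⟨a, ha, b, hb, rfl⟩ := mem_prod.1 hp
    have hm := KC.union_mem ha hb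
    have hs := KC.succ_mem hm
    have : gam κ (pair a b) ⊆ im (gam κ) (ZFSet.prod (insert (a ∪ b) (a ∪ b)) (insert (a ∪ b) (a ∪ b))) := by
      intro z hz
      obtain ⟨q, hq, hr, rfl⟩ := (mem_col GR_wf hp).1 hz
      refine mem_im.2 ⟨q, ?_, rfl⟩
      obtain ⟨c, hc, d, hd, rfl⟩ := mem_prod.1 hq
      rw [GR_iff hc hd ha hb] at hr
      have hle : rank (c ∪ d) ≤ rank (a ∪ b) := by
        unfold GG at hr
        rw [Prod.Lex.toLex_lt_toLex] at hr
        rcases hr with h | h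
        · exact h.le
        · exact h.1.le
      rw [rank_union] at hle
      have key : ∀ x ∈ κ, rank x ≤ rank (a ∪ b) → x ∈ insert (a ∪ b) (a ∪ b) := by
        intro x hx hle
        rw [← (KC.ord' hx).rank_lt_iff_mem (KC.ord' hs), rank_insert]
        exact lt_max_of_lt_left (Order.lt_succ_of_le hle)
      exact pair_mem_prod.2 ⟨key c hc ((le_max_left _ _).trans hle),
        key d hd ((le_max_right _ _).trans hle)⟩
    refine (zcard_mono this).trans_lt ((zcard_im_le _ _).trans_lt ?_)
    rw [zcard_prod]
    exact Cardinal.mul_lt_of_lt KC.inf (KC.lt hs) (KC.lt hs)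

theorem gam_graph {M : ZFSet.{u}} [TM M] (hκ : κ ∈ M) : mkf (gam κ) (ZFSet.prod κ κ) ∈ M := by
  refine TM.col_mem GR_wf (TM.of dfn) ?_
  unfold GR
  exact dfn

/-- code of the relation `F a ∈ F b` on `κ` as a subset of `κ` -/
def code (κ : ZFSet.{u}) [KC κ] (F : ZFSet.{u} → ZFSet.{u}) : ZFSet.{u} :=
  im (gam κ) (ZFSet.sep (fun p => ∃ a ∈ κ, ∃ b ∈ κ, p = pair a b ∧ F a ∈ F b) (ZFSet.prod κ κ))

theorem code_sub (F : ZFSet.{u} → ZFSet.{u}) : code κ F ⊆ κ := by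
  intro z hz
  obtain ⟨p, hp, rfl⟩ := mem_im.1 hz
  exact gam_mem (mem_sep.1 hp).1

theorem gam_mem_code {F : ZFSet.{u} → ZFSet.{u}} {a b : ZFSet.{u}} (ha : a ∈ κ) (hb : b ∈ κ) :
    gam κ (pair a b) ∈ code κ F ↔ F a ∈ F b := by
  have hab : pair a b ∈ ZFSet.prod κ κ := pair_mem_prod.2 ⟨ha, hb⟩
  constructor
  · intro h
    obtain ⟨p, hp, e⟩ := mem_im.1 h
    obtain ⟨hp, c, hc, d, hd, rfl, h'⟩ := mem_sep.1 hp
    have := gam_inj hp hab e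
    rw [pair_inj] at this
    rwa [this.1, this.2] at h'
  · intro h
    exact mem_im.2 ⟨_, mem_sep.2 ⟨hab, a, ha, b, hb, rfl, h⟩, rfl⟩

theorem code_mem {M g : ZFSet.{u}} [TM M] (hκ : κ ∈ M) (hg : g ∈ M) : code κ (fapp g) ∈ M := by
  let G := mkf (gam κ) (ZFSet.prod κ κ)
  have hG : G ∈ M := gam_graph hκ
  have e : code κ (fapp g) = im (fun p => fapp G p) (ZFSet.sep (fun p => ∃ a ∈ κ, ∃ b ∈ κ, p = pair a b ∧ fapp g a ∈ fapp g b) (ZFSet.prod κ κ)) := by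
    ext z
    simp only [code, mem_im, mem_sep]
    refine exists_congr fun p => and_congr_right fun hp => ?_
    rw [fapp_mkf hp.1]
  rw [e]
  exact TM.of dfn

theorem decode {M' t : ZFSet.{u}} {F : ZFSet.{u} → ZFSet.{u}} [TM M'] (hκ : κ ∈ M')
    (ht : t.IsTransitive) (hF : ∀ a ∈ κ, F a ∈ t) (hs : ∀ y ∈ t, ∃ a ∈ κ, F a = y)
    (hA : code κ F ∈ M') : mkf F κ ∈ M' := by
  let G := mkf (gam κ) (ZFSet.prod κ κ)
  have hG : G ∈ M' := gam_graph hκ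
  let R : ZFSet → ZFSet → Prop := fun a b => fapp G (pair a b) ∈ code κ F
  have hR : ∀ a ∈ κ, ∀ b ∈ κ, (R a b ↔ F a ∈ F b) := by
    intro a ha b hb
    simp only [R, G]
    rw [fapp_mkf (pair_mem_prod.2 ⟨ha, hb⟩), gam_mem_code ha hb]
  have hRw : WellFounded (rst κ R) := by
    refine Subrelation.wf ?_ (InvImage.wf F ZFSet.mem_wf)
    intro a b ⟨ha, hb, h⟩
    exact (hR a ha b hb).1 h
  have := TM.col_mem hRw hκ (M := M') dfn
  convert this using 1
  have key := col_unique hRw (d := κ) (fun x hx => hx) (fun _ _ a' ha' _ => ha') F (by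
    intro a ha z
    constructor
    · intro hz
      obtain ⟨b, hb, rfl⟩ := hs z (ht _ (hF a ha) hz)
      exact ⟨b, hb, (hR b hb a ha).2 hz, rfl⟩
    · rintro ⟨b, hb, hr, rfl⟩
      exact (hR b hb a ha).1 hr)
  ext p
  simp only [mkf, mem_im]
  refine exists_congr fun a => and_congr_right fun ha => ?_
  rw [key a ha]

end

set_option linter.unusedSectionVars false
set_option linter.unusedSimpArgs false

/-! ### The hereditarily `κ`-sized part of a model -/

/-- `g` enumerates a transitive set along `κ` -/
def wit (κ g : ZFSet.{u}) : Prop :=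
  IsZFunc κ g ∧ ∀ ξ ∈ κ, ∀ z ∈ fapp g ξ, ∃ η ∈ κ, fapp g η = z

/-- `x` is hereditarily of size `κ` in `M` -/
def sm (κ M x : ZFSet.{u}) : Prop := ∃ g ∈ M, wit κ g ∧ ∃ ξ ∈ κ, fapp g ξ = x

def HM (κ M : ZFSet.{u}) : ZFSet.{u} := ZFSet.sep (sm κ M) M

theorem Dfn.wit {M : ZFSet.{u}} [TM M] {s t : Env.{u} → ZFSet.{u}} (hs : T (one M) s)
    (ht : T (one M) t) : Dfn (one M) (fun E => wit (s E) (t E)) := by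
  refine Dfn.s2 (R := MPaper.wit) ?_ hs ht
  unfold MPaper.wit
  exact dfn

section
variable {κ : ZFSet.{u}} [KC κ]

theorem KC.empty_mem : (∅ : ZFSet) ∈ κ := by
  apply KC.mem_of_zcard_lt
  · rw [isOrdinal_iff_forall_mem_isTransitive]
    exact ⟨fun y hy => absurd hy (notMem_empty y), fun y hy => absurd hy (notMem_empty y)⟩
  · have : zcard (∅ : ZFSet.{u}) = 0 := by
      unfold zcard
      rw [Cardinal.mk_eq_zero_iff]
      exact ⟨fun x => notMem_empty _ x.2⟩
    rw [this]
    exact Cardinal.aleph0_pos.trans_le KC.inf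

theorem KC.omega_sub : ZFSet.omega ⊆ κ := by
  have key : ∀ n : ℕ, ZFSet.mk (PSet.ofNat.{u} n) ∈ κ := by
    intro n
    induction n with
    | zero => exact KC.empty_mem
    | succ n ih => exact KC.succ_mem ih
  intro x hx
  induction x using Quotient.inductionOn with
  | _ x =>
    obtain ⟨⟨n⟩, hn⟩ := hx
    have := key n
    rwa [show (⟦x⟧ : ZFSet) = ZFSet.mk (PSet.ofNat n) from Quotient.sound hn]

variable {M : ZFSet.{u}} [TM M]

theorem Dfn.sm (hκ : κ ∈ M) {s : Env.{u} → ZFSet.{u}} (hs : T (one M) s) :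
    Dfn (one M) (fun E => sm κ M (s E)) := by
  refine Dfn.exM (Q := fun g E => MPaper.wit κ g ∧ ∃ ξ ∈ κ, fapp g ξ = s E) ?_
  have := hs.weak.weak
  exact Dfn.and (Dfn.wit dfn dfn) dfn

theorem sm_fam (hκ : κ ∈ M) {G b : ZFSet.{u}} (hG : G ∈ M) (hGw : ∀ ξ ∈ κ, wit κ (fapp G ξ))
    (hb : b ∈ M) (hcov : ∀ z ∈ b, ∃ ξ ∈ κ, ∃ η ∈ κ, fapp (fapp G ξ) η = z) : sm κ M b := by
  let Γ := mkf (gam κ) (ZFSet.prod κ κ)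
  have hΓ : Γ ∈ M := gam_graph hκ
  have hΓe : ∀ ξ ∈ κ, ∀ η ∈ κ, fapp Γ (pair ξ η) = gam κ (pair ξ η) := fun ξ hξ η hη =>
    fapp_mkf (pair_mem_prod.2 ⟨hξ, hη⟩)
  have hΓm : ∀ ξ ∈ κ, ∀ η ∈ κ, fapp Γ (pair ξ η) ∈ κ := fun ξ hξ η hη => by
    rw [hΓe ξ hξ η hη]; exact gam_mem (pair_mem_prod.2 ⟨hξ, hη⟩)
  have hΓi : ∀ ξ ∈ κ, ∀ η ∈ κ, ∀ ξ' ∈ κ, ∀ η' ∈ κ, fapp Γ (pair ξ η) = fapp Γ (pair ξ' η') →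
      ξ = ξ' ∧ η = η' := fun ξ hξ η hη ξ' hξ' η' hη' h => by
    rw [hΓe ξ hξ η hη, hΓe ξ' hξ' η' hη'] at h
    exact pair_inj.1 (gam_inj (pair_mem_prod.2 ⟨hξ, hη⟩) (pair_mem_prod.2 ⟨hξ', hη'⟩) h)
  obtain ⟨h, hh, hhf, hhP⟩ := TM.choice (M := M) (a := κ) (P := fun ζ w =>
    (∀ ξ ∈ κ, ∀ η ∈ κ, ∀ θ ∈ κ, ζ = fapp Γ (pair ξ (fapp Γ (pair η θ))) →
      (θ = ∅ → w = b) ∧ (θ ≠ ∅ → w = fapp (fapp G ξ) η)) ∧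
    (w = b ∨ ∃ ξ ∈ κ, ∃ η ∈ κ, w = fapp (fapp G ξ) η)) hκ dfn (by
      intro ζ hζ
      by_cases hx : ∃ ξ ∈ κ, ∃ η ∈ κ, ∃ θ ∈ κ, ζ = fapp Γ (pair ξ (fapp Γ (pair η θ)))
      · obtain ⟨ξ, hξ, η, hη, θ, hθ, rfl⟩ := hx
        have key : ∀ ξ' ∈ κ, ∀ η' ∈ κ, ∀ θ' ∈ κ, fapp Γ (pair ξ (fapp Γ (pair η θ))) =
            fapp Γ (pair ξ' (fapp Γ (pair η' θ'))) → ξ = ξ' ∧ η = η' ∧ θ = θ' := by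
          intro ξ' hξ' η' hη' θ' hθ' he
          have h1 := hΓi _ hξ _ (hΓm _ hη _ hθ) _ hξ' _ (hΓm _ hη' _ hθ') he
          exact ⟨h1.1, hΓi _ hη _ hθ _ hη' _ hθ' h1.2⟩
        by_cases h0 : θ = ∅
        · refine ⟨b, hb, fun ξ' hξ' η' hη' θ' hθ' he => ?_, Or.inl rfl⟩
          obtain ⟨rfl, rfl, rfl⟩ := key _ hξ' _ hη' _ hθ' he
          exact ⟨fun _ => rfl, fun h => absurd h0 h⟩
        · refine ⟨fapp (fapp G ξ) η, fapp_memM (fapp_memM hG (TM.tr hκ hξ)) (TM.tr hκ hη),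
            fun ξ' hξ' η' hη' θ' hθ' he => ?_, Or.inr ⟨ξ, hξ, η, hη, rfl⟩⟩
          obtain ⟨rfl, rfl, rfl⟩ := key _ hξ' _ hη' _ hθ' he
          exact ⟨fun h => absurd h h0, fun _ => rfl⟩
      · exact ⟨b, hb, fun ξ hξ η hη θ hθ he => absurd ⟨ξ, hξ, η, hη, θ, hθ, he⟩ hx, Or.inl rfl⟩)
  have h0 : (∅ : ZFSet) ∈ κ := KC.empty_mem
  have h1 : insert (∅ : ZFSet) ∅ ∈ κ := KC.succ_mem h0
  have h1' : insert (∅ : ZFSet.{u}) ∅ ≠ ∅ := fun h =>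
    notMem_empty (∅ : ZFSet.{u}) ((congrArg (fun t => (∅ : ZFSet.{u}) ∈ t) h).mp (mem_insert _ _))
  have hval : ∀ ξ ∈ κ, ∀ η ∈ κ, ∃ ζ ∈ κ, fapp h ζ = fapp (fapp G ξ) η := by
    intro ξ hξ η hη
    have hm := hΓm _ hξ _ (hΓm _ hη _ h1)
    exact ⟨_, hm, ((hhP _ hm).1 ξ hξ η hη _ h1 rfl).2 h1'⟩
  refine ⟨h, hh, ⟨hhf, fun ζ hζ z hz => ?_⟩, ?_⟩
  · rcases (hhP ζ hζ).2 with he | ⟨ξ, hξ, η, hη, he⟩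
    · rw [he] at hz
      obtain ⟨ξ, hξ, η, hη, rfl⟩ := hcov z hz
      exact hval ξ hξ η hη
    · rw [he] at hz
      obtain ⟨η', hη', rfl⟩ := (hGw ξ hξ).2 η hη z hz
      exact hval ξ hξ η' hη'
  · have hm := hΓm _ h0 _ (hΓm _ h0 _ h0)
    exact ⟨_, hm, ((hhP _ hm).1 _ h0 _ h0 _ h0 rfl).1 rfl⟩

theorem sm_sub (hκ : κ ∈ M) {g b : ZFSet.{u}} (hg : g ∈ M) (hw : wit κ g)
    (hb : b ∈ M) (hcov : ∀ z ∈ b, ∃ ξ ∈ κ, fapp g ξ = z) : sm κ M b := by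
  have hG : mkf (fun _ => g) κ ∈ M := TM.of dfn
  refine sm_fam hκ hG (fun ξ hξ => ?_) hb fun z hz => ?_
  · rwa [fapp_mkf hξ]
  · obtain ⟨ξ, hξ, rfl⟩ := hcov z hz
    exact ⟨ξ, hξ, ξ, hξ, by rw [fapp_mkf hξ]⟩

theorem sm_range (hκ : κ ∈ M) {f b : ZFSet.{u}} (hf : f ∈ M) (hb : b ∈ M)
    (hcov : ∀ z ∈ b, sm κ M z ∧ ∃ ξ ∈ κ, fapp f ξ = z) : sm κ M b := by
  by_cases hn : ∃ z, z ∈ b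
  · obtain ⟨z0, hz0⟩ := hn
    obtain ⟨⟨g0, hg0, hgw0, -⟩, -⟩ := hcov z0 hz0
    obtain ⟨G, hG, hGf, hGP⟩ := TM.choice (M := M) (a := κ) (P := fun ξ g =>
      wit κ g ∧ (fapp f ξ ∈ b → ∃ η ∈ κ, fapp g η = fapp f ξ)) hκ
      (Dfn.and (Dfn.wit dfn dfn) dfn) (by
        intro ξ hξ
        by_cases h : fapp f ξ ∈ b
        · obtain ⟨⟨g, hg, hw, hx⟩, -⟩ := hcov _ h
          exact ⟨g, hg, hw, fun _ => hx⟩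
        · exact ⟨g0, hg0, hgw0, fun h' => absurd h' h⟩)
    refine sm_fam hκ hG (fun ξ hξ => (hGP ξ hξ).1) hb fun z hz => ?_
    obtain ⟨_, ξ, hξ, rfl⟩ := hcov z hz
    exact ⟨ξ, hξ, (hGP ξ hξ).2 hz⟩
  · have hG : mkf (fun x => x) κ ∈ M := TM.of dfn
    refine sm_sub hκ hG ⟨IsZFunc.mkf _ _, ?_⟩ hb fun z hz => absurd ⟨z, hz⟩ hn
    intro ξ hξ z hz
    rw [fapp_mkf hξ] at hz
    exact ⟨z, KC.tr hξ hz, fapp_mkf (KC.tr hξ hz)⟩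

theorem sm_kappa (hκ : κ ∈ M) : sm κ M κ := by
  have hG : mkf (fun x => x) κ ∈ M := TM.of dfn
  refine sm_sub hκ hG ⟨IsZFunc.mkf _ _, ?_⟩ hκ fun z hz => ⟨z, hz, fapp_mkf hz⟩
  intro ξ hξ z hz
  rw [fapp_mkf hξ] at hz
  exact ⟨z, KC.tr hξ hz, fapp_mkf (KC.tr hξ hz)⟩

theorem sm.sub (hκ : κ ∈ M) {x b : ZFSet.{u}} (hx : sm κ M x) (hb : b ∈ M) (h : b ⊆ x) : sm κ M b := by
  obtain ⟨g, hg, hw, ξ, hξ, rfl⟩ := hx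
  exact sm_sub hκ hg hw hb fun z hz => hw.2 ξ hξ z (h hz)

theorem sm.mem {x y : ZFSet.{u}} (hx : sm κ M x) (hy : y ∈ x) : sm κ M y := by
  obtain ⟨g, hg, hw, ξ, hξ, rfl⟩ := hx
  exact ⟨g, hg, hw, hw.2 ξ hξ y hy⟩

theorem sm.mem_M {x : ZFSet.{u}} (hκ : κ ∈ M) (hx : sm κ M x) : x ∈ M := by
  obtain ⟨g, hg, hw, ξ, hξ, rfl⟩ := hx
  exact fapp_memM hg (TM.tr hκ hξ)

theorem sm.sUnion (hκ : κ ∈ M) {x : ZFSet.{u}} (hx : sm κ M x) : sm κ M (⋃₀ x : ZFSet) := by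
  have hxM := hx.mem_M hκ
  obtain ⟨g, hg, hw, ξ, hξ, rfl⟩ := hx
  refine sm_sub hκ hg hw (TM.sUnion_mem hxM) fun z hz => ?_
  obtain ⟨y, hy, hzy⟩ := mem_sUnion.1 hz
  obtain ⟨η, hη, rfl⟩ := hw.2 ξ hξ y hy
  exact hw.2 η hη z hzy

theorem sm.upair (hκ : κ ∈ M) {x y : ZFSet.{u}} (hx : sm κ M x) (hy : sm κ M y) : sm κ M {x, y} := by
  have hxM := hx.mem_M hκ
  have hyM := hy.mem_M hκ
  have h0 : (∅ : ZFSet) ∈ κ := KC.empty_mem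
  have h1 : insert (∅ : ZFSet) ∅ ∈ κ := KC.succ_mem h0
  have h1' : insert (∅ : ZFSet.{u}) ∅ ≠ ∅ := fun h =>
    notMem_empty (∅ : ZFSet.{u}) ((congrArg (fun t => (∅ : ZFSet.{u}) ∈ t) h).mp (mem_insert _ _))
  obtain ⟨f, hf, hff, hfP⟩ := TM.choice (M := M) (a := κ) (P := fun ξ w =>
    (ξ = ∅ → w = x) ∧ (ξ ≠ ∅ → w = y)) hκ dfn (by
      intro ξ hξ
      by_cases h : ξ = ∅
      · exact ⟨x, hxM, fun _ => rfl, fun h' => absurd h h'⟩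
      · exact ⟨y, hyM, fun h' => absurd h' h, fun _ => rfl⟩)
  refine sm_range hκ hf (TM.upair_mem hxM hyM) fun z hz => ?_
  rcases mem_pair.1 hz with rfl | rfl
  · exact ⟨hx, _, h0, (hfP _ h0).1 rfl⟩
  · exact ⟨hy, _, h1, (hfP _ h1).2 h1'⟩

theorem sm.pair (hκ : κ ∈ M) {x y : ZFSet.{u}} (hx : sm κ M x) (hy : sm κ M y) :
    sm κ M (ZFSet.pair x y) := by
  have : ZFSet.pair x y = {{x, x}, {x, y}} := by simp [ZFSet.pair]
  rw [this]
  exact (hx.upair hκ hx).upair hκ (hx.upair hκ hy)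

theorem sm.of_wit (hκ : κ ∈ M) {g : ZFSet.{u}} (hg : g ∈ M) (hw : wit κ g) : sm κ M g := by
  have hf : mkf (fun ξ => ZFSet.pair ξ (fapp g ξ)) κ ∈ M := TM.of dfn
  refine sm_range hκ hf hg fun z hz => ?_
  obtain ⟨ξ, hξ, w, rfl⟩ := hw.1.1 z hz
  have := hw.1.fapp_eq hz
  subst this
  exact ⟨((sm_kappa hκ).mem hξ).pair hκ ⟨g, hg, hw, ξ, hξ, rfl⟩, ξ, hξ, fapp_mkf hξ⟩

/-- images of small families -/
theorem sm.im (hκ : κ ∈ M) {F : ZFSet.{u} → ZFSet.{u}} (hF : T (one M) (fun E => F (E 0)))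
    (h : ∀ ξ ∈ κ, sm κ M (F ξ)) : sm κ M (im F κ) := by
  have hf : mkf F κ ∈ M := TM.of (T.mkf (f := fun x _ => F x) hF dfn)
  have hi : MPaper.im F κ ∈ M := TM.of (T.im (f := fun x _ => F x) hF dfn)
  refine sm_range hκ hf hi fun z hz => ?_
  obtain ⟨ξ, hξ, rfl⟩ := mem_im.1 hz
  exact ⟨h ξ hξ, ξ, hξ, fapp_mkf hξ⟩

theorem sm_prod (hκ : κ ∈ M) {g : ZFSet.{u}} (hg : g ∈ M) (hs : ∀ ξ ∈ κ, sm κ M (fapp g ξ)) :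
    sm κ M (⋃₀ (MPaper.im (fun ξ => MPaper.im (fun η => ZFSet.pair (fapp g ξ) (fapp g η)) κ) κ) : ZFSet) := by
  refine sm.sUnion hκ (sm.im (F := fun ξ => MPaper.im (fun η => ZFSet.pair (fapp g ξ) (fapp g η)) κ) hκ
    (T.im (f := fun η E => ZFSet.pair (fapp g (E 0)) (fapp g η)) (T.pair dfn dfn) dfn) fun ξ hξ => ?_)
  have : fapp g ξ ∈ M := fapp_memM hg (TM.tr hκ hξ)
  exact sm.im (F := fun η => ZFSet.pair (fapp g ξ) (fapp g η)) hκ dfn fun η hη => (hs ξ hξ).pair hκ (hs η hη)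

theorem mem_HM {x : ZFSet.{u}} (hκ : κ ∈ M) : x ∈ HM κ M ↔ sm κ M x :=
  ⟨fun h => (mem_sep.1 h).2, fun h => mem_sep.2 ⟨h.mem_M hκ, h⟩⟩

theorem Dfn.satH (hκ : κ ∈ M) (φ : Fml) : ∀ (t : ℕ → Env.{u} → ZFSet.{u}), (∀ n, T (one M) (t n)) →
    Dfn (one M) (fun E => Sat (HM κ M).toSet φ (fun n => t n E)) := by
  induction φ with
  | mem i j => intro t ht; exact Dfn.mem (ht i) (ht j)
  | eq i j => intro t ht; exact Dfn.eq (ht i) (ht j)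
  | impl φ ψ h1 h2 => intro t ht; exact Dfn.imp (h1 t ht) (h2 t ht)
  | neg φ h1 => intro t ht; exact Dfn.not (h1 t ht)
  | all n φ h1 =>
    intro t ht
    have : Dfn (one M) (fun E => ∀ x ∈ M, MPaper.sm κ M x →
      Sat (HM κ M).toSet φ (Function.update (fun n => t n E) n x)) := by
      refine Dfn.allM (Q := fun x E => MPaper.sm κ M x →
        Sat (HM κ M).toSet φ (Function.update (fun n => t n E) n x)) ?_
      refine Dfn.imp (Dfn.sm hκ (T.var 0)) ?_
      refine (h1 (fun m E => if m = n then E 0 else t m E.tail) ?_).congr fun E _ => ?_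
      · intro m
        by_cases hm : m = n
        · simp only [hm, if_true]; exact T.var 0
        · simp only [hm, if_false]; exact (ht m).weak
      · have : (fun m => if m = n then E 0 else t m E.tail) =
          Function.update (fun n => t n E.tail) n (E 0) := by
          funext m
          by_cases hm : m = n
          · subst hm; simp
          · simp [hm]
        rw [this]
    refine this.congr fun E _ => ?_
    constructor
    · intro h x hx
      exact h x (mem_sep.1 hx).1 (mem_sep.1 hx).2
    · intro h x hx hs
      exact h x (mem_sep.2 ⟨hx, hs⟩)

theorem HM_TM (hκ : κ ∈ M) : TM (HM κ M) := by
  have hM : ∀ {x}, x ∈ HM κ M → x ∈ M := fun h => (mem_sep.1 h).1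
  refine ⟨fun x hx y hy => ?_, ?_, fun x hx y hy => ?_, fun x hx => ?_, fun φ v hv a ha => ?_,
    fun φ v hv a ha H => ?_, fun x hx => ?_⟩
  · exact (mem_HM hκ).2 (((mem_HM hκ).1 hx).mem hy)
  · exact (mem_HM hκ).2 ((sm_kappa hκ).sub hκ TM.omega_mem KC.omega_sub)
  · exact (mem_HM hκ).2 (((mem_HM hκ).1 hx).upair hκ ((mem_HM hκ).1 hy))
  · exact (mem_HM hκ).2 (((mem_HM hκ).1 hx).sUnion hκ)
  · refine ⟨ZFSet.sep (fun x => Sat (HM κ M).toSet φ (Function.update v 0 x)) a,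
      (mem_HM hκ).2 (((mem_HM hκ).1 ha).sub hκ (TM.sep_mem (hM ha) ?_) (fun z hz => (mem_sep.1 hz).1)),
      fun x => mem_sep⟩
    refine (Dfn.satH hκ φ (fun m E => if m = 0 then E 0 else v m) ?_).congr fun E _ => ?_
    · intro m
      by_cases hm : m = 0
      · simp only [hm, if_true]; exact T.var 0
      · simp only [hm, if_false]; exact T.constM (hM (hv m))
    · have : (fun m => if m = 0 then E 0 else v m) = Function.update v 0 (E 0) := by
        funext m
        by_cases hm : m = 0
        · subst hm; simp
        · simp [hm]
      rw [this]
  · obtain ⟨g, hg, hw, ξ0, hξ0, rfl⟩ := (mem_HM hκ).1 ha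
    have hξzM : ξ0 ∈ M := TM.tr hκ hξ0
    have hD : Dfn (one M) (fun E => Sat (HM κ M).toSet φ
        (Function.update (Function.update v 0 (E 0)) 1 (E 1))) := by
      refine (Dfn.satH hκ φ (fun m E => if m = 1 then E 1 else if m = 0 then E 0 else v m) ?_).congr
        fun E _ => ?_
      · intro m
        by_cases hm : m = 1
        · simp only [hm, if_true]; exact T.var 1
        · by_cases hm0 : m = 0
          · simp only [hm, hm0, if_true, if_false]; exact T.var 0
          · simp only [hm, hm0, if_false]; exact T.constM (hM (hv m))
      · have : (fun m => if m = 1 then E 1 else if m = 0 then E 0 else v m) =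
            Function.update (Function.update v 0 (E 0)) 1 (E 1) := by
          funext m
          by_cases hm : m = 1
          · subst hm; simp
          · by_cases hm0 : m = 0
            · subst hm0; simp
            · simp [hm, hm0]
        rw [this]
    obtain ⟨f, hf, hff, hfP⟩ := TM.choice (M := M) (a := κ) (P := fun ξ y => sm κ M y ∧
        (fapp g ξ ∈ fapp g ξ0 → Sat (HM κ M).toSet φ
        (Function.update (Function.update v 0 (fapp g ξ)) 1 y))) hκ
        (Dfn.and (Dfn.sm hκ (T.var 1)) (Dfn.imp dfn (Dfn.s2 (R := fun x y => Sat (HM κ M).toSet φ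
        (Function.update (Function.update v 0 x) 1 y)) hD dfn dfn))) (by
          intro ξ hξ
          by_cases h : fapp g ξ ∈ fapp g ξ0
          · obtain ⟨y, hy, h'⟩ := H _ h
            exact ⟨y, hM hy, (mem_HM hκ).1 hy, fun _ => h'⟩
          · exact ⟨κ, hκ, sm_kappa hκ, fun h' => absurd h' h⟩)
    refine ⟨im (fapp f) κ, (mem_HM hκ).2 (sm.im (F := fapp f) hκ dfn fun ξ hξ => (hfP ξ hξ).1), fun x hx => ?_⟩
    obtain ⟨ξ, hξ, rfl⟩ := hw.2 ξ0 hξ0 x hx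
    exact ⟨fapp f ξ, mem_im.2 ⟨ξ, hξ, rfl⟩, (hfP ξ hξ).2 hx⟩
  · obtain ⟨r, hr, hwo⟩ := TM.wo (hM hx)
    refine ⟨r, (mem_HM hκ).2 ?_, hwo⟩
    obtain ⟨g, hg, hw, ξ0, hξ0, rfl⟩ := (mem_HM hκ).1 hx
    have hs : ∀ ξ ∈ κ, sm κ M (fapp g ξ) := fun ξ hξ => ⟨g, hg, hw, ξ, hξ, rfl⟩
    have h1 := sm_prod hκ hg hs
    refine h1.sub hκ hr fun p hp => ?_
    obtain ⟨a, ha, b, hb, rfl⟩ := hwo.1 p hp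
    obtain ⟨ξ, hξ, rfl⟩ := hw.2 ξ0 hξ0 a ha
    obtain ⟨η, hη, rfl⟩ := hw.2 ξ0 hξ0 b hb
    exact mem_sUnion.2 ⟨_, mem_im.2 ⟨ξ, hξ, rfl⟩, mem_im.2 ⟨η, hη, rfl⟩⟩

theorem HM_kappa (hκ : κ ∈ M) : κ ∈ HM κ M := (mem_HM hκ).2 (sm_kappa hκ)

theorem HM_sub : HM κ M ⊆ M := fun _ h => (mem_sep.1 h).1

theorem HM_pow (hκ : κ ∈ M) {A : ZFSet.{u}} (hA : A ∈ M) (h : A ⊆ κ) : A ∈ HM κ M :=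
  (mem_HM hκ).2 ((sm_kappa hκ).sub hκ hA h)

theorem HM_small (hκ : κ ∈ M) {x : ZFSet.{u}} (hx : x ∈ HM κ M) : sm κ (HM κ M) x := by
  obtain ⟨g, hg, hw, h⟩ := (mem_HM hκ).1 hx
  exact ⟨g, (mem_HM hκ).2 (sm.of_wit hκ hg hw), hw, h⟩

theorem sub_of_pow {M' : ZFSet.{u}} [TM M'] (hκ : κ ∈ M) (hκ' : κ ∈ M')
    (hs : ∀ x ∈ M, sm κ M x) (hP : ∀ A ∈ M, A ⊆ κ → A ∈ M') : M ⊆ M' := by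
  intro x hx
  obtain ⟨g, hg, hw, ξ, hξ, rfl⟩ := hs x hx
  have hc : code κ (fapp g) ∈ M' := hP _ (code_mem hκ hg) (code_sub _)
  have := decode (t := im (fapp g) κ) (F := fapp g) hκ' (by
    intro y hy z hz
    obtain ⟨η, hη, rfl⟩ := mem_im.1 hy
    obtain ⟨θ, hθ, rfl⟩ := hw.2 η hη z hz
    exact mem_im.2 ⟨θ, hθ, rfl⟩) (fun a ha => mem_im.2 ⟨a, ha, rfl⟩)
    (fun y hy => mem_im.1 hy) hc
  rw [← fapp_mkf (f := fapp g) hξ]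
  exact fapp_memM this (TM.tr hκ' hξ)

end

/-! ### Ultrafilters, inaccessibility, existence of Ramsey measures -/

/-- basic package -/
structure RM (κ M U : ZFSet.{u}) : Prop where
  tm : TM M
  mem : κ ∈ M
  uf : IsMUltrafilter κ M U
  wa : WeaklyAmenable κ M U
  oi : OmegaOneIntersecting U

section
variable {κ : ZFSet.{u}}

theorem ramsey_KC (hR : IsRamseyCard κ) : KC κ := by
  refine ⟨hR.1, ?_⟩
  obtain ⟨M, ⟨hM, hκ, hc⟩, -⟩ := hR.2 ∅ (fun z hz => absurd hz (notMem_empty z))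
  rw [← hc]
  unfold zcard
  rw [Cardinal.aleph0_le_mk_iff, Set.infinite_coe_iff]
  intro hfin
  obtain ⟨m, hm, hmax⟩ := Set.exists_max_image M.toSet rank hfin ⟨κ, hκ⟩
  have h1 : ({m, m} : ZFSet) ∈ M := hM.2.2.1 m hm m hm
  exact absurd (hmax _ h1) (not_le.2 (rank_lt_of_mem (by simp)))

section
variable {M U : ZFSet.{u}}

theorem IsMUltrafilter.nonempty (h : IsMUltrafilter κ M U) {A : ZFSet.{u}} (hA : A ∈ U) : ∃ x, x ∈ A := by
  by_contra hc
  push Not at hc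
  exact h.2.2.1 ((eq_empty A).2 hc ▸ hA)

theorem IsMUltrafilter.disj (h : IsMUltrafilter κ M U) {A B : ZFSet.{u}} (hA : A ∈ U) (hB : B ∈ U)  :
    ∃ x, x ∈ A ∧ x ∈ B := by
  obtain ⟨x, hx⟩ := h.nonempty (h.2.2.2.1 A hA B hB)
  exact ⟨x, mem_inter.1 hx⟩

theorem IsMUltrafilter.up (h : IsMUltrafilter κ M U) {A B : ZFSet.{u}} (hA : A ∈ U) (hB : B ∈ M) (hBκ : B ⊆ κ)
    (hAB : A ⊆ B) : B ∈ U := h.2.2.2.2.1 A hA B hB hBκ hAB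

theorem IsMUltrafilter.inter (h : IsMUltrafilter κ M U) {A B : ZFSet.{u}} (hA : A ∈ U) (hB : B ∈ U)  :
    A ∩ B ∈ U := h.2.2.2.1 A hA B hB

theorem IsMUltrafilter.or (h : IsMUltrafilter κ M U) {B : ZFSet.{u}} (hB : B ∈ M) (hBκ : B ⊆ κ) :
    B ∈ U ∨ compl κ B ∈ U := h.2.2.2.2.2.1 B hB hBκ

theorem IsMUltrafilter.normal (h : IsMUltrafilter κ M U) {f : ZFSet.{u}} (hf : f ∈ M) (hff : IsZFunc κ f)
    (hs : ZFSet.sep (fun ξ => fapp f ξ ∈ ξ) κ ∈ U) :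
    ∃ γ ∈ κ, ZFSet.sep (fun ξ => fapp f ξ = γ) κ ∈ U := h.2.2.2.2.2.2 f hf hff hs

theorem IsMUltrafilter.mono {M' : ZFSet.{u}} (h : IsMUltrafilter κ M U) (hM : M' ⊆ M) (hU : ∀ A ∈ U, A ∈ M') :
    IsMUltrafilter κ M' U :=
  ⟨fun A hA => ⟨hU A hA, (h.1 A hA).2⟩, h.2.1, h.2.2.1, h.2.2.2.1,
    fun A hA B hB => h.2.2.2.2.1 A hA B (hM hB), fun B hB => h.2.2.2.2.2.1 B (hM hB),
    fun f hf => h.2.2.2.2.2.2 f (hM hf)⟩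

theorem sep_sub' {P : ZFSet.{u} → Prop} {a : ZFSet.{u}} : ZFSet.sep P a ⊆ a := fun _ h => (mem_sep.1 h).1

end

variable [KC κ]

theorem ramsey_rel (hR : IsRamseyCard κ) (R : ZFSet.{u} → ZFSet.{u} → Prop) :
    ∃ M U, RM κ M U ∧ ∃ r ∈ M, ∀ a ∈ κ, ∀ b ∈ κ, (pair a b ∈ r ↔ R a b) := by
  let A := im (gam κ) (ZFSet.sep (fun p => ∃ a ∈ κ, ∃ b ∈ κ, p = pair a b ∧ R a b) (ZFSet.prod κ κ))
  obtain ⟨M, ⟨hM, hκ, hc⟩, hA, U, h1, h2, h3⟩ := hR.2 A (by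
    intro z hz
    obtain ⟨p, hp, rfl⟩ := mem_im.1 hz
    exact gam_mem (mem_sep.1 hp).1)
  have : TM M := ⟨hM⟩
  let Γ := mkf (gam κ) (ZFSet.prod κ κ)
  have hΓ : Γ ∈ M := gam_graph hκ
  refine ⟨M, U, ⟨⟨hM⟩, hκ, h1, h2, h3⟩, ZFSet.sep (fun p => fapp Γ p ∈ A) (ZFSet.prod κ κ), TM.of dfn, ?_⟩
  intro a ha b hb
  have hab : pair a b ∈ ZFSet.prod κ κ := pair_mem_prod.2 ⟨ha, hb⟩
  rw [mem_sep, fapp_mkf hab]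
  constructor
  · rintro ⟨-, h⟩
    obtain ⟨p, hp, e⟩ := mem_im.1 h
    obtain ⟨hp, c, hc, d, hd, rfl, h'⟩ := mem_sep.1 hp
    have := gam_inj hp hab e
    rw [pair_inj] at this
    rwa [this.1, this.2] at h'
  · intro h
    exact ⟨hab, mem_im.2 ⟨_, mem_sep.2 ⟨hab, a, ha, b, hb, rfl, h⟩, rfl⟩⟩

theorem KC.mem_of_notMem {a b c : ZFSet.{u}} (ha : a ∈ κ) (hb : b ∈ κ) (h : a ∉ b) (hc : c ∈ b) : c ∈ a :=
  ((KC.ord' ha).notMem_iff_subset (KC.ord' hb)).1 h hc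

theorem ramsey_reg (hR : IsRamseyCard κ) {γ : ZFSet.{u}} (hγ : γ ∈ κ) (F : ZFSet.{u} → ZFSet.{u})
    (hF : ∀ a ∈ γ, F a ∈ κ) (hcof : ∀ ξ ∈ κ, ∃ a ∈ γ, ξ ∈ F a) : False := by
  obtain ⟨M, U, ⟨_, hκ, uf, -, -⟩, r, hr, hrR⟩ := ramsey_rel hR (fun a b => F a = b)
  have hγM : γ ∈ M := TM.tr hκ hγ
  obtain ⟨g, hg, hgf, hgP⟩ := TM.choice (M := M) (a := κ)
    (P := fun ξ a => a ∈ γ ∧ ∃ b ∈ κ, pair a b ∈ r ∧ ξ ∈ b) hκ dfn (by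
      intro ξ hξ
      obtain ⟨a, ha, h⟩ := hcof ξ hξ
      exact ⟨a, TM.tr hγM ha, ha, F a, hF a ha, (hrR a (KC.tr hγ ha) _ (hF a ha)).2 rfl, h⟩)
  have h1 : ZFSet.sep (fun ξ => fapp g ξ ∈ ξ) κ ∈ U := by
    refine uf.up (uf.2.1 γ hγ) (TM.of dfn) sep_sub' fun ξ hξ => ?_
    obtain ⟨h, h'⟩ := mem_sep.1 hξ
    exact mem_sep.2 ⟨h, KC.mem_of_notMem h hγ h' (hgP ξ h).1⟩
  obtain ⟨δ, hδ, h2⟩ := uf.normal hg hgf h1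
  obtain ⟨ξ0, hξ0⟩ := uf.nonempty h2
  obtain ⟨hξ0, e0⟩ := mem_sep.1 hξ0
  have hδγ : δ ∈ γ := e0 ▸ (hgP ξ0 hξ0).1
  obtain ⟨ξ, h3, h4⟩ := uf.disj h2 (uf.2.1 _ (hF δ hδγ))
  obtain ⟨hξ, e⟩ := mem_sep.1 h3
  obtain ⟨-, b, hb, hp, hξb⟩ := hgP ξ hξ
  rw [e, hrR δ hδ b hb] at hp
  exact (mem_sep.1 h4).2 (hp ▸ hξb)

theorem ramsey_sl (hR : IsRamseyCard κ) {γ : ZFSet.{u}} (hγ : γ ∈ κ) (F : ZFSet.{u} → ZFSet.{u})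
    (hF : ∀ a ∈ κ, F a ⊆ γ) (hinj : ∀ a ∈ κ, ∀ b ∈ κ, F a = F b → a = b) : False := by
  obtain ⟨M, U, ⟨_, hκ, uf, wa, -⟩, r, hr, hrR⟩ := ramsey_rel hR (fun a b => a ∈ F b)
  have hγM : γ ∈ M := TM.tr hκ hγ
  let X : ZFSet → ZFSet := fun i => ZFSet.sep (fun ξ => pair i ξ ∈ r) κ
  let S := im X γ
  have hS : S ∈ M := TM.of (T.im (f := fun i E => ZFSet.sep (fun ξ => pair i ξ ∈ r) κ) dfn dfn)
  have hXm : ∀ i ∈ M, X i ∈ M := fun i hi => TM.of dfn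
  have hSU : S ∩ U ∈ M := by
    refine wa S hS ⟨mkf X κ, TM.of (T.mkf (f := fun i E => ZFSet.sep (fun ξ => pair i ξ ∈ r) κ) dfn dfn), IsZFunc.mkf _ _, ?_⟩
    intro y hy
    obtain ⟨i, hi, rfl⟩ := mem_im.1 hy
    exact ⟨i, KC.tr hγ hi, fapp_mkf (KC.tr hγ hi)⟩
  let B := ZFSet.sep (fun i => ZFSet.sep (fun ξ => pair i ξ ∈ r) κ ∈ S ∩ U) γ
  have hB : B ∈ M := TM.sep_mem hγM (Dfn.mem (T.sep (Q := fun ξ E => pair (E 0) ξ ∈ r) dfn dfn) (T.constM hSU))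
  have hBi : ∀ i ∈ γ, (i ∈ B ↔ X i ∈ U) := by
    intro i hi
    simp only [B, mem_sep, mem_inter]
    exact ⟨fun h => h.2.2, fun h => ⟨hi, mem_im.2 ⟨i, hi, rfl⟩, h⟩⟩
  let D := ZFSet.sep (fun ξ => ∃ k ∈ γ, ¬ (pair k ξ ∈ r ↔ k ∈ B)) κ
  have hDM : D ∈ M := TM.of dfn
  have hD : D ∈ U := by
    rcases uf.or hDM sep_sub' with h | h
    · exact h
    · exfalso
      obtain ⟨ξ0, hx0⟩ := uf.nonempty h
      have key : ∀ ξ ∈ compl κ D, ξ ∈ κ ∧ F ξ = B := by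
        intro ξ hξ
        obtain ⟨h1, h2⟩ := mem_sep.1 hξ
        refine ⟨h1, ?_⟩
        have h3 : ∀ k ∈ γ, (pair k ξ ∈ r ↔ k ∈ B) := by
          intro k hk
          by_contra hc
          exact h2 (mem_sep.2 ⟨h1, k, hk, hc⟩)
        ext k
        constructor
        · intro hk
          have hkγ := hF ξ h1 hk
          exact (h3 k hkγ).1 ((hrR k (KC.tr hγ hkγ) ξ h1).2 hk)
        · intro hk
          have hkγ := (mem_sep.1 hk).1
          exact (hrR k (KC.tr hγ hkγ) ξ h1).1 ((h3 k hkγ).2 hk)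
      obtain ⟨ξ, h1, h2⟩ := uf.disj h (uf.2.1 _ (KC.succ_mem (key ξ0 hx0).1))
      have := hinj ξ (key ξ h1).1 ξ0 (key ξ0 hx0).1 ((key ξ h1).2.trans (key ξ0 hx0).2.symm)
      subst this
      exact (mem_sep.1 h2).2 (mem_insert _ _)
  obtain ⟨g, hg, hgf, hgP⟩ := TM.choice (M := M) (a := κ)
    (P := fun ξ i => (∃ k ∈ γ, ¬ (pair k ξ ∈ r ↔ k ∈ B)) → i ∈ γ ∧ ¬ (pair i ξ ∈ r ↔ i ∈ B)) hκ dfn (by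
      intro ξ hξ
      by_cases h : ∃ k ∈ γ, ¬ (pair k ξ ∈ r ↔ k ∈ B)
      · obtain ⟨k, hk, h⟩ := h
        exact ⟨k, TM.tr hγM hk, fun _ => ⟨hk, h⟩⟩
      · exact ⟨κ, hκ, fun h' => absurd h' h⟩)
  have h1 : ZFSet.sep (fun ξ => fapp g ξ ∈ ξ) κ ∈ U := by
    refine uf.up (uf.inter hD (uf.2.1 γ hγ)) (TM.of dfn) sep_sub' fun ξ hξ => ?_
    obtain ⟨h, h'⟩ := mem_inter.1 hξ
    obtain ⟨hξκ, h⟩ := mem_sep.1 h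
    exact mem_sep.2 ⟨hξκ, KC.mem_of_notMem hξκ hγ (mem_sep.1 h').2 (hgP ξ hξκ h).1⟩
  obtain ⟨δ, hδ, h2⟩ := uf.normal hg hgf h1
  have hY := uf.inter h2 hD
  have key : ∀ ξ ∈ ZFSet.sep (fun ξ => fapp g ξ = δ) κ ∩ D, ξ ∈ κ ∧ δ ∈ γ ∧ ¬ (pair δ ξ ∈ r ↔ δ ∈ B) := by
    intro ξ hξ
    obtain ⟨h, h'⟩ := mem_inter.1 hξ
    obtain ⟨hξκ, e⟩ := mem_sep.1 h
    have := hgP ξ hξκ (mem_sep.1 h').2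
    rw [e] at this
    exact ⟨hξκ, this⟩
  obtain ⟨ξ0, hξ0⟩ := uf.nonempty hY
  obtain ⟨-, hδγ, -⟩ := key ξ0 hξ0
  by_cases hδB : δ ∈ B
  · obtain ⟨ξ, h3, h4⟩ := uf.disj hY ((hBi δ hδγ).1 hδB)
    exact (key ξ h3).2.2 ⟨fun _ => hδB, fun _ => (mem_sep.1 h4).2⟩
  · have h5 : compl κ (X δ) ∈ U := by
      rcases uf.or (hXm δ (TM.tr hκ hδ)) sep_sub' with h | h
      · exact absurd ((hBi δ hδγ).2 h) hδB
      · exact h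
    obtain ⟨ξ, h3, h4⟩ := uf.disj hY h5
    exact (key ξ h3).2.2 ⟨fun h => absurd (mem_sep.2 ⟨(key ξ h3).1, h⟩) (mem_sep.1 h4).2,
      fun h => absurd h hδB⟩

theorem ramsey_unc (hR : IsRamseyCard κ) : Cardinal.aleph0 < zcard κ := by
  by_contra hc
  push Not at hc
  obtain ⟨M, U, ⟨_, hκ, uf, -, oi⟩, -⟩ := ramsey_rel hR (fun a b => False)
  have : Countable κ.toSet := Cardinal.mk_le_aleph0_iff.1 hc
  have : Nonempty κ.toSet := ⟨⟨∅, KC.empty_mem⟩⟩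
  obtain ⟨f, hf⟩ := exists_surjective_nat κ.toSet
  obtain ⟨x, hx⟩ := oi (fun n => tailSet κ (f n).1) (fun n => uf.2.1 _ (f n).2)
  have hxκ : x ∈ κ := (mem_sep.1 (hx 0)).1
  obtain ⟨n, hn⟩ := hf ⟨insert x x, KC.succ_mem hxκ⟩
  have := hx n
  rw [hn] at this
  exact (mem_sep.1 this).2 (mem_insert _ _)

end

set_option linter.unusedSectionVars false

/-! ### Inaccessibility and existence of Ramsey measures -/

section
variable {κ : ZFSet.{u}}

theorem exists_inj {x y : ZFSet.{u}} (h : zcard x ≤ zcard y) :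
    ∃ F : ZFSet.{u} → ZFSet.{u}, (∀ a ∈ x, F a ∈ y) ∧ ∀ a ∈ x, ∀ b ∈ x, F a = F b → a = b := by
  obtain ⟨e⟩ := Cardinal.le_def _ _ |>.1 h
  refine ⟨fun a => if h : a ∈ x then (e ⟨a, h⟩).1 else ∅, fun a ha => ?_, fun a ha b hb hab => ?_⟩
  · simp only [ha, dif_pos]; exact (e ⟨a, ha⟩).2
  · simp only [ha, hb, dif_pos] at hab
    exact congrArg Subtype.val (e.injective (Subtype.ext hab))

theorem exists_surj {x y : ZFSet.{u}} (h0 : ∃ z, z ∈ x) (h : zcard x ≤ zcard y) :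
    ∃ F : ZFSet.{u} → ZFSet.{u}, (∀ a ∈ y, F a ∈ x) ∧ ∀ b ∈ x, ∃ a ∈ y, F a = b := by
  obtain ⟨G, hG, hi⟩ := exists_inj h
  obtain ⟨z, hz⟩ := h0
  refine ⟨fun a => if h : ∃ b ∈ x, G b = a then h.choose else z, fun a ha => ?_, fun b hb => ⟨G b, hG b hb, ?_⟩⟩
  · dsimp only
    split_ifs with h
    · exact h.choose_spec.1
    · exact hz
  · have h : ∃ b' ∈ x, G b' = G b := ⟨b, hb, rfl⟩
    simp only [h, dif_pos]
    exact hi _ h.choose_spec.1 _ hb h.choose_spec.2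

theorem zcard_eq (x : ZFSet.{u}) : zcard x = Cardinal.lift.{u+1, u} (card x) := ZFSet.cardinalMk_coe_sort ..

theorem zcard_le {x y : ZFSet.{u}} : zcard x ≤ zcard y ↔ card x ≤ card y := by
  rw [zcard_eq, zcard_eq, Cardinal.lift_le]

theorem zcard_lt {x y : ZFSet.{u}} : zcard x < zcard y ↔ card x < card y := by
  rw [zcard_eq, zcard_eq, Cardinal.lift_lt]

variable [KC κ]

theorem KC.toZ : (rank κ).toZFSet = κ := KC.ord.toZFSet_rank_eq

theorem KC.cardr : ZFSet.card κ = (rank κ).card := by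
  conv_lhs => rw [← KC.toZ (κ := κ)]
  rw [Ordinal.card_toZFSet]

theorem KC.rank_eq : rank κ = (ZFSet.card κ).ord := by
  apply le_antisymm _ (by rw [KC.cardr]; exact Cardinal.ord_card_le _)
  by_contra hc
  push Not at hc
  have h : (ZFSet.card κ).ord.toZFSet ∈ κ := by
    rw [← KC.toZ (κ := κ), Ordinal.mem_toZFSet_iff]
    exact ⟨_, by simpa [KC.toZ] using hc, by rw [KC.toZ]⟩
  have h2 := KC.lt h
  rw [zcard_lt, Ordinal.card_toZFSet, Cardinal.card_ord] at h2
  exact lt_irrefl _ h2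

theorem KC.mem_iff {o : Ordinal.{u}} : o.toZFSet ∈ κ ↔ o < rank κ := by
  conv_lhs => rw [← KC.toZ (κ := κ)]
  rw [Ordinal.toZFSet_mem_toZFSet_iff]

theorem ramsey_inacc (hR : IsRamseyCard κ) : (ZFSet.card κ).IsInaccessible := by
  have hu : Cardinal.aleph0 < ZFSet.card κ := by
    have := ramsey_unc hR
    rw [zcard_eq] at this
    simpa using this
  rw [Cardinal.isInaccessible_def]
  refine ⟨hu, ⟨hu.le, ?_⟩, ⟨(Cardinal.aleph0_pos.trans hu).ne', ?_⟩⟩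
  · by_contra hc
    push Not at hc
    obtain ⟨ι, f, hf, hι⟩ := Ordinal.exists_lsub_cof (ZFSet.card κ).ord
    rw [← hι] at hc
    let γ := (Cardinal.mk ι).ord.toZFSet
    have hγ : γ ∈ κ := by
      rw [KC.mem_iff, KC.rank_eq]; exact Cardinal.ord_lt_ord.2 hc
    have e : Nonempty (γ.toSet ≃ ι) := by
      have : zcard γ = Cardinal.lift.{u+1} (Cardinal.mk ι) := by
        rw [zcard_eq, Ordinal.card_toZFSet, Cardinal.card_ord]
      unfold zcard at this
      have h2 : Cardinal.lift.{u} (Cardinal.mk γ.toSet) = Cardinal.lift.{u+1} (Cardinal.mk ι) := by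
        rw [this]; simp
      exact Cardinal.lift_mk_eq'.1 h2
    obtain ⟨e⟩ := e
    refine ramsey_reg hR hγ (fun a => if h : a ∈ γ then (Order.succ (f (e ⟨a, h⟩))).toZFSet else ∅) ?_ ?_
    · intro a ha
      simp only [ha, dif_pos]
      rw [Ordinal.toZFSet_succ]
      apply KC.succ_mem
      rw [KC.mem_iff, KC.rank_eq, ← hf]
      exact Ordinal.lt_lsub f _
    · intro ξ hξ
      have h1 : rank ξ < Ordinal.lsub.{u,u} f := by
        rw [hf, ← KC.rank_eq (κ := κ)]; exact rank_lt_of_mem hξ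
      obtain ⟨i, hi⟩ := Ordinal.lt_lsub_iff.1 h1
      refine ⟨(e.symm i).1, (e.symm i).2, ?_⟩
      have : (e.symm i).1 ∈ γ := (e.symm i).2
      simp only [this, dif_pos, Subtype.coe_eta, Equiv.apply_symm_apply]
      rw [← (KC.ord' hξ).toZFSet_rank_eq, Ordinal.toZFSet_mem_toZFSet_iff]
      exact Order.lt_succ_of_le hi
  · intro x hx
    by_contra hc
    push Not at hc
    let γ := x.ord.toZFSet
    have hγ : γ ∈ κ := by
      rw [KC.mem_iff, KC.rank_eq]; exact Cardinal.ord_lt_ord.2 hx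
    obtain ⟨F, h1, h2⟩ := exists_inj (x := κ) (y := powerset γ) (by
      rw [zcard_le, card_powerset, Ordinal.card_toZFSet, Cardinal.card_ord]; exact hc)
    exact ramsey_sl hR hγ F (fun a ha => mem_powerset.1 (h1 a ha)) h2

/-- the set `V_κ` -/
def vk (κ : ZFSet.{u}) : ZFSet.{u} := vonNeumann (rank κ)

theorem mem_vk {x : ZFSet.{u}} : x ∈ vk κ ↔ rank x < rank κ := mem_vonNeumann

theorem vk_tr {x y : ZFSet.{u}} (hx : x ∈ vk κ) (hy : y ∈ x) : y ∈ vk κ :=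
  mem_vk.2 ((rank_lt_of_mem hy).trans (mem_vk.1 hx))

theorem vk_card (hR : IsRamseyCard κ) : zcard (vk κ) = zcard κ := by
  rw [zcard_eq, vk, card_vonNeumann, KC.rank_eq, (ramsey_inacc hR).preBeth_ord, ← zcard_eq]

/-- Ramsey for hereditarily small sets. -/
theorem ramsey_hered (hR : IsRamseyCard κ) {t : ZFSet.{u}} (ht : t.IsTransitive) (h0 : ∃ z, z ∈ t)
    (hc : zcard t ≤ zcard κ) : ∃ M U, IsWeakModel κ M ∧ RM κ M U ∧ ∃ g ∈ M, wit κ g ∧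
      ∀ x, x ∈ t ↔ ∃ ξ ∈ κ, fapp g ξ = x := by
  obtain ⟨F, h1, h2⟩ := exists_surj h0 hc
  obtain ⟨M, hM, hA, U, h3, h4, h5⟩ := hR.2 (code κ F) (code_sub _)
  have : TM M := ⟨hM.1⟩
  have hF : mkf F κ ∈ M := decode hM.2.1 ht h1 h2 hA
  refine ⟨M, U, hM, ⟨⟨hM.1⟩, hM.2.1, h3, h4, h5⟩, mkf F κ, hF, ⟨IsZFunc.mkf _ _, ?_⟩, ?_⟩
  · intro ξ hξ z hz
    rw [fapp_mkf hξ] at hz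
    obtain ⟨η, hη, e⟩ := h2 z (ht _ (h1 ξ hξ) hz)
    exact ⟨η, hη, by rw [fapp_mkf hη, e]⟩
  · intro x
    constructor
    · intro hx
      obtain ⟨η, hη, e⟩ := h2 x hx
      exact ⟨η, hη, by rw [fapp_mkf hη, e]⟩
    · rintro ⟨ξ, hξ, rfl⟩
      rw [fapp_mkf hξ]; exact h1 ξ hξ

theorem MU_eq {U M : ZFSet.{u}} (h : IsMUModel κ U M) : MU κ U = M := by
  have h0 : ∃ M, IsMUModel κ U M := ⟨M, h⟩
  have h1 : IsMUModel κ U (MU κ U) := by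
    unfold MU; rw [dif_pos h0]; exact h0.choose_spec
  ext x
  exact ⟨fun hx => h1.2.2.2 M h.1.1 h.1.2.1 h.2.2.1 hx, fun hx => h.2.2.2 _ h1.1.1 h1.1.2.1 h1.2.2.1 hx⟩

theorem compl_compl_eq {A : ZFSet.{u}} (hA : A ⊆ κ) : compl κ (compl κ A) = A := by
  ext x
  simp only [compl, mem_sep]
  constructor
  · rintro ⟨h1, h2⟩
    by_contra h3
    exact h2 ⟨h1, h3⟩
  · intro h
    exact ⟨hA h, fun h' => h'.2 h⟩

/-- everything one needs about a Ramsey measure and its model -/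
structure RMs (κ M U : ZFSet.{u}) : Prop extends RM κ M U where
  vk : vk κ ∈ M
  small : ∀ x ∈ M, sm κ M x

theorem IsRamseyMeasure.rms {W : ZFSet.{u}} (h : IsRamseyMeasure κ W) : RMs κ (MU κ W) W := by
  obtain ⟨⟨h1, h2, M, h3⟩, h4, h5⟩ := h
  rw [MU_eq h3] at h4 ⊢
  have : TM M := ⟨h3.1.1⟩
  have hκ := h3.1.2.1
  obtain ⟨v, hv, hv'⟩ := h3.2.1
  have hve : v = MPaper.vk κ := by
    ext x; rw [hv', mem_vk]
  have := HM_TM (M := M) hκ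
  refine ⟨⟨⟨h3.1.1⟩, hκ, h3.2.2.1, h4, h5⟩, hve ▸ hv, fun x hx => ?_⟩
  refine (mem_HM hκ).1 (h3.2.2.2 (HM κ M) this.h (HM_kappa hκ) (h3.2.2.1.mono HM_sub fun A hA => ?_) hx)
  exact HM_pow hκ (h3.2.2.1.1 A hA).1 (h3.2.2.1.1 A hA).2

theorem exists_measure (hR : IsRamseyCard κ) {t : ZFSet.{u}} (ht : t.IsTransitive)
    (hc : zcard t ≤ zcard κ) : ∃ W, IsRamseyMeasure κ W ∧ t ∈ MU κ W := by
  let t' := insert t t ∪ insert (MPaper.vk κ) (MPaper.vk κ)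
  have ht' : t'.IsTransitive := by
    intro x hx y hy
    simp only [t', mem_union, mem_insert_iff] at hx ⊢
    rcases hx with (rfl | hx) | (rfl | hx)
    · exact Or.inl (Or.inr hy)
    · exact Or.inl (Or.inr (ht x hx hy))
    · exact Or.inr (Or.inr hy)
    · exact Or.inr (Or.inr (vk_tr hx hy))
  have h1 : (1 : Cardinal) ≤ zcard κ := Cardinal.one_lt_aleph0.le.trans KC.inf
  have hc' : zcard t' ≤ zcard κ := by
    have : zcard t' ≤ zcard (insert t t) + zcard (insert (MPaper.vk κ) (MPaper.vk κ)) := by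
      have := Cardinal.mk_union_le (insert t t : ZFSet).toSet (insert (MPaper.vk κ) (MPaper.vk κ) : ZFSet).toSet
      refine le_trans (Cardinal.mk_le_mk_of_subset ?_) this
      intro x hx
      exact mem_union.1 hx
    refine this.trans (Cardinal.add_le_of_le KC.inf ?_ ?_)
    · exact (zcard_insert_le _ _).trans (Cardinal.add_le_of_le KC.inf hc h1)
    · exact (zcard_insert_le _ _).trans (Cardinal.add_le_of_le KC.inf (vk_card hR).le h1)
  obtain ⟨M, U, hM, rm, g, hg, hw, hgt⟩ := ramsey_hered hR ht' ⟨t, by simp [t']⟩ hc'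
  have := rm.tm
  have hκ := rm.mem
  have hMM := HM_TM (M := M) hκ
  have hin : ∀ x ∈ t', x ∈ HM κ M := fun x hx => (mem_HM hκ).2 ⟨g, hg, hw, (hgt x).1 hx⟩
  have hκH := HM_kappa (M := M) hκ
  have htail : ∀ a ∈ κ, tailSet κ a ∈ U := rm.uf.2.1
  have hzU : zcard κ ≤ zcard U := by
    refine (?_ : zcard κ ≤ zcard (im (tailSet κ) κ)).trans (zcard_mono fun x hx => ?_)
    · unfold zcard
      refine Cardinal.mk_le_of_injective (f := fun a : κ.toSet => (⟨tailSet κ a.1, mem_im.2 ⟨a.1, a.2, rfl⟩⟩ :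
        (im (tailSet κ) κ).toSet)) ?_
      intro a b hab
      have hab : tailSet κ a.1 = tailSet κ b.1 := congrArg Subtype.val hab
      have key : ∀ a ∈ κ, ∀ b ∈ κ, tailSet κ a = tailSet κ b → a ⊆ b := by
        intro a ha b hb h x hx
        by_contra hxb
        have : x ∈ tailSet κ b := mem_sep.2 ⟨KC.tr ha hx, hxb⟩
        rw [← h] at this
        exact (mem_sep.1 this).2 hx
      have ha : a.1 ∈ κ := a.2
      have hb : b.1 ∈ κ := b.2
      apply Subtype.ext
      ext x
      exact ⟨fun h => key _ ha _ hb hab h, fun h => key _ hb _ ha hab.symm h⟩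
    · obtain ⟨a, ha, rfl⟩ := mem_im.1 hx
      exact htail a ha
  have hUM : zcard U ≤ zcard κ := by
    rw [← hM.2.2]; exact zcard_mono fun x hx => (rm.uf.1 x hx).1
  have hmu : IsMUModel κ U (HM κ M) := by
    refine ⟨⟨hMM.h, hκH, le_antisymm ?_ ?_⟩, ⟨MPaper.vk κ, hin _ (by simp [t']), fun x => mem_vk⟩,
      rm.uf.mono HM_sub fun A hA => HM_pow hκ (rm.uf.1 A hA).1 (rm.uf.1 A hA).2, ?_⟩
    · rw [← hM.2.2]; exact zcard_mono HM_sub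
    · exact zcard_mono fun x hx => hMM.h.1 _ hκH hx
    · intro M' hM' hκ' hU'
      have : TM M' := ⟨hM'⟩
      refine sub_of_pow hκH hκ' (fun x hx => HM_small hκ hx) fun A hA hs => ?_
      rcases rm.uf.or (HM_sub hA) hs with h | h
      · exact (hU'.1 A h).1
      · have h2 := (hU'.1 _ h).1
        rw [← compl_compl_eq hs]
        exact TM.of dfn
  refine ⟨U, ⟨⟨le_antisymm hUM hzU, fun A hA => (rm.uf.1 A hA).2, _, hmu⟩, ?_, rm.oi⟩, ?_⟩
  · rw [MU_eq hmu]
    rintro X hX ⟨f, hf, h1, h2⟩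
    have h3 := rm.wa X (HM_sub hX) ⟨f, HM_sub hf, h1, h2⟩
    exact (mem_HM hκ).2 (((mem_HM hκ).1 hX).sub hκ h3 fun z hz => (mem_inter.1 hz).1)
  · rw [MU_eq hmu]
    exact hin _ (by simp [t'])

end

set_option linter.unusedSectionVars false

/-! ### The ultrapower -/

/-- `P` holds almost everywhere -/
def AE (κ U : ZFSet.{u}) (P : ZFSet.{u} → Prop) : Prop := ZFSet.sep P κ ∈ U

section
variable {κ M U : ZFSet.{u}} {P Q R : ZFSet.{u} → Prop}

theorem AE.mono (uf : IsMUltrafilter κ M U) (h : AE κ U P) (hQ : ZFSet.sep Q κ ∈ M)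
    (hPQ : ∀ ξ ∈ κ, P ξ → Q ξ) : AE κ U Q :=
  uf.up h hQ sep_sub' fun ξ hξ => mem_sep.2 ⟨(mem_sep.1 hξ).1, hPQ ξ (mem_sep.1 hξ).1 (mem_sep.1 hξ).2⟩

theorem AE.mono2 (uf : IsMUltrafilter κ M U) (h : AE κ U P) (h' : AE κ U R) (hQ : ZFSet.sep Q κ ∈ M)
    (hPQ : ∀ ξ ∈ κ, P ξ → R ξ → Q ξ) : AE κ U Q :=
  uf.up (uf.inter h h') hQ sep_sub' fun ξ hξ => by
    obtain ⟨h1, h2⟩ := mem_inter.1 hξ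
    exact mem_sep.2 ⟨(mem_sep.1 h1).1, hPQ ξ (mem_sep.1 h1).1 (mem_sep.1 h1).2 (mem_sep.1 h2).2⟩

theorem AE.ex (uf : IsMUltrafilter κ M U) (h : AE κ U P) : ∃ ξ ∈ κ, P ξ := by
  obtain ⟨ξ, h⟩ := uf.nonempty h
  exact ⟨ξ, mem_sep.1 h⟩

theorem AE.ex2 (uf : IsMUltrafilter κ M U) (h : AE κ U P) (h' : AE κ U Q) : ∃ ξ ∈ κ, P ξ ∧ Q ξ := by
  obtain ⟨ξ, h1, h2⟩ := uf.disj h h'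
  exact ⟨ξ, (mem_sep.1 h1).1, (mem_sep.1 h1).2, (mem_sep.1 h2).2⟩

theorem AE.not (uf : IsMUltrafilter κ M U) (hP : ZFSet.sep P κ ∈ M) (h : ¬ AE κ U P) :
    AE κ U (fun ξ => ¬ P ξ) := by
  have : ZFSet.sep (fun ξ => ¬ P ξ) κ = compl κ (ZFSet.sep P κ) := by
    ext x
    simp only [compl, mem_sep]
    tauto
  unfold AE
  rw [this]
  exact (uf.or hP sep_sub').resolve_left h

theorem AE.all [KC κ] (uf : IsMUltrafilter κ M U) (h : ∀ ξ ∈ κ, P ξ) : AE κ U P := by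
  have h1 := uf.2.1 ∅ KC.empty_mem
  have : ZFSet.sep P κ = tailSet κ ∅ := by
    ext x
    simp only [tailSet, mem_sep, notMem_empty, not_false_eq_true, and_true]
    exact ⟨fun h => h.1, fun hx => ⟨hx, h x hx⟩⟩
  unfold AE
  rw [this]; exact h1

/-- functions on `κ` in `M` -/
def FF (κ M : ZFSet.{u}) : ZFSet.{u} := ZFSet.sep (IsZFunc κ) M

def UR (κ U f g : ZFSet.{u}) : Prop := AE κ U (fun ξ => fapp f ξ ∈ fapp g ξ)

theorem UR_wf (oi : OmegaOneIntersecting U) : WellFounded (rst (FF κ M) (UR κ U)) := by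
  rw [wellFounded_iff_isEmpty_descending_chain]
  refine ⟨fun ⟨s, hs⟩ => ?_⟩
  obtain ⟨ξ, hξ⟩ := oi (fun n => ZFSet.sep (fun ξ => fapp (s (n+1)) ξ ∈ fapp (s n) ξ) κ) fun n => (hs n).2.2
  exact (wellFounded_iff_isEmpty_descending_chain.1 ZFSet.mem_wf).false
    ⟨fun n => fapp (s n) ξ, fun n => (mem_sep.1 (hξ n)).2⟩

theorem mem_FF {f : ZFSet.{u}} : f ∈ FF κ M ↔ f ∈ M ∧ IsZFunc κ f := mem_sep

variable [KC κ] [TM M]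

section
variable (rm : RM κ M U)


def cu (rm : RM κ M U) : ZFSet.{u} → ZFSet.{u} := col (UR_wf (κ := κ) (M := M) rm.oi)
def Nu (rm : RM κ M U) : ZFSet.{u} := im (cu rm) (FF κ M)
def ju (rm : RM κ M U) (x : ZFSet.{u}) : ZFSet.{u} := cu rm (mkf (fun _ => x) κ)

theorem mkf_FF (rm : RM κ M U) {F : ZFSet.{u} → ZFSet.{u}} (h : mkf F κ ∈ M) : mkf F κ ∈ FF κ M := mem_FF.2 ⟨h, IsZFunc.mkf _ _⟩

theorem mem_cu (rm : RM κ M U) {f z : ZFSet.{u}} (hf : f ∈ FF κ M) : z ∈ cu rm f ↔ ∃ g ∈ FF κ M, UR κ U g f ∧ cu rm g = z :=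
  mem_col _ hf

theorem cu_eq (rm : RM κ M U) {f g : ZFSet.{u}} (hf : f ∈ FF κ M) (hg : g ∈ FF κ M) :
    cu rm f = cu rm g ↔ AE κ U (fun ξ => fapp f ξ = fapp g ξ) := by
  have hκ := rm.mem
  have uf := rm.uf
  constructor
  · induction f using (UR_wf (κ := κ) (M := M) rm.oi).induction generalizing g with
    | _ f ih =>
    intro hfg
    have hfM := (mem_FF.1 hf).1
    have hgM := (mem_FF.1 hg).1
    by_contra hne
    have h1 := AE.not uf (TM.of dfn) hne
    -- one direction of inclusion fails
    by_cases h2 : AE κ U (fun ξ => ∃ z ∈ fapp f ξ, z ∉ fapp g ξ)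
    · obtain ⟨h, hh, hhf, hP⟩ := TM.choice (M := M) (a := κ) (P := fun ξ z =>
        (∃ z ∈ fapp f ξ, z ∉ fapp g ξ) → z ∈ fapp f ξ ∧ z ∉ fapp g ξ) hκ dfn (by
          intro ξ hξ
          by_cases hz : ∃ z ∈ fapp f ξ, z ∉ fapp g ξ
          · obtain ⟨z, hz1, hz2⟩ := hz
            exact ⟨z, TM.tr (fapp_memM hfM (TM.tr hκ hξ)) hz1, fun _ => ⟨hz1, hz2⟩⟩
          · exact ⟨κ, hκ, fun h => absurd h hz⟩)
      have hhF := mem_FF.2 ⟨hh, hhf⟩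
      have h3 : UR κ U h f := AE.mono uf h2 (TM.of dfn) fun ξ hξ h => (hP ξ hξ h).1
      have h4 : cu rm h ∈ cu rm g := by
        rw [← hfg]; exact (mem_cu rm hf).2 ⟨h, hhF, h3, rfl⟩
      obtain ⟨h', hh', h5, h6⟩ := (mem_cu rm hg).1 h4
      have h7 := ih h ⟨hhF, hf, h3⟩ hhF hh' h6.symm
      have hh'M := (mem_FF.1 hh').1
      obtain ⟨ξ, hξ, h8, h9⟩ := AE.ex2 uf (AE.mono2 uf h5 h7 (Q := fun ξ => fapp h ξ ∈ fapp g ξ)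
        (TM.of dfn) fun ξ hξ h1 h2 => by rw [h2]; exact h1) h2
      exact (hP ξ hξ h9).2 h8
    · have h2' := AE.not uf (TM.of dfn) h2
      have h2 : AE κ U (fun ξ => ∃ z ∈ fapp g ξ, z ∉ fapp f ξ) := by
        refine AE.mono2 uf h1 h2' (TM.of dfn) fun ξ hξ h1 h2 => ?_
        by_contra h3
        push Not at h2 h3
        exact h1 (ZFSet.ext fun z => ⟨h2 z, h3 z⟩)
      obtain ⟨h, hh, hhf, hP⟩ := TM.choice (M := M) (a := κ) (P := fun ξ z =>
        (∃ z ∈ fapp g ξ, z ∉ fapp f ξ) → z ∈ fapp g ξ ∧ z ∉ fapp f ξ) hκ dfn (by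
          intro ξ hξ
          by_cases hz : ∃ z ∈ fapp g ξ, z ∉ fapp f ξ
          · obtain ⟨z, hz1, hz2⟩ := hz
            exact ⟨z, TM.tr (fapp_memM hgM (TM.tr hκ hξ)) hz1, fun _ => ⟨hz1, hz2⟩⟩
          · exact ⟨κ, hκ, fun h => absurd h hz⟩)
      have hhF := mem_FF.2 ⟨hh, hhf⟩
      have h3 : UR κ U h g := AE.mono uf h2 (TM.of dfn) fun ξ hξ h => (hP ξ hξ h).1
      have h4 : cu rm h ∈ cu rm f := by
        rw [hfg]; exact (mem_cu rm hg).2 ⟨h, hhF, h3, rfl⟩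
      obtain ⟨h', hh', h5, h6⟩ := (mem_cu rm hf).1 h4
      have h7 := ih h' ⟨hh', hf, h5⟩ hh' hhF h6
      have hh'M := (mem_FF.1 hh').1
      obtain ⟨ξ, hξ, h8, h9⟩ := AE.ex2 uf (AE.mono2 uf h5 h7 (Q := fun ξ => fapp h ξ ∈ fapp f ξ)
        (TM.of dfn) fun ξ hξ h1 h2 => by rw [← h2]; exact h1) h2
      exact (hP ξ hξ h9).2 h8
  · intro h
    have hfM := (mem_FF.1 hf).1
    have hgM := (mem_FF.1 hg).1
    ext z
    rw [mem_cu rm hf, mem_cu rm hg]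
    constructor
    · rintro ⟨k, hk, h1, h2⟩
      have hkM := (mem_FF.1 hk).1
      exact ⟨k, hk, AE.mono2 uf h h1 (TM.of dfn) fun ξ hξ h1 h2 => by rw [← h1]; exact h2, h2⟩
    · rintro ⟨k, hk, h1, h2⟩
      have hkM := (mem_FF.1 hk).1
      exact ⟨k, hk, AE.mono2 uf h h1 (TM.of dfn) fun ξ hξ h1 h2 => by rw [h1]; exact h2, h2⟩

theorem cu_mem (rm : RM κ M U) {f g : ZFSet.{u}} (hf : f ∈ FF κ M) (hg : g ∈ FF κ M) :
    cu rm f ∈ cu rm g ↔ AE κ U (fun ξ => fapp f ξ ∈ fapp g ξ) := by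
  have hκ := rm.mem
  constructor
  · intro h
    obtain ⟨k, hk, h1, h2⟩ := (mem_cu rm hg).1 h
    have := (cu_eq rm hk hf).1 h2
    have hfM := (mem_FF.1 hf).1
    have hgM := (mem_FF.1 hg).1
    exact AE.mono2 rm.uf h1 this (TM.of dfn) fun ξ hξ h1 h2 => by rw [← h2]; exact h1
  · intro h
    exact (mem_cu rm hg).2 ⟨f, hf, h, rfl⟩

theorem Nu_tr (rm : RM κ M U) : (Nu rm).IsTransitive := by
  intro x hx y hy
  obtain ⟨f, hf, rfl⟩ := mem_im.1 hx
  obtain ⟨g, hg, -, rfl⟩ := (mem_cu rm hf).1 hy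
  exact mem_im.2 ⟨g, hg, rfl⟩

theorem cu_Nu (rm : RM κ M U) {f : ZFSet.{u}} (hf : f ∈ FF κ M) : cu rm f ∈ Nu rm := mem_im.2 ⟨f, hf, rfl⟩

theorem const_FF (rm : RM κ M U) {x : ZFSet.{u}} (hx : x ∈ M) : mkf (fun _ => x) κ ∈ FF κ M := by
  have hκ := rm.mem
  exact mkf_FF rm (TM.of dfn)

theorem los (rm : RM κ M U) (φ : Fml) : ∀ v : ℕ → ZFSet.{u}, (∀ n, v n ∈ FF κ M) →
    (Sat (Nu rm).toSet φ (fun n => cu rm (v n)) ↔ AE κ U (fun ξ => Sat M.toSet φ (fun n => fapp (v n) ξ))) := by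
  have hκ := rm.mem
  have uf := rm.uf
  have hsep : ∀ (φ : Fml) (v : ℕ → ZFSet.{u}), (∀ n, v n ∈ FF κ M) →
      ZFSet.sep (fun ξ => Sat M.toSet φ (fun n => fapp (v n) ξ)) κ ∈ M := fun φ v hv =>
    TM.sep_mem hκ (Dfn.sat φ (fun n E => fapp (v n) (E 0)) fun n =>
      T.fapp (T.constM (mem_FF.1 (hv n)).1) (T.var 0))
  induction φ with
  | mem i j => intro v hv; exact cu_mem rm (hv i) (hv j)
  | eq i j => intro v hv; exact cu_eq rm (hv i) (hv j)
  | impl φ ψ ih1 ih2 =>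
    intro v hv
    simp only [Sat]
    rw [ih1 v hv, ih2 v hv]
    have hM := hsep (.impl φ ψ) v hv
    constructor
    · intro h
      by_cases h1 : AE κ U (fun ξ => Sat M.toSet φ (fun n => fapp (v n) ξ))
      · exact AE.mono uf (h h1) hM fun ξ _ h _ => h
      · exact AE.mono uf (AE.not uf (hsep φ v hv) h1) hM fun ξ _ h h' => absurd h' h
    · intro h h1
      exact AE.mono2 uf h h1 (hsep ψ v hv) fun ξ _ h h' => h h'
  | neg φ ih =>
    intro v hv
    simp only [Sat]
    rw [ih v hv]
    constructor
    · intro h; exact AE.not uf (hsep φ v hv) h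
    · intro h h'
      obtain ⟨ξ, _, h1, h2⟩ := AE.ex2 uf h h'
      exact h1 h2
  | all m φ ih =>
    intro v hv
    have hM := hsep (.all m φ) v hv
    have hup : ∀ (f : ZFSet) (ξ : ZFSet), (fun n => fapp (Function.update v m f n) ξ) =
        Function.update (fun n => fapp (v n) ξ) m (fapp f ξ) := by
      intro f ξ; funext n
      by_cases h : n = m
      · subst h; simp
      · simp [h]
    have hup' : ∀ (f : ZFSet), (fun n => cu rm (Function.update v m f n)) =
        Function.update (fun n => cu rm (v n)) m (cu rm f) := by
      intro f; funext n
      by_cases h : n = m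
      · subst h; simp
      · simp [h]
    have hv' : ∀ f ∈ FF κ M, ∀ n, Function.update v m f n ∈ FF κ M := by
      intro f hf n
      by_cases h : n = m
      · subst h; simpa using hf
      · simpa [h] using hv n
    have key : Sat (Nu rm).toSet (.all m φ) (fun n => cu rm (v n)) ↔
        ∀ f ∈ FF κ M, AE κ U (fun ξ => Sat M.toSet φ (Function.update (fun n => fapp (v n) ξ) m (fapp f ξ))) := by
      simp only [Sat]
      constructor
      · intro h f hf
        have := (ih _ (hv' f hf)).1 (by rw [hup' f]; exact h _ (cu_Nu rm hf))
        simpa only [hup] using this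
      · intro h x hx
        obtain ⟨f, hf, rfl⟩ := mem_im.1 (show x ∈ im (cu rm) (FF κ M) from hx)
        have := (ih _ (hv' f hf)).2 (by simpa only [hup] using h f hf)
        rw [hup' f] at this
        exact this
    rw [key]
    constructor
    · intro h
      by_contra hc
      have hc := AE.not uf hM hc
      have d1 : Dfn (one M) (fun E => Sat M.toSet φ (Function.update (fun n => fapp (v n) (E 0)) m (E 1))) := by
        refine (Dfn.sat φ (fun n E => if n = m then E 1 else fapp (v n) (E 0)) fun n => ?_).congr fun E _ => ?_
        · by_cases h : n = m
          · simp only [h, if_true]; exact T.var 1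
          · simp only [h, if_false]; exact T.fapp (T.constM (mem_FF.1 (hv n)).1) (T.var 0)
        · have : (fun n => if n = m then E 1 else fapp (v n) (E 0)) =
            Function.update (fun n => fapp (v n) (E 0)) m (E 1) := by
            funext n
            by_cases h : n = m
            · subst h; simp
            · simp [h]
          rw [this]
      have d2 : Dfn (one M) (fun E => Sat M.toSet (.all m φ) (fun n => fapp (v n) (E 0))) :=
        Dfn.sat (.all m φ) (fun n E => fapp (v n) (E 0)) fun n =>
          T.fapp (T.constM (mem_FF.1 (hv n)).1) (T.var 0)
      obtain ⟨f, hf, hff, hP⟩ := TM.choice (M := M) (a := κ) (P := fun ξ y =>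
        ¬ Sat M.toSet (.all m φ) (fun n => fapp (v n) ξ) →
          ¬ Sat M.toSet φ (Function.update (fun n => fapp (v n) ξ) m y)) hκ (d2.not.imp d1.not) (by
          intro ξ hξ
          by_cases h' : Sat M.toSet (.all m φ) (fun n => fapp (v n) ξ)
          · exact ⟨κ, hκ, fun h => absurd h' h⟩
          · have h'' := h'
            simp only [Sat] at h''
            push Not at h''
            obtain ⟨x, hx, h2⟩ := h''
            exact ⟨x, hx, fun _ => h2⟩)
      obtain ⟨ξ, hξ, h1, h2⟩ := AE.ex2 uf (h f (mem_FF.2 ⟨hf, hff⟩)) hc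
      exact hP ξ hξ h2 h1
    · intro h f hf
      have := hsep φ _ (hv' f hf)
      simp only [hup] at this
      exact AE.mono uf h this fun ξ hξ h' => h' _ (fapp_memM (mem_FF.1 hf).1 (TM.tr hκ hξ))

theorem cu_upair (rm : RM κ M U) {a b : ZFSet.{u} → ZFSet.{u}} (ha : mkf a κ ∈ M) (hb : mkf b κ ∈ M)
    (hab : mkf (fun ξ => {a ξ, b ξ}) κ ∈ M) :
    cu rm (mkf (fun ξ => {a ξ, b ξ}) κ) = {cu rm (mkf a κ), cu rm (mkf b κ)} := by
  have hκ := rm.mem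
  ext z
  rw [mem_cu rm (mkf_FF rm hab), mem_pair]
  constructor
  · rintro ⟨g, hg, h, rfl⟩
    have hgM := (mem_FF.1 hg).1
    by_cases h1 : AE κ U (fun ξ => fapp g ξ = fapp (mkf a κ) ξ)
    · exact Or.inl ((cu_eq rm hg (mkf_FF rm ha)).2 h1)
    · refine Or.inr ((cu_eq rm hg (mkf_FF rm hb)).2 ?_)
      refine AE.mono2 rm.uf (AE.not rm.uf (TM.of dfn) h1) h (TM.of dfn) fun ξ hξ h1 h2 => ?_
      rw [fapp_mkf hξ, mem_pair] at h2
      rw [fapp_mkf hξ] at h1 ⊢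
      exact h2.resolve_left h1
  · rintro (rfl | rfl)
    · exact ⟨_, mkf_FF rm ha, AE.all rm.uf fun ξ hξ => by rw [fapp_mkf hξ, fapp_mkf hξ]; simp, rfl⟩
    · exact ⟨_, mkf_FF rm hb, AE.all rm.uf fun ξ hξ => by rw [fapp_mkf hξ, fapp_mkf hξ]; simp, rfl⟩

theorem cu_pair (rm : RM κ M U) {a b : ZFSet.{u}} (ha : a ∈ FF κ M) (hb : b ∈ FF κ M) :
    cu rm (mkf (fun ξ => pair (fapp a ξ) (fapp b ξ)) κ) = pair (cu rm a) (cu rm b) := by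
  have hκ := rm.mem
  have haM := (mem_FF.1 ha).1
  have hbM := (mem_FF.1 hb).1
  have e : ∀ {f : ZFSet}, f ∈ FF κ M → mkf (fapp f) κ = f := by
    intro f hf
    refine IsZFunc.ext (IsZFunc.mkf _ _) (mem_FF.1 hf).2 fun ξ hξ => fapp_mkf hξ
  have h1 : ∀ x y : ZFSet, pair x y = {{x, x}, {x, y}} := by
    intro x y
    have : ({x, x} : ZFSet) = {x} := by ext z; simp
    rw [this, ZFSet.pair]
  rw [h1 (cu rm a), show (fun ξ => pair (fapp a ξ) (fapp b ξ)) = fun ξ => {{fapp a ξ, fapp a ξ}, {fapp a ξ, fapp b ξ}} from funext fun ξ => h1 _ _]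
  have m1 : mkf (fun ξ => ({fapp a ξ, fapp a ξ} : ZFSet)) κ ∈ M := TM.of (T.mkf (f := fun ξ E => {fapp a ξ, fapp a ξ}) dfn dfn)
  have m2 : mkf (fun ξ => ({fapp a ξ, fapp b ξ} : ZFSet)) κ ∈ M := TM.of (T.mkf (f := fun ξ E => {fapp a ξ, fapp b ξ}) dfn dfn)
  have m3 : mkf (fun ξ => ({{fapp a ξ, fapp a ξ}, {fapp a ξ, fapp b ξ}} : ZFSet)) κ ∈ M :=
    TM.of (T.mkf (f := fun ξ E => {{fapp a ξ, fapp a ξ}, {fapp a ξ, fapp b ξ}}) dfn dfn)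
  rw [cu_upair rm m1 m2 m3, cu_upair rm (by rwa [e ha]) (by rwa [e ha]) m1,
    cu_upair rm (by rwa [e ha]) (by rwa [e hb]) m2, e ha, e hb]

theorem ju_lt (rm : RM κ M U) {γ : ZFSet.{u}} (hγ : γ ∈ κ) : ju rm γ = γ := by
  have hκ := rm.mem
  induction γ using ZFSet.inductionOn with
  | _ γ ih =>
  have hγM := TM.tr hκ hγ
  ext z
  unfold ju
  rw [mem_cu rm (const_FF rm hγM)]
  constructor
  · rintro ⟨g, hg, h, rfl⟩
    have hgM := (mem_FF.1 hg).1
    have h1 : AE κ U (fun ξ => fapp g ξ ∈ ξ) := by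
      refine AE.mono2 rm.uf h (rm.uf.2.1 γ hγ) (TM.of dfn) fun ξ hξ h1 h2 => ?_
      rw [fapp_mkf hξ] at h1
      exact KC.mem_of_notMem hξ hγ h2 h1
    obtain ⟨δ, hδ, h2⟩ := rm.uf.normal hgM (mem_FF.1 hg).2 h1
    have hδM := TM.tr hκ hδ
    obtain ⟨ξ, hξ, h3, h4⟩ := AE.ex2 rm.uf h h2
    rw [fapp_mkf hξ, h4] at h3
    rw [← ih δ h3 hδ] at h3
    have : cu rm g = ju rm δ := (cu_eq rm hg (const_FF rm (TM.tr hκ hδ))).2 (AE.mono rm.uf h2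
      (TM.of dfn) fun ξ hξ h => by rw [fapp_mkf hξ, h])
    rw [this]; exact h3
  · intro hz
    refine ⟨mkf (fun _ => z) κ, const_FF rm (TM.tr hγM hz), AE.all rm.uf fun ξ hξ => ?_, ih z hz (KC.tr hγ hz)⟩
    rw [fapp_mkf hξ, fapp_mkf hξ]; exact hz

theorem id_FF (rm : RM κ M U) : mkf (fun x => x) κ ∈ FF κ M := by
  have hκ := rm.mem
  exact mkf_FF rm (TM.of dfn)

theorem cu_id (rm : RM κ M U) : cu rm (mkf (fun x => x) κ) = κ := by
  have hκ := rm.mem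
  ext z
  rw [mem_cu rm (id_FF rm)]
  constructor
  · rintro ⟨g, hg, h, rfl⟩
    have hgM := (mem_FF.1 hg).1
    have h1 : AE κ U (fun ξ => fapp g ξ ∈ ξ) :=
      AE.mono rm.uf h (TM.of dfn) fun ξ hξ h => by rwa [fapp_mkf hξ] at h
    obtain ⟨δ, hδ, h2⟩ := rm.uf.normal hgM (mem_FF.1 hg).2 h1
    have hδM := TM.tr hκ hδ
    have : cu rm g = ju rm δ := (cu_eq rm hg (const_FF rm (TM.tr hκ hδ))).2 (AE.mono rm.uf h2
      (TM.of dfn) fun ξ hξ h => by rw [fapp_mkf hξ, h])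
    rw [this, ju_lt rm hδ]; exact hδ
  · intro hz
    have hzM := TM.tr hκ hz
    refine ⟨mkf (fun _ => z) κ, const_FF rm hzM, ?_, ju_lt rm hz⟩
    refine AE.mono rm.uf (rm.uf.2.1 _ (KC.succ_mem hz)) (TM.of dfn) fun ξ hξ h => ?_
    rw [fapp_mkf hξ, fapp_mkf hξ]
    exact KC.mem_of_notMem hξ (KC.succ_mem hz) h (mem_insert _ _)

theorem ultrapower_exists (rm : RM κ M U) : IsUltrapowerEmb κ M U (Nu rm) (ju rm) := by
  have hκ := rm.mem
  refine ⟨Nu_tr rm, fun x hx => cu_Nu rm (const_FF rm hx), fun φ v hv => ?_, fun a ha => ?_, fun A hA hs => ?_⟩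
  · rw [show (fun n => ju rm (v n)) = (fun n => cu rm (mkf (fun _ => v n) κ)) from rfl,
      los rm φ _ fun n => const_FF rm (hv n)]
    constructor
    · intro h
      refine AE.all rm.uf fun ξ hξ => ?_
      simpa only [fapp_mkf hξ] using h
    · intro h
      obtain ⟨ξ, hξ, h⟩ := AE.ex rm.uf h
      simpa only [fapp_mkf hξ] using h
  · obtain ⟨f, hf, rfl⟩ := mem_im.1 ha
    obtain ⟨hfM, hff⟩ := mem_FF.1 hf
    refine ⟨f, hfM, hff, fun ξ hξ => fapp_memM hfM (TM.tr hκ hξ), ?_⟩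
    have key : ∀ g ∈ FF κ M, (pair κ (cu rm g) ∈ ju rm f ↔ AE κ U (fun ξ => pair ξ (fapp g ξ) ∈ f)) := by
      intro g hg
      have hgM := (mem_FF.1 hg).1
      have hi := (mem_FF.1 (id_FF rm)).1
      have hm : mkf (fun ξ => pair (fapp (mkf (fun x => x) κ) ξ) (fapp g ξ)) κ ∈ M := TM.of dfn
      have h1 := cu_pair rm (id_FF rm) hg
      rw [cu_id] at h1
      rw [← h1]
      unfold ju
      rw [cu_mem rm (mkf_FF rm hm) (const_FF rm hfM)]
      unfold AE
      have : (ZFSet.sep (fun ξ => fapp (mkf (fun ξ => pair (fapp (mkf (fun x => x) κ) ξ) (fapp g ξ)) κ) ξ ∈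
        fapp (mkf (fun _ => f) κ) ξ) κ) = ZFSet.sep (fun ξ => pair ξ (fapp g ξ) ∈ f) κ := by
        ext ξ
        rw [mem_sep, mem_sep]
        refine and_congr_right fun hξ => ?_
        rw [fapp_mkf hξ, fapp_mkf hξ, fapp_mkf hξ]
      rw [this]
    refine fapp_of_unique ((key f hf).2 (AE.all rm.uf fun ξ hξ => hff.fapp_mem hξ)) fun y hy => ?_
    have hyN : y ∈ Nu rm := (mem_of_pair_mem (Nu_tr rm) (cu_Nu rm (const_FF rm hfM)) hy).2
    obtain ⟨g, hg, rfl⟩ := mem_im.1 hyN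
    have hgM := (mem_FF.1 hg).1
    exact (cu_eq rm hg hf).2 (AE.mono rm.uf ((key g hg).1 hy) (TM.of dfn) fun ξ hξ h => (hff.fapp_eq h).symm)
  · have h1 : κ ∈ ju rm A ↔ AE κ U (fun ξ => fapp (mkf (fun x => x) κ) ξ ∈ fapp (mkf (fun _ => A) κ) ξ) := by
      rw [← cu_mem rm (id_FF rm) (const_FF rm hA), cu_id]; rfl
    rw [h1]
    unfold AE
    have : (ZFSet.sep (fun ξ => fapp (mkf (fun x => x) κ) ξ ∈ fapp (mkf (fun _ => A) κ) ξ) κ) = A := by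
      ext ξ
      rw [mem_sep]
      constructor
      · rintro ⟨hξ, h⟩; rwa [fapp_mkf hξ, fapp_mkf hξ] at h
      · intro h
        refine ⟨hs h, ?_⟩
        rwa [fapp_mkf (hs h), fapp_mkf (hs h)]
    rw [this]

end

theorem IsRamseyMeasure.up {W : ZFSet.{u}} (h : IsRamseyMeasure κ W) :
    IsUltrapowerEmb κ (MU κ W) W (NU κ W) (jU κ W) := by
  have rm := h.rms.toRM
  have := rm.tm
  have h0 : ∃ p : ZFSet × (ZFSet → ZFSet), IsUltrapowerEmb κ (MU κ W) W p.1 p.2 :=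
    ⟨(_, _), ultrapower_exists rm⟩
  unfold NU jU upData
  rw [dif_pos h0]
  exact h0.choose_spec

end

set_option linter.unusedSectionVars false

/-! ### Uniqueness of the ultrapower -/

section
variable {κ M U N : ZFSet.{u}} {j : ZFSet.{u} → ZFSet.{u}} [KC κ] [TM M]

theorem tr2 (hN : N.IsTransitive) : Tr {(M, id), (N, j)} := ⟨by
  rintro s (rfl | rfl)
  · exact (TM.h (M := M)).1
  · exact hN⟩

theorem RM.kappa_mem (rm : RM κ M U) : κ ∈ U := by
  have h1 := rm.uf.2.1 ∅ KC.empty_mem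
  have : tailSet κ ∅ = κ := by
    ext x
    simp [tailSet, mem_sep]
  rwa [this] at h1

section
variable (rm : RM κ M U) (em : IsUltrapowerEmb κ M U N j)


theorem em_kappa (rm : RM κ M U) (em : IsUltrapowerEmb κ M U N j) : κ ∈ j κ := (em.2.2.2.2 κ rm.mem (fun _ h => h)).1 rm.kappa_mem

theorem em_func (rm : RM κ M U) (em : IsUltrapowerEmb κ M U N j) {f : ZFSet.{u}} (hf : f ∈ FF κ M) : IsZFunc (j κ) (j f) := by
  have := tr2 (M := M) (j := j) em.1
  have hκ := rm.mem
  have hj := em.2.1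
  obtain ⟨hfM, hff⟩ := mem_FF.1 hf
  exact (Dfn.elem κ hκ hj em.2.2.1 (P := fun _ e => IsZFunc (e κ) (e f)) dfn).1 hff

theorem em_los (rm : RM κ M U) (em : IsUltrapowerEmb κ M U N j) {R : ZFSet.{u} → ZFSet.{u} → Prop} (hR : ∀ {s t}, T {(M, id), (N, j)} s → T {(M, id), (N, j)} t →
    Dfn {(M, id), (N, j)} (fun E => R (s E) (t E)))
    {f g : ZFSet.{u}} (hf : f ∈ FF κ M) (hg : g ∈ FF κ M)
    (hA : ZFSet.sep (fun ξ => R (fapp f ξ) (fapp g ξ)) κ ∈ M) :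
    R (fapp (j f) κ) (fapp (j g) κ) ↔ AE κ U (fun ξ => R (fapp f ξ) (fapp g ξ)) := by
  have := tr2 (M := M) (j := j) em.1
  have hκ := rm.mem
  have hj := em.2.1
  obtain ⟨hfM, hff⟩ := mem_FF.1 hf
  obtain ⟨hgM, hgf⟩ := mem_FF.1 hg
  have hk := em_kappa rm em
  have hf' := em_func rm em hf
  have hg' := em_func rm em hg
  have key := (Dfn.elem κ hκ hj em.2.2.1 (P := fun D e => ∀ ξ ∈ e κ, (ξ ∈ e (ZFSet.sep (fun ξ => R (fapp f ξ) (fapp g ξ)) κ) ↔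
    ∃ x ∈ D, ∃ y ∈ D, pair ξ x ∈ e f ∧ pair ξ y ∈ e g ∧ R x y)) (by
      refine Dfn.ball dfn (Dfn.iff dfn (Dfn.ex (Dfn.ex (Dfn.and dfn (Dfn.and dfn (hR dfn dfn)))))))).1 (by
    intro ξ hξ
    simp only [id]
    rw [mem_sep]
    constructor
    · rintro ⟨hξ, h⟩
      exact ⟨_, fapp_memM hfM (TM.tr hκ hξ), _, fapp_memM hgM (TM.tr hκ hξ), hff.fapp_mem hξ, hgf.fapp_mem hξ, h⟩
    · rintro ⟨x, _, y, _, hx, hy, h⟩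
      rw [hff.fapp_eq hx, hgf.fapp_eq hy]; exact ⟨hξ, h⟩) κ hk
  unfold AE
  rw [em.2.2.2.2 _ hA sep_sub', key]
  constructor
  · intro h
    have h1 := hf'.fapp_mem hk
    have h2 := hg'.fapp_mem hk
    exact ⟨_, (mem_of_pair_mem em.1 (hj f hfM) h1).2, _, (mem_of_pair_mem em.1 (hj g hgM) h2).2, h1, h2, h⟩
  · rintro ⟨x, _, y, _, hx, hy, h⟩
    rwa [hf'.fapp_eq hx, hg'.fapp_eq hy]

theorem em_mem (rm : RM κ M U) (em : IsUltrapowerEmb κ M U N j) {f g : ZFSet.{u}} (hf : f ∈ FF κ M) (hg : g ∈ FF κ M) :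
    fapp (j f) κ ∈ fapp (j g) κ ↔ UR κ U f g := by
  have hκ := rm.mem
  have hfM := (mem_FF.1 hf).1
  have hgM := (mem_FF.1 hg).1
  exact em_los rm em (R := fun x y => x ∈ y) (fun hs ht => Dfn.mem hs ht) hf hg (TM.of dfn)

theorem em_cu (rm : RM κ M U) (em : IsUltrapowerEmb κ M U N j) {f : ZFSet.{u}} (hf : f ∈ FF κ M) : fapp (j f) κ = cu rm f := by
  have hj := em.2.1
  have hk := em_kappa rm em
  induction f using (UR_wf (κ := κ) (M := M) rm.oi).induction with
  | _ f ih =>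
  have hfM := (mem_FF.1 hf).1
  ext z
  rw [mem_cu rm hf]
  constructor
  · intro hz
    have h1 := (mem_of_pair_mem em.1 (hj f hfM) ((em_func rm em hf).fapp_mem hk)).2
    obtain ⟨g, hg, hgf, -, rfl⟩ := em.2.2.2.1 z (em.1 _ h1 hz)
    have hg := mem_FF.2 ⟨hg, hgf⟩
    have h2 := (em_mem rm em hg hf).1 hz
    exact ⟨g, hg, h2, (ih g ⟨hg, hf, h2⟩ hg).symm⟩
  · rintro ⟨g, hg, h2, rfl⟩
    rw [← ih g ⟨hg, hf, h2⟩ hg]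
    exact (em_mem rm em hg hf).2 h2

theorem em_N (rm : RM κ M U) (em : IsUltrapowerEmb κ M U N j) : N = Nu rm := by
  have hj := em.2.1
  have hk := em_kappa rm em
  ext z
  constructor
  · intro hz
    obtain ⟨g, hg, hgf, -, rfl⟩ := em.2.2.2.1 z hz
    have hg := mem_FF.2 ⟨hg, hgf⟩
    rw [em_cu rm em hg]
    exact cu_Nu rm hg
  · intro hz
    obtain ⟨f, hf, rfl⟩ := mem_im.1 hz
    rw [← em_cu rm em hf]
    exact (mem_of_pair_mem em.1 (hj f (mem_FF.1 hf).1) ((em_func rm em hf).fapp_mem hk)).2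

theorem em_j (rm : RM κ M U) (em : IsUltrapowerEmb κ M U N j) {x : ZFSet.{u}} (hx : x ∈ M) : j x = ju rm x := by
  have := tr2 (M := M) (j := j) em.1
  have hκ := rm.mem
  have hj := em.2.1
  have hc := const_FF rm hx
  have hcM := (mem_FF.1 hc).1
  unfold ju
  rw [← em_cu rm em hc]
  symm
  refine (em_func rm em hc).fapp_eq ?_
  exact (Dfn.elem κ hκ hj em.2.2.1 (P := fun D e => ∀ ξ ∈ e κ, pair ξ (e x) ∈ e (mkf (fun _ => x) κ)) dfn).1
    (fun ξ hξ => by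
      have := (IsZFunc.mkf (fun _ => x) κ).fapp_mem hξ
      rwa [fapp_mkf (a := κ) hξ] at this) κ (em_kappa rm em)

end

/-! ### `P(κ) ∩ N ⊆ M ⊆ N` -/

theorem pow_Nu (rm : RM κ M U) {A : ZFSet.{u}} (hA : A ∈ Nu rm) (hs : A ⊆ κ) : A ∈ M := by
  have hκ := rm.mem
  obtain ⟨f, hf, rfl⟩ := mem_im.1 hA
  have hfM := (mem_FF.1 hf).1
  have hg : mkf (fun α => ZFSet.sep (fun ξ => α ∈ fapp f ξ) κ) κ ∈ M := TM.of dfn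
  set g := mkf (fun α => ZFSet.sep (fun ξ => α ∈ fapp f ξ) κ) κ with hgd
  have hX : im (fapp g) κ ∈ M := TM.of dfn
  have hXU : im (fapp g) κ ∩ U ∈ M := rm.wa _ hX ⟨g, hg, IsZFunc.mkf _ _, fun y hy => mem_im.1 hy⟩
  have e : cu rm f = ZFSet.sep (fun α => fapp g α ∈ im (fapp g) κ ∩ U) κ := by
    ext α
    rw [mem_sep]
    have key : ∀ α ∈ κ, (α ∈ cu rm f ↔ fapp g α ∈ U) := by
      intro α hα
      have h1 := cu_mem rm (const_FF rm (TM.tr hκ hα)) hf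
      have h2 : cu rm (mkf (fun _ => α) κ) = α := ju_lt rm hα
      rw [h2] at h1
      rw [h1, hgd, fapp_mkf hα]
      unfold AE
      have : ZFSet.sep (fun ξ => fapp (mkf (fun _ => α) κ) ξ ∈ fapp f ξ) κ = ZFSet.sep (fun ξ => α ∈ fapp f ξ) κ := by
        ext ξ
        rw [mem_sep, mem_sep]
        exact and_congr_right fun hξ => by rw [fapp_mkf hξ]
      rw [this]
    constructor
    · intro h
      exact ⟨hs h, mem_inter.2 ⟨mem_im.2 ⟨α, hs h, rfl⟩, (key α (hs h)).1 h⟩⟩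
    · rintro ⟨h, h'⟩
      exact (key α h).2 (mem_inter.1 h').2
  rw [e]
  exact TM.of dfn

theorem sub_Nu (rm : RM κ M U) {x : ZFSet.{u}} (hx : sm κ M x) : x ∈ Nu rm := by
  have hκ := rm.mem
  have uf := rm.uf
  obtain ⟨g, hg, hw, η, hη, rfl⟩ := hx
  let R : ZFSet.{u} → ZFSet.{u} → Prop := fun p q => ∃ ξ ∈ κ, ∃ η' ∈ ξ, ∃ η ∈ κ, p = pair ξ η' ∧ q = pair ξ η ∧
    fapp g η' ∈ fapp g η
  have hR : ∀ {ξ η' η}, ξ ∈ κ → η ∈ κ → (R (pair ξ η') (pair ξ η) ↔ η' ∈ ξ ∧ fapp g η' ∈ fapp g η) := by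
    intro ξ η' η hξ hη
    constructor
    · rintro ⟨a, ha, b, hb, c, hc, e1, e2, h⟩
      rw [pair_inj] at e1 e2
      obtain ⟨rfl, rfl⟩ := e1
      obtain ⟨-, rfl⟩ := e2
      exact ⟨hb, h⟩
    · rintro ⟨h1, h2⟩
      exact ⟨ξ, hξ, η', h1, η, hη, rfl, rfl, h2⟩
  have wf : WellFounded (rst (prod κ κ) R) := by
    rw [wellFounded_iff_isEmpty_descending_chain]
    refine ⟨fun ⟨s, hs⟩ => ?_⟩
    have : ∀ n, ∃ η, ∃ ξ, s n = pair ξ η := fun n => by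
      obtain ⟨a, _, b, _, e⟩ := mem_prod.1 (hs n).2.1
      exact ⟨b, a, e⟩
    choose t ht using this
    refine (wellFounded_iff_isEmpty_descending_chain.1 ZFSet.mem_wf).false ⟨fun n => fapp g (t n), fun n => ?_⟩
    obtain ⟨ξ', h1⟩ := ht n
    obtain ⟨ξ'', h2⟩ := ht (n+1)
    obtain ⟨a, ha, b, hb, c, hc, e1, e2, h⟩ := (hs n).2.2
    rw [h2, pair_inj] at e1
    rw [h1, pair_inj] at e2
    change fapp g (t (n+1)) ∈ fapp g (t n)
    rw [e1.2, e2.2]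
    exact h
  have hF : mkf (col wf) (prod κ κ) ∈ M := TM.col_mem wf (TM.of dfn) dfn
  set F := mkf (col wf) (prod κ κ) with hFd
  let c : ZFSet.{u} → ZFSet.{u} := fun η => mkf (fun ξ => fapp F (pair ξ η)) κ
  have hcM : ∀ η ∈ κ, c η ∈ FF κ M := fun η hη => by
    have := TM.tr hκ hη
    exact mkf_FF rm (TM.of dfn)
  have hc : ∀ ξ ∈ κ, ∀ η ∈ κ, fapp (c η) ξ = col wf (pair ξ η) := fun ξ hξ η hη => by
    rw [fapp_mkf hξ, hFd, fapp_mkf (pair_mem_prod.2 ⟨hξ, hη⟩)]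
  have main : ∀ x, ∀ η ∈ κ, fapp g η = x → cu rm (c η) = x := by
    intro x
    induction x using ZFSet.inductionOn with
    | _ x ih =>
    rintro η hη rfl
    ext z
    rw [mem_cu rm (hcM η hη)]
    constructor
    · rintro ⟨h, hh, hu, rfl⟩
      have hhM := (mem_FF.1 hh).1
      have hηM := TM.tr hκ hη
      obtain ⟨e, he, hef, hP⟩ := TM.choice (M := M) (a := κ) (P := fun ξ y =>
        (∃ y ∈ ξ, fapp g y ∈ fapp g η ∧ fapp h ξ = fapp F (pair ξ y)) →
          y ∈ ξ ∧ fapp g y ∈ fapp g η ∧ fapp h ξ = fapp F (pair ξ y)) hκ dfn (by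
          intro ξ hξ
          by_cases hz : ∃ y ∈ ξ, fapp g y ∈ fapp g η ∧ fapp h ξ = fapp F (pair ξ y)
          · obtain ⟨z, hz1, hz2⟩ := hz
            exact ⟨z, TM.tr (TM.tr hκ hξ) hz1, fun _ => ⟨hz1, hz2⟩⟩
          · exact ⟨κ, hκ, fun h => absurd h hz⟩)
      have h1 : AE κ U (fun ξ => ∃ y ∈ ξ, fapp g y ∈ fapp g η ∧ fapp h ξ = fapp F (pair ξ y)) := by
        refine AE.mono uf hu (TM.of dfn) fun ξ hξ h0 => ?_
        rw [hc ξ hξ η hη, mem_col wf (pair_mem_prod.2 ⟨hξ, hη⟩)] at h0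
        obtain ⟨p, hp, hpR, e⟩ := h0
        obtain ⟨a, ha, b, hb, c, hc, e1, e2, h⟩ := id hpR
        rw [pair_inj] at e2
        obtain ⟨rfl, rfl⟩ := e2
        subst e1
        refine ⟨b, hb, h, ?_⟩
        rw [← e, hFd, fapp_mkf hp]
      obtain ⟨δ, hδ, h2⟩ := uf.normal he hef (AE.mono uf h1 (TM.of dfn) fun ξ hξ h => (hP ξ hξ h).1)
      obtain ⟨ξ, hξ, h3, h4⟩ := AE.ex2 uf h1 h2
      have h5 := hP ξ hξ h3
      rw [h4] at h5
      have hδM := TM.tr hκ hδ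
      have : cu rm h = cu rm (c δ) := by
        have hcδ := (mem_FF.1 (hcM δ hδ)).1
        refine (cu_eq rm hh (hcM δ hδ)).2 (AE.mono2 uf h1 h2 (TM.of dfn) fun ξ hξ h1 h2 => ?_)
        have := hP ξ hξ h1
        rw [h2] at this
        rw [this.2.2, fapp_mkf hξ]
      rw [this, ih _ h5.2.1 δ hδ rfl]
      exact h5.2.1
    · intro hz
      obtain ⟨η', hη', rfl⟩ := hw.2 η hη z hz
      refine ⟨c η', hcM η' hη', ?_, ih _ hz η' hη' rfl⟩
      have h1 := (mem_FF.1 (hcM η' hη')).1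
      have h2 := (mem_FF.1 (hcM η hη)).1
      refine AE.mono uf (uf.2.1 _ (KC.succ_mem hη')) (TM.of dfn) fun ξ hξ h => ?_
      rw [hc ξ hξ η hη, hc ξ hξ η' hη', mem_col wf (pair_mem_prod.2 ⟨hξ, hη⟩)]
      exact ⟨_, pair_mem_prod.2 ⟨hξ, hη'⟩,
        (hR hξ hη).2 ⟨KC.mem_of_notMem hξ (KC.succ_mem hη') h (mem_insert _ _), hz⟩, rfl⟩
  rw [← main _ η hη rfl]
  exact cu_Nu rm (hcM η hη)

end

set_option linter.unusedSectionVars false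

/-! ### Closure of `V_κ` -/

section
variable {κ : ZFSet.{u}} [KC κ]

theorem KC.rank_succ {o : Ordinal.{u}} (h : o < rank κ) : Order.succ o < rank κ := by
  have h1 := KC.succ_mem (KC.mem_iff.2 h)
  have h2 := rank_lt_of_mem h1
  rw [rank_insert, Ordinal.rank_toZFSet] at h2
  exact lt_of_le_of_lt (le_max_left _ _) h2

theorem vk_upair {x y : ZFSet.{u}} (hx : x ∈ vk κ) (hy : y ∈ vk κ) : ({x, y} : ZFSet) ∈ vk κ := by
  rw [mem_vk] at *
  rw [rank_pair]
  exact max_lt (KC.rank_succ hx) (KC.rank_succ hy)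

theorem vk_pair {x y : ZFSet.{u}} (hx : x ∈ vk κ) (hy : y ∈ vk κ) : pair x y ∈ vk κ := by
  unfold pair
  refine vk_upair ?_ (vk_upair hx hy)
  have := vk_upair hx hx
  rwa [show ({x, x} : ZFSet) = {x} by ext z; simp] at this

theorem vk_sub {x y : ZFSet.{u}} (hx : x ∈ vk κ) (h : y ⊆ x) : y ∈ vk κ := by
  rw [mem_vk] at *
  exact lt_of_le_of_lt (rank_mono h) hx

theorem vk_pow {x : ZFSet.{u}} (hx : x ∈ vk κ) : powerset x ∈ vk κ := by
  rw [mem_vk] at *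
  rw [rank_powerset]
  exact KC.rank_succ hx

theorem vk_of_mem {x : ZFSet.{u}} (hx : x ∈ κ) : x ∈ vk κ := mem_vk.2 (rank_lt_of_mem hx)

theorem vk_small (hR : IsRamseyCard κ) {x : ZFSet.{u}} (hs : x ⊆ vk κ) (hc : zcard x < zcard κ) : x ∈ vk κ := by
  rw [mem_vk]
  by_contra hn
  push Not at hn
  have h0 : ∃ z, z ∈ x := by
    obtain ⟨y, hy, -⟩ := lt_rank_iff.1 (lt_of_lt_of_le (rank_lt_of_mem (KC.empty_mem (κ := κ))) hn)
    exact ⟨y, hy⟩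
  let γ := (ZFSet.card x).ord.toZFSet
  have hγ : γ ∈ κ := by
    rw [KC.mem_iff, KC.rank_eq, Cardinal.ord_lt_ord]
    exact zcard_lt.1 hc
  obtain ⟨F, h1, h2⟩ := exists_surj (x := x) (y := γ) h0 (by
    rw [zcard_le, Ordinal.card_toZFSet, Cardinal.card_ord])
  refine ramsey_reg hR hγ (fun a => (Order.succ (rank (F a))).toZFSet) (fun a ha => ?_) fun ξ hξ => ?_
  · rw [KC.mem_iff]
    exact KC.rank_succ (mem_vk.1 (hs (h1 a ha)))
  · obtain ⟨y, hy, hle⟩ := lt_rank_iff.1 (lt_of_lt_of_le (rank_lt_of_mem hξ) hn)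
    obtain ⟨a, ha, rfl⟩ := h2 y hy
    refine ⟨a, ha, ?_⟩
    rw [← (KC.ord' hξ).toZFSet_rank_eq, Ordinal.toZFSet_mem_toZFSet_iff]
    exact Order.lt_succ_of_le hle

theorem zcard_powerset_lt (hR : IsRamseyCard κ) {x : ZFSet.{u}} (hc : zcard x < zcard κ) :
    zcard (powerset x) < zcard κ := by
  rw [zcard_lt] at *
  rw [card_powerset]
  exact (ramsey_inacc hR).isStrongLimit.two_power_lt hc

/-! ### Comparing functions -/

/-- `f` is smaller than `g` on a set in `u`. -/
def LT' (u ξ f g : ZFSet.{u}) : Prop :=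
  ∃ s ∈ u, ∀ η ∈ ξ, η ∈ s → ∃ a ∈ ξ, pair η a ∈ f ∧ ∀ b ∈ ξ, pair η b ∈ g → a ∈ b

def Sb (f ξ : ZFSet.{u}) : Prop := ∀ p ∈ f, ∃ a ∈ ξ, ∃ b ∈ ξ, p = pair a b

/-- the sentence to be transferred -/
def Phi (D k : ZFSet.{u}) : Prop :=
  ∀ ξ ∈ k, ∀ u ∈ D, (∀ S ∈ D, (∃ f ∈ S, f = f) → (∀ f ∈ S, Sb f ξ) → ∃ f ∈ S, ∀ g ∈ S, ¬ LT' u ξ g f) →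
    ∃ θ ∈ k, ∃ ρ ∈ D, (∀ f ∈ D, Sb f ξ → ∃ y ∈ θ, pair f y ∈ ρ) ∧
      ∀ f ∈ D, ∀ g ∈ D, ∀ y ∈ D, ∀ z ∈ D, Sb f ξ → Sb g ξ → pair f y ∈ ρ → pair g z ∈ ρ → LT' u ξ f g → y ∈ z

theorem Dfn.LT' {𝒞 : StrC.{u}} [Tr 𝒞] {s t r q : Env.{u} → ZFSet.{u}} (hs : T 𝒞 s) (ht : T 𝒞 t) (hr : T 𝒞 r)
    (hq : T 𝒞 q) : Dfn 𝒞 (fun E => LT' (s E) (t E) (r E) (q E)) := by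
  refine Dfn.s4 (R := MPaper.LT') ?_ hs ht hr hq
  unfold MPaper.LT'
  exact dfn

theorem Dfn.Sb {𝒞 : StrC.{u}} [Tr 𝒞] {s t : Env.{u} → ZFSet.{u}} (hs : T 𝒞 s) (ht : T 𝒞 t) :
    Dfn 𝒞 (fun E => Sb (s E) (t E)) := by
  refine Dfn.s2 (R := MPaper.Sb) ?_ hs ht
  unfold MPaper.Sb
  exact dfn

theorem Phi_elem {M N : ZFSet.{u}} {j : ZFSet.{u} → ZFSet.{u}} [TM M] {U : ZFSet.{u}} (hκ : κ ∈ M)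
    (em : IsUltrapowerEmb κ M U N j) (h : Phi M κ) : Phi N (j κ) := by
  have := tr2 (M := M) (j := j) em.1
  have hj := em.2.1
  refine (Dfn.elem κ hκ hj em.2.2.1 (P := fun D e => Phi D (e κ)) ?_).1 h
  unfold Phi
  refine Dfn.ball dfn (Dfn.all (Dfn.imp (Dfn.all (Dfn.imp dfn (Dfn.imp (Dfn.ball dfn (Dfn.Sb dfn dfn))
    (Dfn.bex dfn (Dfn.ball dfn (Dfn.not (Dfn.LT' dfn dfn dfn dfn))))))) (Dfn.bex dfn (Dfn.ex (Dfn.and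
    (Dfn.all (Dfn.imp (Dfn.Sb dfn dfn) dfn)) (Dfn.all (Dfn.all (Dfn.all (Dfn.all
    (Dfn.imp (Dfn.Sb dfn dfn) (Dfn.imp (Dfn.Sb dfn dfn) (Dfn.imp dfn (Dfn.imp dfn (Dfn.imp
    (Dfn.LT' dfn dfn dfn dfn) dfn))))))))))))))

theorem Phi_true (hR : IsRamseyCard κ) {M W : ZFSet.{u}} (rm : RMs κ M W) : Phi M κ := by
  have := rm.tm
  have hv : ∀ {x}, x ∈ vk κ → x ∈ M := fun hx => TM.tr rm.vk hx
  intro ξ hξ u hu hyp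
  let X := powerset (prod ξ ξ)
  have hξc : zcard (prod ξ ξ) < zcard κ := by
    rw [zcard_prod]
    exact Cardinal.mul_lt_of_lt (KC.inf (κ := κ)) (KC.lt hξ) (KC.lt hξ)
  have hp : prod ξ ξ ∈ vk κ := by
    refine vk_small hR (fun p hp => ?_) hξc
    obtain ⟨a, ha, b, hb, rfl⟩ := mem_prod.1 hp
    exact vk_pair (vk_of_mem (KC.tr hξ ha)) (vk_of_mem (KC.tr hξ hb))
  have hX : X ∈ vk κ := vk_pow hp
  have hXc : zcard X < zcard κ := zcard_powerset_lt hR hξc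
  have hSb : ∀ {f}, Sb f ξ ↔ f ∈ X := by
    intro f
    rw [mem_powerset]
    constructor
    · intro h p hp
      obtain ⟨a, ha, b, hb, rfl⟩ := h p hp
      exact pair_mem_prod.2 ⟨ha, hb⟩
    · intro h p hp
      exact mem_prod.1 (h hp)
  have wf : WellFounded (rst X (LT' u ξ)) := by
    rw [WellFounded.wellFounded_iff_has_min]
    intro s ⟨f0, hf0⟩
    by_cases h : ∃ f ∈ s, f ∈ X
    · obtain ⟨f1, hf1, hf1X⟩ := h
      obtain ⟨f, hf, hmin⟩ := hyp (ZFSet.sep (fun f => f ∈ s) X) (hv (vk_sub hX sep_sub'))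
        ⟨f1, mem_sep.2 ⟨hf1X, hf1⟩, rfl⟩ (fun f hf => hSb.2 (mem_sep.1 hf).1)
      exact ⟨f, (mem_sep.1 hf).2, fun g hg h => hmin g (mem_sep.2 ⟨h.1, hg⟩) h.2.2⟩
    · exact ⟨f0, hf0, fun g hg h' => h ⟨g, hg, h'.1⟩⟩
  have hcol : ∀ f, f ∈ X → col wf f ∈ vk κ := by
    intro f
    induction f using wf.induction with
    | _ f ih =>
    intro hf
    refine vk_small hR (fun z hz => ?_) ?_
    · obtain ⟨g, hg, h, rfl⟩ := (mem_col wf hf).1 hz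
      exact ih g ⟨hg, hf, h⟩ hg
    · refine lt_of_le_of_lt (le_trans (zcard_mono fun z hz => ?_) (zcard_im_le (col wf) X)) hXc
      obtain ⟨g, hg, h, rfl⟩ := (mem_col wf hf).1 hz
      exact mem_im.2 ⟨g, hg, rfl⟩
  have hY : im (col wf) X ∈ vk κ := by
    refine vk_small hR (fun z hz => ?_) (lt_of_le_of_lt (zcard_im_le _ _) hXc)
    obtain ⟨f, hf, rfl⟩ := mem_im.1 hz
    exact hcol f hf
  let r : ZFSet.{u} → ZFSet.{u} := fun f => (rank (col wf f)).toZFSet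
  have hr : ∀ f ∈ X, r f ∈ κ := fun f hf => KC.mem_iff.2 (mem_vk.1 (hcol f hf))
  have hρ : mkf r X ∈ vk κ := by
    refine vk_small hR (x := im (fun f => pair f (r f)) X) (fun z hz => ?_) (lt_of_le_of_lt (zcard_im_le _ _) hXc)
    obtain ⟨f, hf, rfl⟩ := mem_im.1 hz
    exact vk_pair (vk_tr hX hf) (vk_of_mem (hr f hf))
  have hpm := (IsZFunc.mkf r X)
  refine ⟨(rank (im (col wf) X)).toZFSet, KC.mem_iff.2 (mem_vk.1 hY), _, hv hρ, fun f _ hf => ?_, ?_⟩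
  · have hf := hSb.1 hf
    refine ⟨r f, ?_, hpm.pair_mem_iff.2 ⟨hf, fapp_mkf hf⟩⟩
    rw [Ordinal.toZFSet_mem_toZFSet_iff]
    exact rank_lt_of_mem (mem_im.2 ⟨f, hf, rfl⟩)
  · intro f _ g _ y _ z _ hf hg hy hz h
    have hf := hSb.1 hf
    have hg := hSb.1 hg
    rw [hpm.pair_mem_iff, fapp_mkf hf] at hy
    rw [hpm.pair_mem_iff, fapp_mkf hg] at hz
    rw [← hy.2, ← hz.2, Ordinal.toZFSet_mem_toZFSet_iff]
    exact rank_lt_of_mem ((mem_col wf hg).2 ⟨f, hf, h, rfl⟩)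

/-! ### Well-foundedness of `◁` -/

theorem NU_eq {W : ZFSet.{u}} (h : IsRamseyMeasure κ W) (rm : RM κ (MU κ W) W) [TM (MU κ W)] :
    NU κ W = Nu rm := em_N rm h.up

theorem MU_sub_NU {W : ZFSet.{u}} (h : IsRamseyMeasure κ W) : MU κ W ⊆ NU κ W := by
  have rm := h.rms
  have := rm.tm
  intro x hx
  rw [NU_eq h rm.toRM]
  exact sub_Nu rm.toRM (rm.small x hx)

theorem MU_mono {U W : ZFSet.{u}} (h : ramseyMeasureOrder κ U W) : MU κ U ⊆ MU κ W := by
  obtain ⟨hU, hW, hm⟩ := h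
  have ru := hU.rms
  have rw' := hW.rms
  have := ru.tm
  have := rw'.tm
  refine sub_of_pow ru.mem rw'.mem ru.small fun A hA hs => ?_
  have key : ∀ B ∈ U, B ∈ MU κ W := by
    intro B hB
    have h1 : B ∈ NU κ W := hW.up.1 _ hm hB
    rw [NU_eq hW rw'.toRM] at h1
    exact pow_Nu rw'.toRM h1 (ru.uf.1 B hB).2
  rcases ru.uf.or hA hs with h | h
  · exact key A h
  · have h1 := key _ h
    have hκ := rw'.mem
    rw [← compl_compl_eq hs]
    exact TM.of dfn

theorem mu_lt (hR : IsRamseyCard κ) {U W : ZFSet.{u}} (h : ramseyMeasureOrder κ U W) :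
    rank (jU κ U κ) < rank (jU κ W κ) := by
  have hMN := MU_mono h
  obtain ⟨hU, hW, hm⟩ := h
  have ru := hU.rms
  have rw' := hW.rms
  have := ru.tm
  have := rw'.tm
  have hκU := ru.mem
  have uf := ru.uf
  have hMN' : ∀ {x}, x ∈ MU κ U → x ∈ NU κ W := fun hx => MU_sub_NU hW (hMN hx)
  have hphi := Phi_elem rw'.mem hW.up (Phi_true hR rw')
  obtain ⟨θ, hθ, ρ, hρ, h1, h2⟩ := hphi κ (em_kappa rw'.toRM hW.up) U hm (by
    rintro S hS ⟨f0, hf0, -⟩ hSb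
    by_contra hcon
    push Not at hcon
    choose! nx hnx hlt using hcon
    let s : ℕ → ZFSet := fun n => nx^[n] f0
    have hs : ∀ n, s n ∈ S := by
      intro n
      induction n with
      | zero => exact hf0
      | succ n ih =>
        simp only [s, Function.iterate_succ_apply'] at ih ⊢
        exact hnx _ ih
    have hs' : ∀ n, LT' U κ (s (n+1)) (s n) := by
      intro n
      have := hlt _ (hs n)
      simpa only [s, Function.iterate_succ_apply'] using this
    choose A hA hA' using hs'
    obtain ⟨η, hη⟩ := ru.oi A hA
    have hηκ : η ∈ κ := (uf.1 _ (hA 0)).2 (hη 0)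
    have := fun n => hA' n η hηκ (hη n)
    choose a ha hp hb using this
    exact (wellFounded_iff_isEmpty_descending_chain.1 ZFSet.mem_wf).false
      ⟨a, fun n => hb (n+1) _ (ha n) (hp n)⟩)
  refine lt_of_le_of_lt ?_ (rank_lt_of_mem hθ)
  have hNtr := hW.up.1
  have hθN : θ ∈ NU κ W := hNtr _ (hW.up.2.1 κ rw'.mem) hθ
  let p : ZFSet.{u} → ZFSet.{u} := fun f => f ∩ prod κ κ
  have hpM : ∀ f ∈ MU κ U, p f ∈ MU κ U := fun f hf => TM.of dfn
  have hpS : ∀ f, Sb (p f) κ := fun f q hq => mem_prod.1 (mem_inter.1 hq).2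
  have main : ∀ f, f ∈ FF κ (MU κ U) → AE κ U (fun ξ => fapp f ξ ∈ κ) → ∀ y, pair (p f) y ∈ ρ →
      rank (cu ru.toRM f) ≤ rank y := by
    intro f
    induction f using (UR_wf (κ := κ) (M := MU κ U) ru.oi).induction with
    | _ f ih =>
    intro hf hfκ y hy
    have hfM := (mem_FF.1 hf).1
    rw [rank_le_iff]
    intro z hz
    obtain ⟨g, hg, hgf, rfl⟩ := (mem_cu ru.toRM hf).1 hz
    have hgM := (mem_FF.1 hg).1
    obtain ⟨y', hy', hpy'⟩ := h1 (p g) (hMN' (hpM g hgM)) (hpS g)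
    have hgκ : AE κ U (fun ξ => fapp g ξ ∈ κ) :=
      AE.mono2 uf hgf hfκ (TM.of dfn) fun ξ hξ h1 h2 => KC.tr h2 h1
    refine lt_of_le_of_lt (ih g ⟨hg, hf, hgf⟩ hg hgκ y' hpy') (rank_lt_of_mem ?_)
    refine h2 (p g) (hMN' (hpM g hgM)) (p f) (hMN' (hpM f hfM)) y' (hNtr _ hθN hy') y
      (mem_of_pair_mem hNtr hρ hy).2 (hpS g) (hpS f) hpy' hy ?_
    refine ⟨_, uf.inter hgf hgκ, fun η hη hηs => ⟨fapp g η, ?_, ?_, fun b hb hfb => ?_⟩⟩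
    · exact (mem_sep.1 (mem_inter.1 hηs).2).2
    · exact mem_inter.2 ⟨(mem_FF.1 hg).2.fapp_mem hη, pair_mem_prod.2 ⟨hη, (mem_sep.1 (mem_inter.1 hηs).2).2⟩⟩
    · rw [← (mem_FF.1 hf).2.fapp_eq (mem_inter.1 hfb).1]
      exact (mem_sep.1 (mem_inter.1 hηs).1).2
  rw [em_j ru.toRM hU.up hκU, rank_le_iff]
  intro x hx
  obtain ⟨f, hf, hfk, rfl⟩ := (mem_cu ru.toRM (const_FF ru.toRM hκU)).1 hx
  have hfM := (mem_FF.1 hf).1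
  obtain ⟨y, hy, hpy⟩ := h1 (p f) (hMN' (hpM f hfM)) (hpS f)
  refine lt_of_le_of_lt (main f hf ?_ y hpy) (rank_lt_of_mem hy)
  exact AE.mono uf hfk (TM.of dfn) fun ξ hξ h => by rwa [fapp_mkf hξ] at h

theorem order_acc (hR : IsRamseyCard κ) (U : ZFSet.{u}) : Acc (ramseyMeasureOrder κ) U := by
  have : WellFounded (ramseyMeasureOrder κ) :=
    Subrelation.wf (fun {U W} h => mu_lt hR h) (InvImage.wf (fun U => rank (jU κ U κ)) Ordinal.lt_wf)
  exact this.apply U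

end

set_option linter.unusedSectionVars false

/-! ### The main induction -/

theorem main_thm (κ : ZFSet.{u}) (hκ : IsRamseyCard κ) (α : Ordinal.{u+1}) (hα : α < cardSuccOrd κ) :
    ∃ U : ZFSet.{u}, IsRamseyMeasure κ U ∧ α ≤ relRank (ramseyMeasureOrder κ) U := by
  have hKC : KC κ := ramsey_KC hκ
  have hinf : Cardinal.aleph0 ≤ zcard κ := KC.inf (κ := κ)
  induction α using WellFoundedLT.induction with
  | _ α ih =>
  have hcard : α.card ≤ zcard κ := by
    have h1 : α.card < Order.succ (zcard κ) := Cardinal.lt_ord.1 hα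
    exact Order.lt_succ_iff.1 h1
  have hfam : ∃ F : κ.toSet → ZFSet.{u}, (∀ i, IsRamseyMeasure κ (F i) ∨ F i = ∅) ∧
      ∀ β < α, ∃ i, IsRamseyMeasure κ (F i) ∧ β ≤ relRank (ramseyMeasureOrder κ) (F i) := by
    choose V hV hV' using fun β (hβ : β < α) => ih β hβ (hβ.trans hα)
    have h2 : Cardinal.lift.{u+1} (Cardinal.mk (Set.Iio α)) ≤ Cardinal.lift.{u+2} (Cardinal.mk κ.toSet) := by
      rw [Cardinal.mk_Iio_ordinal, Cardinal.lift_lift]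
      exact Cardinal.lift_le.2 hcard
    obtain ⟨e⟩ := Cardinal.lift_mk_le'.1 h2
    let G : Set.Iio α → ZFSet.{u} := fun b => V b.1 b.2
    let F : κ.toSet → ZFSet.{u} := fun i => if h : ∃ b, e b = i then G h.choose else ∅
    refine ⟨F, fun i => ?_, fun β hβ => ?_⟩
    · by_cases h : ∃ b, e b = i
      · left
        simp only [F]
        rw [dif_pos h]
        exact hV _ _
      · right
        simp only [F]
        rw [dif_neg h]
    · let b : Set.Iio α := ⟨β, hβ⟩
      have h : ∃ b', e b' = e b := ⟨b, rfl⟩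
      have h' : h.choose = b := e.injective h.choose_spec
      refine ⟨e b, ?_⟩
      simp only [F]
      rw [dif_pos h, h']
      exact ⟨hV _ _, hV' _ hβ⟩
  obtain ⟨F, hF, hF'⟩ := hfam
  let F' : ZFSet.{u} → ZFSet.{u} := fun x => if h : x ∈ κ then F ⟨x, h⟩ else ∅
  let I := im F' κ
  have hI : ∀ x ∈ I, IsRamseyMeasure κ x ∨ x = ∅ := by
    intro x hx
    obtain ⟨a, ha, rfl⟩ := mem_im.1 hx
    simp only [F', dif_pos ha]
    exact hF _
  have hIc : ∀ i, F i ∈ I := fun i => mem_im.2 ⟨i.1, i.2, by simp only [F']; exact dif_pos i.2⟩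
  let t := (I ∪ sUnion I) ∪ κ
  have hIU : ∀ x ∈ sUnion I, x ⊆ κ := by
    intro x hx
    obtain ⟨U, hU, hxU⟩ := mem_sUnion.1 hx
    rcases hI U hU with h | rfl
    · exact h.1.2.1 x hxU
    · exact absurd hxU (notMem_empty _)
  have ht : t.IsTransitive := by
    intro x hx y hy
    rcases mem_union.1 hx with hx | hx
    · rcases mem_union.1 hx with hx | hx
      · exact mem_union.2 (Or.inl (mem_union.2 (Or.inr (mem_sUnion.2 ⟨x, hx, hy⟩))))
      · exact mem_union.2 (Or.inr (hIU x hx hy))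
    · exact mem_union.2 (Or.inr (KC.tr hx hy))
  have hIz : zcard I ≤ zcard κ := zcard_im_le _ _
  have hUz : zcard (sUnion I) ≤ zcard κ := by
    have e : (sUnion I).toSet = ⋃ U : I.toSet, U.1.toSet := by
      ext x
      simp only [Set.mem_iUnion]
      constructor
      · intro h
        obtain ⟨U, hU, hx⟩ := mem_sUnion.1 h
        exact ⟨⟨U, hU⟩, hx⟩
      · rintro ⟨U, hx⟩
        exact mem_sUnion.2 ⟨U.1, U.2, hx⟩
    have h3 : ∀ U : I.toSet, Cardinal.mk U.1.toSet ≤ zcard κ := by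
      rintro ⟨U, hU⟩
      rcases hI U hU with h | rfl
      · exact h.1.1.le
      · refine (zcard_mono (x := ∅) (y := κ) ?_)
        exact fun z hz => absurd hz (notMem_empty _)
    show Cardinal.mk (sUnion I).toSet ≤ _
    rw [e]
    refine (Cardinal.mk_iUnion_le _).trans ?_
    refine (mul_le_mul' hIz (ciSup_le' h3)).trans ?_
    rw [Cardinal.mul_eq_self hinf]
  have htu : ∀ a b : ZFSet.{u}, zcard a ≤ zcard κ → zcard b ≤ zcard κ → zcard (a ∪ b) ≤ zcard κ := by
    intro a b ha hb
    have e : (a ∪ b).toSet = a.toSet ∪ b.toSet := by ext x; exact mem_union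
    show Cardinal.mk (a ∪ b).toSet ≤ _
    rw [e]
    refine (Cardinal.mk_union_le _ _).trans ((add_le_add ha hb).trans ?_)
    rw [Cardinal.add_eq_self hinf]
  have htc : zcard t ≤ zcard κ := htu _ _ (htu _ _ hIz hUz) le_rfl
  obtain ⟨W, hW, htW⟩ := exists_measure hκ ht htc
  refine ⟨W, hW, ?_⟩
  have rm := hW.rms
  have := rm.tm
  by_contra hlt
  push Not at hlt
  obtain ⟨i, hi, hle⟩ := hF' _ hlt
  have hmem : F i ∈ MU κ W :=
    TM.tr htW (mem_union.2 (Or.inl (mem_union.2 (Or.inl (hIc i)))))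
  have hrel : ramseyMeasureOrder κ (F i) W := ⟨hi, hW, MU_sub_NU hW hmem⟩
  have hr : relRank (ramseyMeasureOrder κ) (F i) < relRank (ramseyMeasureOrder κ) W := by
    unfold relRank
    rw [dif_pos (order_acc hκ _), dif_pos (order_acc hκ _)]
    exact Acc.rank_lt_of_rel _ hrel
  exact absurd hle (not_le.2 hr)


/-- If `κ` is a Ramsey cardinal and `α < κ⁺`, then there is a Ramsey
measure on `κ` whose rank in the order `◁` (where `U ◁ W` iff `U ∈ N_W`) is at least `α`. -/
theorem exists_ramseyMeasure_of_rank_ge (κ : ZFSet) (hκ : IsRamseyCard κ)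
    (α : Ordinal) (hα : α < cardSuccOrd κ) :
    ∃ U : ZFSet, IsRamseyMeasure κ U ∧ α ≤ relRank (ramseyMeasureOrder κ) U := by
  exact main_thm κ hκ α hα

end MPaper
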